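/- arXiv:1406.5516 — 2 statements merged into one kernel-verified Lean document; each statement's English description precedes it below -/
import Mathlib

section
/- Let T ∈ 𝔯(ℍ) be bounded and such that T ∩ ℂ_I is a Jordan region in the plane ℂ_I for every unit imaginary quaternion I, and let α ∈ T̄. If f is slice regular in T and continuous on T̄, then for every ε > 0 there exists a polynomial P(q) = ∑_{k=0}^n q^k a_k such that P(α) = f(α) and sup_{q ∈ T̄} ‖f(q) − P(q)‖ < ε. -/
noncomputable section

/-- The complex plane `ℂ_I = {x + I y : x, y ∈ ℝ}` inside the quaternions, for a
unit imaginary quaternion `I`. -/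
def slicePlane (I : Quaternion ℝ) : Set (Quaternion ℝ) :=
  {q | ∃ x y : ℝ, q = (x : Quaternion ℝ) + y • I}

/-- A set `U ⊆ ℍ` is axially symmetric if `x + I y ∈ U` implies `x + J y ∈ U`
for all unit imaginary quaternions `J`. -/
def AxiallySymmetric (U : Set (Quaternion ℝ)) : Prop :=
  ∀ (x y : ℝ) (I J : Quaternion ℝ), I ^ 2 = -1 → J ^ 2 = -1 →
    ((x : Quaternion ℝ) + y • I) ∈ U → ((x : Quaternion ℝ) + y • J) ∈ U

/-- `f` is slice regular on `U`: it is real differentiable on `U` and for every unit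
imaginary quaternion `I` its restriction to `U ∩ ℂ_I` satisfies
`(1/2)(∂/∂x + I ∂/∂y) f(x + I y) = 0`. -/
def SliceRegularOn (f : Quaternion ℝ → Quaternion ℝ) (U : Set (Quaternion ℝ)) : Prop :=
  DifferentiableOn ℝ f U ∧
  ∀ (I : Quaternion ℝ), I ^ 2 = -1 → ∀ x y : ℝ, ((x : Quaternion ℝ) + y • I) ∈ U →
    fderiv ℝ (fun p : ℝ × ℝ => f ((p.1 : Quaternion ℝ) + p.2 • I)) (x, y) (1, 0)
      + I * fderiv ℝ (fun p : ℝ × ℝ => f ((p.1 : Quaternion ℝ) + p.2 • I)) (x, y) (0, 1) = 0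

/-- The slice derivative of `f` at `q`, i.e. `(∂/∂x) f`. -/
def sliceDeriv (f : Quaternion ℝ → Quaternion ℝ) (q : Quaternion ℝ) : Quaternion ℝ :=
  fderiv ℝ f q 1

/-- A quaternion is a (strictly) positive real number. -/
def IsPosReal (q : Quaternion ℝ) : Prop := ∃ r : ℝ, 0 < r ∧ q = (r : Quaternion ℝ)

/-- `f ∈ 𝒩(U)`: `f` is slice regular on `U` and preserves every slice `ℂ_I`. -/
def QIntrinsicOn (f : Quaternion ℝ → Quaternion ℝ) (U : Set (Quaternion ℝ)) : Prop :=
  SliceRegularOn f U ∧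
  ∀ (I : Quaternion ℝ), I ^ 2 = -1 → ∀ q ∈ U ∩ slicePlane I, f q ∈ slicePlane I

/-- The class `𝔯(ℍ)` of axially symmetric open sets whose intersection with every
slice plane `ℂ_I` is simply connected. -/
def MemFrakR (Ω : Set (Quaternion ℝ)) : Prop :=
  IsOpen Ω ∧ AxiallySymmetric Ω ∧
  ∀ I : Quaternion ℝ, I ^ 2 = -1 → SimplyConnectedSpace ↥(Ω ∩ slicePlane I)

/-- `S` is a Jordan region in the plane `ℂ_I`: a bounded subset of `ℂ_I`, open in `ℂ_I`,
whose boundary (inside `ℂ_I`) is a Jordan curve. -/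
def IsJordanRegionIn (I : Quaternion ℝ) (S : Set (Quaternion ℝ)) : Prop :=
  S ⊆ slicePlane I ∧ Bornology.IsBounded S ∧
  IsOpen (Subtype.val ⁻¹' S : Set ↥(slicePlane I)) ∧
  ∃ γ : Circle → ↥(slicePlane I), Continuous γ ∧ Function.Injective γ ∧
    Set.range γ = frontier (Subtype.val ⁻¹' S : Set ↥(slicePlane I))

/-- The axially symmetric completion `⋃_{x+Jy ∈ Ω, I ∈ 𝕊} {x + I y}` of a subset `Ω`
of the slice plane `ℂ_J`. -/
def axSymmCompletion (J : Quaternion ℝ) (Ω : Set (Quaternion ℝ)) : Set (Quaternion ℝ) :=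
  {q | ∃ x y : ℝ, ∃ I : Quaternion ℝ, I ^ 2 = -1 ∧
    ((x : Quaternion ℝ) + y • J) ∈ Ω ∧ q = (x : Quaternion ℝ) + y • I}

/-- The first modulus of continuity `ω₁(f; δ)` of `f` on the set `K`. -/
def omega1 (f : Quaternion ℝ → Quaternion ℝ) (K : Set (Quaternion ℝ)) (δ : ℝ) : ℝ :=
  sSup {r : ℝ | ∃ u ∈ K, ∃ v ∈ K, ‖u - v‖ ≤ δ ∧ r = ‖f u - f v‖}

section

open Topology Set Filter

theorem exists_continuous_log {X : Type*} [TopologicalSpace X] [SimplyConnectedSpace X]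
    [LocallyPathConnectedSpace X] {G : X → ℂ} (hG : Continuous G) (h0 : ∀ x, G x ≠ 0) :
    ∃ h : X → ℂ, Continuous h ∧ ∀ x, Complex.exp (h x) = G x := by
  obtain ⟨x₀⟩ : Nonempty X := inferInstance
  let f : C(X, {z : ℂ // z ≠ 0}) := ⟨fun x => ⟨G x, h0 x⟩, by fun_prop⟩
  obtain ⟨F, hF, -⟩ := Complex.isCoveringMap_exp.existsUnique_continuousMap_lifts f x₀
    (Complex.log (G x₀)) (Subtype.ext (Complex.exp_log (h0 x₀)))
  exact ⟨F, F.continuous, fun x => congrArg Subtype.val (congrFun hF.2 x)⟩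

theorem eq_of_continuous_of_exp_eq_exp {X : Type*} [TopologicalSpace X] [PreconnectedSpace X]
    {g h : X → ℂ} (hg : Continuous g) (hh : Continuous h)
    (he : ∀ x, Complex.exp (g x) = Complex.exp (h x)) {x₀ : X} (h0 : g x₀ = h x₀) : g = h :=
  Complex.isCoveringMap_exp.eq_of_comp_eq hg hh (funext fun x => Subtype.ext (he x)) x₀ h0

theorem eq_zero_of_exp_eq_zpow {a : ℂ} {R : ℝ} (hR : 0 < R) {n : ℤ} {h : ℂ → ℂ}
    (hh : Continuous h) (he : ∀ z, ‖z - a‖ = R → Complex.exp (h z) = (z - a) ^ n) : n = 0 := by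
  have key := eq_of_continuous_of_exp_eq_exp (X := ℝ)
    (g := fun t => h (a + R * Complex.exp (t * Complex.I)))
    (h := fun t => h (a + R) + n * (t * Complex.I)) (by fun_prop) (by fun_prop)
    (fun t => by
      rw [he _ (by simp [Complex.norm_exp, abs_of_pos hR]), Complex.exp_add,
        he _ (by simp [abs_of_pos hR]), Complex.exp_int_mul]
      simp [mul_zpow]) (x₀ := 0) (by simp)
  have h2 := congrFun key (2 * Real.pi)
  simp only [Complex.ofReal_mul, Complex.ofReal_ofNat, Complex.exp_two_pi_mul_I, mul_one,
    left_eq_add] at h2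
  simpa [Complex.two_pi_I_ne_zero, Real.pi_ne_zero] using h2

/-- A power of `z - a` that extends without zeros from the frontier of a bounded open set
containing `a` to its closure is trivial. -/
theorem eq_zero_of_zpow_extends {U : Set ℂ} (hUo : IsOpen U) (hUb : Bornology.IsBounded U)
    {a : ℂ} (ha : a ∈ U) {n : ℤ} {k : ℂ → ℂ} (hk : ContinuousOn k (closure U))
    (hk0 : ∀ z ∈ closure U, k z ≠ 0) (hfr : ∀ z ∈ frontier U, (z - a) ^ n = k z) : n = 0 := by
  classical
  have hcont : Continuous (U.piecewise k (fun z => (z - a) ^ n)) := by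
    apply continuous_piecewise
    · exact fun z hz => (hfr z hz).symm
    · exact hk
    · intro z hz
      have : z ∉ U := by
        rw [closure_compl, hUo.interior_eq] at hz; exact hz
      have hne : z - a ≠ 0 := fun h => this (by rwa [sub_eq_zero.1 h])
      exact ((continuousAt_id.sub continuousAt_const).zpow₀ n (Or.inl hne)).continuousWithinAt
  have hne : ∀ z, U.piecewise k (fun z => (z - a) ^ n) z ≠ 0 := by
    intro z
    by_cases hz : z ∈ U
    · simpa [hz] using hk0 z (subset_closure hz)
    · simp only [hz, not_false_eq_true, piecewise_eq_of_notMem]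
      exact zpow_ne_zero _ fun h => hz (by rwa [sub_eq_zero.1 h])
  obtain ⟨h, hh, he⟩ := exists_continuous_log hcont hne
  obtain ⟨R, hR0, hR⟩ := hUb.subset_ball_lt 0 a
  refine eq_zero_of_exp_eq_zpow hR0 hh (a := a) fun z hz => ?_
  have : z ∉ U := fun h' => by
    have := hR h'
    rw [Metric.mem_ball, dist_eq_norm] at this
    exact this.ne hz
  rw [he]; simp [this]

/-- A continuous nowhere vanishing function on the circle is a power times an exponential. -/
theorem Circle.exists_zpow_mul_exp {φ : Circle → ℂ} (hφ : Continuous φ) (h0 : ∀ w, φ w ≠ 0) :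
    ∃ (n : ℤ) (H : Circle → ℂ), Continuous H ∧ ∀ w : Circle, φ w = (w : ℂ) ^ n * Complex.exp (H w) := by
  obtain ⟨h, hh, he⟩ := exists_continuous_log (X := ℝ) (G := fun t => φ (Circle.exp t))
    (by fun_prop) (fun t => h0 _)
  have hper : ∀ t : ℝ, Complex.exp (h (t + 2 * Real.pi)) = Complex.exp (h t) := fun t => by
    rw [he, he, Circle.exp_add, Circle.exp_two_pi, mul_one]
  obtain ⟨n, hn⟩ := Complex.exp_eq_exp_iff_exists_int.1 (hper 0)
  have key := eq_of_continuous_of_exp_eq_exp (X := ℝ) (g := fun t => h (t + 2 * Real.pi))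
    (h := fun t => h t + n * (2 * Real.pi * Complex.I)) (by fun_prop) (by fun_prop)
    (fun t => by rw [hper, Complex.exp_add, Complex.exp_int_mul_two_pi_mul_I, mul_one])
    (x₀ := 0) hn
  let g : ℝ → ℂ := fun t => h t - n * (t * Complex.I)
  have hg : Function.Periodic g (2 * Real.pi) := fun t => by
    have := congrFun key t
    simp only [g] at this ⊢
    rw [this]; push_cast; ring
  have hgc : Continuous (hg.lift : AddCircle (2 * Real.pi) → ℂ) :=
    continuous_coinduced_dom.2 (by
      change Continuous g
      fun_prop)
  refine ⟨n, fun w => hg.lift (AddCircle.homeomorphCircle'.symm w),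
    hgc.comp (Homeomorph.continuous _), fun w => ?_⟩
  obtain ⟨t, rfl⟩ : ∃ t : ℝ, Circle.exp t = w := ⟨_, Circle.exp_arg w⟩
  have e1 : AddCircle.homeomorphCircle'.symm (Circle.exp t) = ((t : ℝ) : AddCircle (2 * Real.pi)) := by
    rw [← AddCircle.homeomorphCircle'_apply_mk, Homeomorph.symm_apply_apply]
  have e2 : hg.lift (AddCircle.homeomorphCircle'.symm (Circle.exp t)) = g t := by
    rw [e1, hg.lift_coe]
  beta_reduce
  rw [e2, ← he, Circle.coe_exp, ← Complex.exp_int_mul, ← Complex.exp_add]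
  simp only [g]
  congr 1; ring

/-- Two bounded open sets lying off a Jordan curve, with frontiers inside it, intersect. -/
theorem not_disjoint_of_frontier_subset_range {γ : Circle → ℂ} (hγ : Continuous γ)
    (hinj : Function.Injective γ) {U V : Set ℂ} (hU : IsOpen U) (hUb : Bornology.IsBounded U)
    (hUne : U.Nonempty) (hUf : frontier U ⊆ range γ) (hUγ : Disjoint U (range γ))
    (hV : IsOpen V) (hVb : Bornology.IsBounded V) (hVne : V.Nonempty)
    (hVf : frontier V ⊆ range γ) (hVγ : Disjoint V (range γ)) :
    ¬ Disjoint U V := by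
  intro hd
  obtain ⟨a, ha⟩ := hUne
  obtain ⟨b, hb⟩ := hVne
  have hbU : b ∉ closure U := fun h =>
    disjoint_left.1 (hd.closure_left hV) h hb
  have haV : a ∉ closure V := fun h =>
    disjoint_left.1 (hd.symm.closure_left hU) h ha
  have hemb : IsClosedEmbedding γ := hγ.isClosedEmbedding hinj
  have haγ : ∀ w, γ w - a ≠ 0 := fun w h =>
    disjoint_left.1 hUγ ha ⟨w, sub_eq_zero.1 h⟩
  have hbγ : ∀ w, γ w - b ≠ 0 := fun w h =>
    disjoint_left.1 hVγ hb ⟨w, sub_eq_zero.1 h⟩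
  have key : ∀ {W : Set ℂ} {c d : ℂ}, IsOpen W → Bornology.IsBounded W → c ∈ W →
      d ∉ closure W → frontier W ⊆ range γ → ∀ (p q : ℤ) (H : Circle → ℂ), Continuous H →
      (∀ w, (γ w - c) ^ p = (γ w - d) ^ q * Complex.exp (H w)) → p = 0 := by
    intro W c d hW hWb hc hd hWf p q H hH hw
    obtain ⟨g, hg⟩ := ContinuousMap.exists_extension hemb ⟨H, hH⟩
    have hgw : ∀ w, g (γ w) = H w := fun w => congrFun (congrArg DFunLike.coe hg) w
    have hne : ∀ z ∈ closure W, z - d ≠ 0 := fun z hz h => hd (by rwa [← sub_eq_zero.1 h])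
    refine eq_zero_of_zpow_extends hW hWb hc (k := fun z => (z - d) ^ q * Complex.exp (g z))
      ?_ ?_ ?_
    · refine ContinuousOn.mul ?_ (by fun_prop)
      exact ContinuousOn.zpow₀ (by fun_prop) q fun z hz => Or.inl (hne z hz)
    · exact fun z hz => mul_ne_zero (zpow_ne_zero _ (hne z hz)) (Complex.exp_ne_zero _)
    · intro z hz
      obtain ⟨w, rfl⟩ := hWf hz
      simp only [hgw, hw]
  obtain ⟨n, H, hH, hn⟩ := Circle.exists_zpow_mul_exp (φ := fun w => γ w - a) (by fun_prop) haγ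
  obtain ⟨m, H', hH', hm⟩ := Circle.exists_zpow_mul_exp (φ := fun w => γ w - b) (by fun_prop) hbγ
  have hm0 : m = 0 := by
    refine key hU hUb ha hbU hUf m n (fun w => m * H w - n * H' w) (by fun_prop) fun w => ?_
    rw [hn, hm, mul_zpow, mul_zpow, ← Complex.exp_int_mul, ← Complex.exp_int_mul, ← zpow_mul,
      ← zpow_mul, mul_assoc, ← Complex.exp_add, mul_comm n m]
    congr 2; ring
  have hn0 : n = 0 := by
    refine key hV hVb hb haV hVf n m (fun w => n * H' w - m * H w) (by fun_prop) fun w => ?_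
    rw [hn, hm, mul_zpow, mul_zpow, ← Complex.exp_int_mul, ← Complex.exp_int_mul, ← zpow_mul,
      ← zpow_mul, mul_assoc, ← Complex.exp_add, mul_comm n m]
    congr 2; ring
  have := key hU hUb ha hbU hUf 1 0 H hH fun w => by simp [hn, hn0]
  exact one_ne_zero this

/-- The complement of the closure of a Jordan region has no bounded component. -/
theorem not_isBounded_component_of_jordan {γ : Circle → ℂ} (hγ : Continuous γ)
    (hinj : Function.Injective γ) {U : Set ℂ} (hU : IsOpen U) (hUb : Bornology.IsBounded U)
    (hUne : U.Nonempty) (hUf : frontier U = range γ) {p : ℂ} (hp : p ∉ closure U) :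
    ¬ Bornology.IsBounded (connectedComponentIn (closure U)ᶜ p) := by
  intro hb
  set V := connectedComponentIn (closure U)ᶜ p with hV
  have hVo : IsOpen V := isClosed_closure.isOpen_compl.connectedComponentIn
  have hVs : V ⊆ (closure U)ᶜ := connectedComponentIn_subset _ _
  have hpV : p ∈ V := mem_connectedComponentIn hp
  have hUV : Disjoint U V := disjoint_left.2 fun x hx hx' => hVs hx' (subset_closure hx)
  have hfU : ∀ x ∈ frontier U, x ∈ closure U := fun x hx => frontier_subset_closure hx
  refine not_disjoint_of_frontier_subset_range hγ hinj hU hUb hUne hUf.le ?_ hVo hb ⟨p, hpV⟩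
    ?_ ?_ hUV
  · rw [← hUf]; exact disjoint_left.2 fun x hx hx' => by
      rw [hU.frontier_eq] at hx'; exact hx'.2 hx
  · intro x hx
    rw [hVo.frontier_eq] at hx
    have hxU : x ∉ U := fun h => disjoint_left.1 (hUV.symm.closure_left hU) hx.1 h
    by_cases hxc : x ∈ closure U
    · rw [← hUf, hU.frontier_eq]; exact ⟨hxc, hxU⟩
    · refine absurd ?_ hx.2
      have h1 : IsPreconnected (insert x V) :=
        isPreconnected_connectedComponentIn.subset_closure (subset_insert _ _)
          (insert_subset hx.1 subset_closure)
      exact h1.subset_connectedComponentIn (mem_insert_of_mem _ hpV)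
        (insert_subset hxc hVs) (mem_insert _ _)
  · rw [← hUf]; exact disjoint_left.2 fun x hx hx' => hVs hx (hfU x hx')

open scoped ComplexOrder in
theorem frontier_subset_closure_compl_of_jordan {γ : Circle → ℂ} (hγ : Continuous γ)
    (hinj : Function.Injective γ) {U : Set ℂ} (hU : IsOpen U) (hUb : Bornology.IsBounded U)
    (hUne : U.Nonempty) (hUf : frontier U = range γ) :
    frontier U ⊆ closure (closure U)ᶜ := by
  intro x hx
  by_contra hcon
  rw [hUf] at hx
  obtain ⟨w₀, rfl⟩ := hx
  obtain ⟨a, ha⟩ := hUne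
  have hw0 : γ w₀ ∈ interior (closure U) := by
    rw [closure_compl] at hcon; simpa using hcon
  set W := interior (closure U)
  have haW : a ∈ W := interior_maximal subset_closure hU ha
  have hWf : frontier W ⊆ range γ := by
    rw [← hUf]
    exact frontier_interior_subset.trans frontier_closure_subset
  have haγ : ∀ w, γ w - a ≠ 0 := fun w h => by
    have : a ∈ frontier U := hUf ▸ ⟨w, sub_eq_zero.1 h⟩
    rw [hU.frontier_eq] at this
    exact this.2 ha
  obtain ⟨n, H, hH, hn⟩ := Circle.exists_zpow_mul_exp (φ := fun w => γ w - a) (by fun_prop) haγ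
  let T : Set Circle := γ ⁻¹' frontier W
  have hT : IsClosed T := isClosed_frontier.preimage hγ
  have hw0T : ∀ w ∈ T, w ≠ w₀ := by
    rintro w hw rfl
    have : γ w ∈ frontier W := hw
    rw [isOpen_interior.frontier_eq] at this
    exact this.2 hw0
  have hslit : ∀ w : T, -((w : Circle) : ℂ) / (w₀ : ℂ) ∈ Complex.slitPlane := by
    rintro ⟨w, hw⟩
    by_contra hs
    have h1 : ‖-(w : ℂ) / (w₀ : ℂ)‖ = 1 := by
      rw [norm_div, norm_neg, Circle.norm_coe, Circle.norm_coe, div_one]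
    rw [Complex.mem_slitPlane_iff_not_le_zero, not_not] at hs
    have h2 := Complex.eq_coe_norm_of_nonneg (neg_nonneg.2 hs)
    rw [norm_neg, h1] at h2
    refine hw0T w hw (Subtype.ext ?_)
    have h3 : -(-(w : ℂ) / (w₀ : ℂ)) = (w : ℂ) / w₀ := by ring
    rw [h3, Complex.ofReal_one, div_eq_one_iff_eq (Circle.coe_ne_zero _)] at h2
    exact h2
  have hemb : IsClosedEmbedding (fun w : T => γ w) :=
    (hγ.isClosedEmbedding hinj).comp hT.isClosedEmbedding_subtypeVal
  obtain ⟨g, hg⟩ := ContinuousMap.exists_extension hemb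
    ⟨fun w : T => H w + n * (Complex.log (-((w : Circle) : ℂ) / (w₀ : ℂ)) +
      Complex.log (-(w₀ : ℂ))), by
      have : Continuous fun w : T => Complex.log (-((w : Circle) : ℂ) / (w₀ : ℂ)) :=
        Continuous.clog (by fun_prop) hslit
      fun_prop⟩
  have : (1 : ℤ) = 0 := by
    refine eq_zero_of_zpow_extends isOpen_interior
      (hUb.closure.subset interior_subset) haW (k := fun z => Complex.exp (g z))
      (by fun_prop) (fun z _ => Complex.exp_ne_zero _) fun z hz => ?_
    obtain ⟨w, rfl⟩ := hWf hz
    have e1 := congrFun (congrArg DFunLike.coe hg) ⟨w, hz⟩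
    simp only [ContinuousMap.comp_apply, ContinuousMap.coe_mk] at e1
    have hw00 : (w₀ : ℂ) ≠ 0 := Circle.coe_ne_zero _
    have hw1 : (w : ℂ) ≠ 0 := Circle.coe_ne_zero _
    rw [e1, zpow_one, hn, Complex.exp_add, Complex.exp_int_mul, Complex.exp_add,
      Complex.exp_log (by simp), Complex.exp_log (by simp), mul_comm]
    congr 2
    field_simp
  exact one_ne_zero this

end

section

open Topology Set Filter

/-- `g` is a uniform limit on `K` of complex polynomials. -/
def PolyApprox (K : Set ℂ) (g : ℂ → ℂ) : Prop :=
  ∀ ε > 0, ∃ p : Polynomial ℂ, ∀ z ∈ K, ‖g z - p.eval z‖ ≤ ε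

namespace PolyApprox

variable {K : Set ℂ} {g h : ℂ → ℂ}

theorem poly (p : Polynomial ℂ) : PolyApprox K (fun z => p.eval z) :=
  fun ε hε => ⟨p, fun z _ => by simpa using hε.le⟩

theorem const (c : ℂ) : PolyApprox K (fun _ => c) := by
  simpa using poly (K := K) (Polynomial.C c)

theorem id : PolyApprox K (fun z => z) := by
  simpa using poly (K := K) Polynomial.X

theorem congr (hg : PolyApprox K g) (h' : ∀ z ∈ K, h z = g z) : PolyApprox K h := fun ε hε => by
  obtain ⟨p, hp⟩ := hg ε hε
  exact ⟨p, fun z hz => by rw [h' z hz]; exact hp z hz⟩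

theorem of_uniform (hg : ∀ ε > 0, ∃ h, PolyApprox K h ∧ ∀ z ∈ K, ‖g z - h z‖ ≤ ε) :
    PolyApprox K g := fun ε hε => by
  obtain ⟨h, hh, hgh⟩ := hg (ε / 2) (half_pos hε)
  obtain ⟨p, hp⟩ := hh (ε / 2) (half_pos hε)
  refine ⟨p, fun z hz => ?_⟩
  have := norm_sub_le_norm_sub_add_norm_sub (g z) (h z) (p.eval z)
  linarith [hgh z hz, hp z hz]

theorem add (hg : PolyApprox K g) (hh : PolyApprox K h) : PolyApprox K (fun z => g z + h z) := by
  intro ε hε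
  obtain ⟨p, hp⟩ := hg (ε / 2) (half_pos hε)
  obtain ⟨q, hq⟩ := hh (ε / 2) (half_pos hε)
  refine ⟨p + q, fun z hz => ?_⟩
  rw [Polynomial.eval_add, add_sub_add_comm]
  linarith [norm_add_le (g z - p.eval z) (h z - q.eval z), hp z hz, hq z hz]

theorem exists_bound (hK : IsCompact K) (hg : PolyApprox K g) :
    ∃ M > 0, ∀ z ∈ K, ‖g z‖ ≤ M := by
  obtain ⟨p, hp⟩ := hg 1 one_pos
  obtain ⟨C, hC⟩ := hK.exists_bound_of_continuousOn (f := fun z => p.eval z) (by fun_prop)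
  refine ⟨|C| + 1, by positivity, fun z hz => ?_⟩
  have := norm_le_norm_sub_add (g z) (p.eval z)
  linarith [hp z hz, hC z hz, le_abs_self C]

theorem mul (hK : IsCompact K) (hg : PolyApprox K g) (hh : PolyApprox K h) :
    PolyApprox K (fun z => g z * h z) := by
  obtain ⟨M, hM, hMg⟩ := hg.exists_bound hK
  refine of_uniform fun ε hε => ?_
  obtain ⟨q, hq⟩ := hh (ε / M) (by positivity)
  refine ⟨fun z => g z * q.eval z, ?_, fun z hz => ?_⟩
  · obtain ⟨N, hN, hNq⟩ := (poly (K := K) q).exists_bound hK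
    intro η hη
    obtain ⟨p, hp⟩ := hg (η / N) (by positivity)
    refine ⟨p * q, fun z hz => ?_⟩
    rw [Polynomial.eval_mul, ← sub_mul, norm_mul]
    calc _ ≤ η / N * N := by gcongr; exacts [hp z hz, hNq z hz]
      _ = η := by field_simp
  · rw [← mul_sub, norm_mul]
    calc _ ≤ M * (ε / M) := by gcongr; exacts [hMg z hz, hq z hz]
      _ = ε := by field_simp

theorem const_mul (hK : IsCompact K) (c : ℂ) (hg : PolyApprox K g) :
    PolyApprox K (fun z => c * g z) := (const c).mul hK hg

theorem neg (hK : IsCompact K) (hg : PolyApprox K g) : PolyApprox K (fun z => - g z) := by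
  simpa using hg.const_mul hK (-1)

theorem sub (hK : IsCompact K) (hg : PolyApprox K g) (hh : PolyApprox K h) :
    PolyApprox K (fun z => g z - h z) := by
  simpa [sub_eq_add_neg] using hg.add (hh.neg hK)

theorem pow (hK : IsCompact K) (hg : PolyApprox K g) (n : ℕ) :
    PolyApprox K (fun z => g z ^ n) := by
  induction n with
  | zero => simpa using const (K := K) 1
  | succ n ih => simpa [pow_succ] using ih.mul hK hg

theorem sum {ι : Type*} (s : Finset ι) {g : ι → ℂ → ℂ} (hg : ∀ i ∈ s, PolyApprox K (g i)) :
    PolyApprox K (fun z => ∑ i ∈ s, g i z) := by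
  classical
  induction s using Finset.induction_on with
  | empty => simpa using const (K := K) 0
  | insert i s hi ih =>
    simp only [Finset.sum_insert hi]
    exact (hg i (by simp)).add (ih fun j hj => hg j (by simp [hj]))

/-- Composition with a function holomorphic on a disc containing the values. -/
theorem comp (hK : IsCompact K) (hg : PolyApprox K g) {φ : ℂ → ℂ} {c : ℂ} {ρ R : ℝ} (hρ : 0 ≤ ρ)
    (hρR : ρ < R) (hφ : DifferentiableOn ℂ φ (Metric.ball c R))
    (hgK : ∀ z ∈ K, ‖g z - c‖ ≤ ρ) : PolyApprox K (fun z => φ (g z)) := by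
  obtain ⟨r, hr1, hr2⟩ := exists_between hρR
  obtain ⟨s, hs1, hs2⟩ := exists_between hr1
  lift r to NNReal using hρ.trans hr1.le
  lift s to NNReal using hρ.trans hs1.le
  have hp := (hφ.mono (Metric.closedBall_subset_ball hr2)).hasFPowerSeriesOnBall
    (by exact_mod_cast lt_of_le_of_lt hρ hr1)
  have hu := hp.tendstoUniformlyOn (r' := s) (by exact_mod_cast hs2)
  rw [Metric.tendstoUniformlyOn_iff] at hu
  refine of_uniform fun ε hε => ?_
  obtain ⟨n, hn⟩ := (hu ε hε).exists
  refine ⟨fun z => (cauchyPowerSeries φ c r).partialSum n (g z - c), ?_, fun z hz => ?_⟩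
  · simp only [FormalMultilinearSeries.partialSum]
    refine sum _ fun i _ => ?_
    simp only [FormalMultilinearSeries.apply_eq_pow_smul_coeff, smul_eq_mul]
    exact ((hg.sub hK (const c)).pow hK i).mul hK (const _)
  · have := hn (g z - c) (by
      rw [mem_ball_zero_iff]; exact (hgK z hz).trans_lt hs1)
    rw [dist_eq_norm] at this
    simpa using this.le

theorem one_add_inv (hK : IsCompact K) (hg : PolyApprox K g) (h : ∀ z ∈ K, ‖g z‖ ≤ 1 / 2) :
    PolyApprox K (fun z => (1 + g z)⁻¹) := by
  refine hg.comp hK (φ := fun w => (1 + w)⁻¹) (c := 0) (ρ := 1 / 2) (R := 1) (by norm_num)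
    (by norm_num) ?_ (by simpa using h)
  refine DifferentiableOn.inv (by fun_prop) fun w hw h => ?_
  rw [mem_ball_zero_iff, ← norm_neg, ← eq_neg_of_add_eq_zero_left h] at hw
  simp at hw

/-- Pole pushing: inverses `(z - p)⁻¹` with poles off `K` are uniform limits of polynomials. -/
theorem inv_sub (hK : IsCompact K) {p : ℂ} (hp : p ∉ K)
    (hub : ¬ Bornology.IsBounded (connectedComponentIn Kᶜ p)) :
    PolyApprox K (fun z => (z - p)⁻¹) := by
  have hKo : IsOpen Kᶜ := hK.isClosed.isOpen_compl
  obtain ⟨M, hM0, hM⟩ := hK.isBounded.exists_pos_norm_le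
  obtain ⟨p₀, hp₀, hp₀M⟩ : ∃ p₀ ∈ connectedComponentIn Kᶜ p, 2 * M < ‖p₀‖ := by
    by_contra! hcon
    exact hub (isBounded_iff_forall_norm_le.2 ⟨_, hcon⟩)
  have step : ∀ x y : ℂ, x ∉ K → y ∉ K → (∀ z ∈ K, ‖x - y‖ ≤ 1 / 2 * ‖z - x‖) →
      PolyApprox K (fun z => (z - x)⁻¹) → PolyApprox K (fun z => (z - y)⁻¹) := by
    intro x y hx hy hxy hax
    have h1 : PolyApprox K (fun z => (1 + (x - y) * (z - x)⁻¹)⁻¹) := by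
      refine (hax.const_mul hK (x - y)).one_add_inv hK fun z hz => ?_
      have hne : 0 < ‖z - x‖ := norm_pos_iff.2 (sub_ne_zero.2 fun h => hx (h ▸ hz))
      rw [norm_mul, norm_inv, ← div_eq_mul_inv, div_le_iff₀ hne]
      exact hxy z hz
    refine (hax.mul hK h1).congr fun z hz => ?_
    have hne : z - x ≠ 0 := sub_ne_zero.2 fun h => hx (h ▸ hz)
    have hne' : z - y ≠ 0 := sub_ne_zero.2 fun h => hy (h ▸ hz)
    rw [← mul_inv, mul_add, mul_one, mul_comm (x - y), mul_inv_cancel_left₀ hne]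
    congr 1; ring
  have base : PolyApprox K (fun z => (z - p₀)⁻¹) := by
    have hp00 : p₀ ≠ 0 := norm_pos_iff.1 (by linarith)
    have h1 : PolyApprox K (fun z => (1 + (-p₀⁻¹) * z)⁻¹) := by
      refine (PolyApprox.id.const_mul hK _).one_add_inv hK fun z hz => ?_
      rw [norm_mul, norm_neg, norm_inv, inv_mul_le_iff₀ (norm_pos_iff.2 hp00)]
      linarith [hM z hz]
    refine (h1.const_mul hK (-p₀⁻¹)).congr fun z hz => ?_
    rw [← inv_neg, ← mul_inv]
    congr 1
    field_simp
    ring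
  refine (isPreconnected_connectedComponentIn.induction₂'
    (fun x y => PolyApprox K (fun z => (z - x)⁻¹) → PolyApprox K (fun z => (z - y)⁻¹))
    (fun x hx => ?_) (fun x y z _ _ _ hxy hyz h => hyz (hxy h)) hp₀
    (mem_connectedComponentIn hp)) base
  have hxK : x ∉ K := connectedComponentIn_subset _ _ hx
  obtain ⟨r, hr, hball⟩ := Metric.isOpen_iff.1 hKo x hxK
  have hd : ∀ z ∈ K, r ≤ ‖z - x‖ := fun z hz => by
    by_contra! h
    exact hball (by rwa [Metric.mem_ball, dist_eq_norm]) hz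
  filter_upwards [nhdsWithin_le_nhds (Metric.ball_mem_nhds x (show 0 < r / 4 by linarith))] with y hy
  rw [Metric.mem_ball, dist_eq_norm, norm_sub_rev] at hy
  have hyK : y ∉ K := fun h => by have := hd y h; rw [norm_sub_rev] at this; linarith
  refine ⟨step x y hxK hyK fun z hz => ?_, step y x hyK hxK fun z hz => ?_⟩
  · linarith [hd z hz]
  · rw [norm_sub_rev]
    have := norm_sub_le_norm_sub_add_norm_sub z y x
    rw [norm_sub_rev y x] at this
    linarith [hd z hz]

theorem sqrt_one_add (hK : IsCompact K) (hg : PolyApprox K g) (h : ∀ z ∈ K, ‖g z‖ ≤ 1 / 2) :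
    ∃ S, PolyApprox K S ∧ (∀ z ∈ K, S z ^ 2 = 1 + g z) ∧ ∀ z ∈ K, 0 < (S z).re := by
  have hslit : ∀ w : ℂ, ‖w‖ < 1 → 1 + w ∈ Complex.slitPlane := fun w hw =>
    Complex.mem_slitPlane_of_norm_lt_one hw
  refine ⟨fun z => Complex.exp (Complex.log (1 + g z) / 2), ?_, fun z hz => ?_, fun z hz => ?_⟩
  · refine hg.comp hK (φ := fun w => Complex.exp (Complex.log (1 + w) / 2)) (c := 0) (ρ := 1 / 2)
      (R := 1) (by norm_num) (by norm_num) ?_ (by simpa using h)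
    refine (DifferentiableOn.div_const (DifferentiableOn.clog (by fun_prop) fun w hw => ?_) _).cexp
    exact hslit w (by simpa using hw)
  · have hs := hslit (g z) ((h z hz).trans_lt (by norm_num))
    rw [← Complex.exp_nat_mul, Nat.cast_ofNat, mul_div_cancel₀ _ two_ne_zero,
      Complex.exp_log (Complex.slitPlane_ne_zero hs)]
  · have hs := hslit (g z) ((h z hz).trans_lt (by norm_num))
    rw [Complex.exp_re]
    refine mul_pos (Real.exp_pos _) (Real.cos_pos_of_mem_Ioo ?_)
    have h1 := Complex.neg_pi_lt_arg (1 + g z)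
    have h2 := Complex.arg_le_pi (1 + g z)
    have h3 : (Complex.log (1 + g z) / 2).im = Complex.arg (1 + g z) / 2 := by
      rw [show (2 : ℂ) = ((2 : ℝ) : ℂ) by simp, Complex.div_ofReal_im, Complex.log_im]
    have h4 := Complex.mem_slitPlane_iff_arg.1 hs
    have h5 := lt_of_le_of_ne h2 h4.1
    rw [h3]
    constructor <;> linarith

/-- A holomorphic square root of `(z - p) / (z - q)` for `p`, `q` joined by a connected set off
`K`, normalised to have positive real part far from this set. -/
theorem exists_sqrt_div (hK : IsCompact K) {s : Set ℂ} (hs : IsPreconnected s) {c : ℂ} {r : ℝ}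
    (hsr : s ⊆ Metric.closedBall c r) (hsK : Disjoint s K)
    (hinv : ∀ p ∈ s, PolyApprox K (fun z => (z - p)⁻¹)) {p q : ℂ} (hp : p ∈ s) (hq : q ∈ s) :
    ∃ S, PolyApprox K S ∧ (∀ z ∈ K, S z ^ 2 * (z - q) = z - p) ∧
      ∀ z ∈ K, 3 * r < ‖z - c‖ → 0 < (S z).re := by
  have hKo : IsOpen Kᶜ := hK.isClosed.isOpen_compl
  have hne : ∀ {x}, x ∈ s → ∀ {z}, z ∈ K → z - x ≠ 0 := fun hx z hz =>
    sub_ne_zero.2 fun h => disjoint_left.1 hsK hx (h ▸ hz)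
  have step : ∀ x y : ℂ, x ∈ s → y ∈ s → (∀ z ∈ K, ‖y - x‖ ≤ 1 / 2 * ‖z - y‖) →
      ∃ S, PolyApprox K S ∧ (∀ z ∈ K, S z ^ 2 * (z - y) = z - x) ∧
      ∀ z ∈ K, 3 * r < ‖z - c‖ → 0 < (S z).re := by
    intro x y hx hy hxy
    obtain ⟨S, hS, hS2, hSr⟩ := ((hinv y hy).const_mul hK (y - x)).sqrt_one_add hK fun z hz => by
      have : 0 < ‖z - y‖ := norm_pos_iff.2 (hne hy hz)
      rw [norm_mul, norm_inv, ← div_eq_mul_inv, div_le_iff₀ this]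
      exact hxy z hz
    refine ⟨S, hS, fun z hz => ?_, fun z hz _ => hSr z hz⟩
    have := hne hy hz
    rw [hS2 z hz]
    field_simp
    ring
  have hre : ∀ x y : ℂ, x ∈ s → y ∈ s → ∀ S : ℂ → ℂ, (∀ z ∈ K, S z ^ 2 * (z - y) = z - x) →
      ∀ z ∈ K, 3 * r < ‖z - c‖ → |(S z).im| ^ 2 < (S z).re ^ 2 := by
    intro x y hx hy S hS z hz hzc
    have hyz := hne hy hz
    have h1 : S z ^ 2 = 1 + (y - x) / (z - y) := by
      rw [eq_div_of_mul_eq hyz (hS z hz)]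
      field_simp
      ring
    have h2 : ‖(y - x) / (z - y)‖ < 1 := by
      have hx' := hsr hx
      have hy' := hsr hy
      rw [Metric.mem_closedBall, dist_eq_norm] at hx' hy'
      rw [norm_div, div_lt_one (norm_pos_iff.2 hyz)]
      have e1 := norm_sub_le_norm_sub_add_norm_sub y c x
      have e2 := norm_sub_le_norm_sub_add_norm_sub z y c
      rw [norm_sub_rev c x] at e1
      linarith
    have h3 : 0 < (S z ^ 2).re := by
      rw [h1, Complex.add_re, Complex.one_re]
      have := Complex.abs_re_le_norm ((y - x) / (z - y))
      have := neg_abs_le ((y - x) / (z - y)).re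
      linarith
    rw [sq (S z), Complex.mul_re] at h3
    rw [sq_abs]
    nlinarith
  refine hs.induction₂' (fun x y => ∃ S, PolyApprox K S ∧ (∀ z ∈ K, S z ^ 2 * (z - y) = z - x) ∧
      ∀ z ∈ K, 3 * r < ‖z - c‖ → 0 < (S z).re) (fun x hx => ?_) ?_ hp hq
  · obtain ⟨ρ, hρ, hball⟩ := Metric.isOpen_iff.1 hKo x (disjoint_left.1 hsK hx)
    have hd : ∀ z ∈ K, ρ ≤ ‖z - x‖ := fun z hz => by
      by_contra! h
      exact hball (by rwa [Metric.mem_ball, dist_eq_norm]) hz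
    filter_upwards [nhdsWithin_le_nhds (Metric.ball_mem_nhds x (show 0 < ρ / 4 by linarith)),
      self_mem_nhdsWithin] with y hy hys
    rw [Metric.mem_ball, dist_eq_norm] at hy
    refine ⟨step x y hx hys fun z hz => ?_, step y x hys hx fun z hz => ?_⟩
    · have := norm_sub_le_norm_sub_add_norm_sub z y x
      linarith [hd z hz]
    · rw [norm_sub_rev]
      linarith [hd z hz]
  · rintro x y w hx hy hw ⟨S, hS, hS2, hSr⟩ ⟨S', hS', hS2', hSr'⟩
    refine ⟨fun z => S z * S' z, hS.mul hK hS', fun z hz => ?_, fun z hz hzc => ?_⟩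
    · rw [mul_pow, mul_assoc, hS2' z hz, hS2 z hz]
    · have h1 := abs_lt_of_sq_lt_sq (hre x y hx hy S hS2 z hz hzc) (hSr z hz hzc).le
      have h2 := abs_lt_of_sq_lt_sq (hre y w hy hw S' hS2' z hz hzc) (hSr' z hz hzc).le
      rw [abs_abs] at h1 h2
      rw [Complex.mul_re, sub_pos]
      calc _ ≤ |(S z).im * (S' z).im| := le_abs_self _
        _ = |(S z).im| * |(S' z).im| := abs_mul _ _
        _ < _ := mul_lt_mul'' h1 h2 (abs_nonneg _) (abs_nonneg _)

end PolyApprox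

end

section

open Topology Set Filter

theorem exists_preconnected_of_not_isBounded_component {K : Set ℂ} (hK : IsClosed K) {c : ℂ}
    (hub : ¬ Bornology.IsBounded (connectedComponentIn Kᶜ c)) {r : ℝ} (hr : 0 < r) :
    ∃ s : Set ℂ, IsPreconnected s ∧ s ⊆ Metric.closedBall c r ∧ Disjoint s K ∧ c ∈ s ∧
      ∃ q ∈ s, ‖q - c‖ = r := by
  have hc : c ∈ Kᶜ := by
    by_contra h
    exact hub (by rw [connectedComponentIn_eq_empty h]; exact Bornology.isBounded_empty)
  set V := connectedComponentIn Kᶜ c with hV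
  obtain ⟨x, hx, hxr⟩ : ∃ x ∈ V, r < ‖x - c‖ := by
    by_contra! hcon
    exact hub (Metric.isBounded_closedBall.subset (s := V) (t := Metric.closedBall c r)
      fun x hx => by rw [Metric.mem_closedBall, dist_eq_norm]; exact hcon x hx)
  have hVo : IsOpen V := hK.isOpen_compl.connectedComponentIn
  have hVp : IsPathConnected V :=
    hVo.isConnected_iff_isPathConnected.1 (isConnected_connectedComponentIn_iff.2 hc)
  obtain ⟨γ, hγ⟩ := hVp.joinedIn c (mem_connectedComponentIn hc) x hx
  let F : unitInterval → ℝ := fun t => ‖γ t - c‖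
  have hF : Continuous F := by fun_prop
  obtain ⟨t₀, ht₀, hleast⟩ := (isClosed_Ici.preimage hF : IsClosed (F ⁻¹' Ici r)).isCompact
    |>.exists_isLeast ⟨1, by simpa [F] using hxr.le⟩
  have hFt : F t₀ = r := by
    obtain ⟨t₁, ht₁, h1⟩ := intermediate_value_Icc (a := 0) (b := t₀) unitInterval.nonneg'
      hF.continuousOn (show r ∈ Icc (F 0) (F t₀) from ⟨by simpa [F] using hr.le, ht₀⟩)
    have : t₁ = t₀ := le_antisymm ht₁.2 (hleast (show r ≤ F t₁ from h1.ge))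
    rw [← this, h1]
  refine ⟨γ '' Icc 0 t₀, isPreconnected_Icc.image _ γ.continuous.continuousOn, ?_, ?_,
    ⟨0, ⟨le_rfl, unitInterval.nonneg'⟩, γ.source⟩, γ t₀, ⟨t₀, ⟨unitInterval.nonneg', le_rfl⟩, rfl⟩, hFt⟩
  · rintro _ ⟨t, ht, rfl⟩
    rw [Metric.mem_closedBall, dist_eq_norm]
    by_contra! h
    have : t = t₀ := le_antisymm ht.2 (hleast (show r ≤ F t from h.le))
    rw [this] at h
    exact h.ne hFt.symm
  · rw [disjoint_left]
    rintro _ ⟨t, -, rfl⟩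
    exact connectedComponentIn_subset _ _ (hγ t)

/-- The majorant of the error made in replacing the Cauchy kernel at scale `r`. -/
def kernelBound (r : ℝ) (u : ℂ) : ℝ :=
  if ‖u‖ < 5 * r then ‖u‖⁻¹ + 21736 / r else 245 * r ^ 2 / ‖u‖ ^ 3

theorem exists_kernel {K : Set ℂ} (hK : IsCompact K)
    (hub : ∀ p ∉ K, ¬ Bornology.IsBounded (connectedComponentIn Kᶜ p)) {c : ℂ} (hc : c ∉ K)
    {r : ℝ} (hr : 0 < r) :
    ∃ (g : ℂ → ℂ) (m : ℂ), PolyApprox K g ∧ ∀ z ∈ K, ∀ ζ ∈ Metric.closedBall c r,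
      ‖(z - ζ)⁻¹ - (g z + (ζ - m) * g z ^ 2)‖ ≤ kernelBound r (z - ζ) := by
  obtain ⟨s, hs, hsr, hsK, hcs, q, hqs, hqc⟩ :=
    exists_preconnected_of_not_isBounded_component hK.isClosed (hub c hc) hr
  obtain ⟨S, hS, hS2, hSr⟩ := PolyApprox.exists_sqrt_div hK hs hsr hsK
    (fun p hp => PolyApprox.inv_sub hK (disjoint_left.1 hsK hp) (hub p (disjoint_left.1 hsK hp)))
    hcs hqs
  set d := q - c with hd
  have hd0 : d ≠ 0 := norm_pos_iff.1 (hqc ▸ hr)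
  refine ⟨fun z => 4 / d ^ 2 * ((S z - 1) ^ 2 * (z - q)), c + d / 2, ?_, ?_⟩
  · exact (((hS.sub hK (.const 1)).pow hK 2).mul hK (PolyApprox.id.sub hK (.const q))).const_mul hK _
  intro z hz ζ hζ
  rw [Metric.mem_closedBall, dist_eq_norm] at hζ
  have hqz : z - q ≠ 0 := sub_ne_zero.2 fun h => disjoint_left.1 hsK hqs (h ▸ hz)
  have hm : ‖ζ - (c + d / 2)‖ ≤ 2 * r := by
    calc ‖ζ - (c + d / 2)‖ = ‖(ζ - c) - d / 2‖ := by congr 1; ring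
      _ ≤ ‖ζ - c‖ + ‖d / 2‖ := norm_sub_le _ _
      _ = ‖ζ - c‖ + r / 2 := by rw [norm_div, hqc]; simp
      _ ≤ 2 * r := by linarith
  have hSd : (S z ^ 2 - 1) * (z - q) = d := by
    rw [sub_mul, hS2 z hz, hd]; ring
  set y := z - q with hy
  set w := S z with hw
  have hzc : z - c = y + d := by rw [hy, hd]; ring
  beta_reduce
  set G := 4 / d ^ 2 * ((w - 1) ^ 2 * y) with hG
  unfold kernelBound
  have t1 : ‖z - c‖ ≤ ‖z - ζ‖ + ‖ζ - c‖ := norm_sub_le_norm_sub_add_norm_sub _ _ _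
  have t2 : ‖z - ζ‖ ≤ ‖z - c‖ + ‖ζ - c‖ := by
    rw [norm_sub_rev ζ c]; exact norm_sub_le_norm_sub_add_norm_sub _ _ _
  split_ifs with hnear
  · have hy7 : ‖y‖ ≤ 7 * r := by
      have : y = (z - c) - d := by rw [hzc]; ring
      rw [this]
      linarith [norm_sub_le (z - c) d]
    have hGb : ‖G‖ ≤ 104 / r := by
      have h1 : ‖w - 1‖ ^ 2 ≤ 2 * (‖w‖ ^ 2 + 1) := by
        have := norm_sub_le w 1
        rw [norm_one] at this
        nlinarith [sq_nonneg (‖w‖ - 1), norm_nonneg (w - 1), norm_nonneg w]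
      have h2 : ‖w‖ ^ 2 * ‖y‖ = ‖z - c‖ := by
        rw [← norm_pow, ← norm_mul, hS2 z hz]
      have h3 : ‖(w - 1) ^ 2 * y‖ ≤ 26 * r := by
        rw [norm_mul, norm_pow]
        nlinarith [mul_le_mul_of_nonneg_right h1 (norm_nonneg y)]
      rw [hG, norm_mul, norm_div, norm_pow, hqc, Complex.norm_ofNat]
      calc _ ≤ 4 / r ^ 2 * (26 * r) := by gcongr
        _ = 104 / r := by field_simp; norm_num
    calc _ ≤ ‖(z - ζ)⁻¹‖ + ‖G + (ζ - (c + d / 2)) * G ^ 2‖ := norm_sub_le _ _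
      _ ≤ ‖(z - ζ)⁻¹‖ + (‖G‖ + ‖ζ - (c + d / 2)‖ * ‖G‖ ^ 2) := by
        rw [← norm_pow, ← norm_mul]; gcongr; exact norm_add_le _ _
      _ ≤ ‖(z - ζ)⁻¹‖ + (104 / r + 2 * r * (104 / r) ^ 2) := by gcongr
      _ = _ := by rw [norm_inv]; congr 1; field_simp; norm_num
  · rw [not_lt] at hnear
    have hre : 0 < w.re := hSr z hz (by linarith)
    have hw1 : 1 ≤ ‖w + 1‖ := by
      refine le_trans ?_ (Complex.re_le_norm _)
      simp [hre.le]
    have hwp : w + 1 ≠ 0 := norm_pos_iff.1 (by linarith)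
    have hwm : w - 1 ≠ 0 := by
      intro h
      apply hd0
      rw [← hSd, show w ^ 2 - 1 = (w - 1) * (w + 1) by ring, h]; ring
    have hw2 : w ^ 2 - 1 ≠ 0 := by
      rw [show w ^ 2 - 1 = (w - 1) * (w + 1) by ring]; exact mul_ne_zero hwm hwp
    have hG2 : G = 4 / (y * (w + 1) ^ 2) := by
      rw [hG, ← hSd, show w ^ 2 - 1 = (w - 1) * (w + 1) by ring]
      field_simp
    have hid : (z - (c + d / 2)) * G - 1 = d ^ 2 * G ^ 2 / 16 := by
      have : z - (c + d / 2) = y + d / 2 := by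
        rw [show z - (c + d / 2) = (z - c) - d / 2 by ring, hzc]; ring
      rw [this, hG2, ← hSd]
      field_simp
      ring
    set t := ‖z - ζ‖ with ht
    have ht0 : 0 < t := by linarith
    have hyt : 3 * t / 5 ≤ ‖y‖ := by
      have : z - c = y + d := hzc
      rw [this] at t2
      linarith [norm_add_le y d]
    have hGt : ‖G‖ ≤ 7 / t := by
      rw [hG2, norm_div, norm_mul, norm_pow, Complex.norm_ofNat]
      rw [div_le_div_iff₀ (by positivity) ht0]
      have : 1 ≤ ‖w + 1‖ ^ 2 := one_le_pow₀ hw1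
      nlinarith [norm_nonneg y]
    have hGr : ‖G‖ * r ≤ 7 / 5 := by
      calc ‖G‖ * r ≤ 7 / t * (t / 5) := by gcongr; linarith
        _ = 7 / 5 := by field_simp
    have hne : z - ζ ≠ 0 := norm_pos_iff.1 ht0
    set u := ζ - (c + d / 2) with hu
    have hE : (z - ζ) * ((z - ζ)⁻¹ - (G + u * G ^ 2)) =
        u ^ 2 * G ^ 2 - d ^ 2 * G ^ 2 / 16 - u * d ^ 2 * G ^ 3 / 16 := by
      rw [mul_sub, mul_inv_cancel₀ hne, show z - ζ = (z - (c + d / 2)) - u by rw [hu]; ring]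
      linear_combination (-1 - u * G) * hid
    have hEn : t * ‖(z - ζ)⁻¹ - (G + u * G ^ 2)‖ ≤ 5 * r ^ 2 * ‖G‖ ^ 2 := by
      rw [ht, ← norm_mul, hE]
      calc _ ≤ ‖u ^ 2 * G ^ 2‖ + ‖d ^ 2 * G ^ 2 / 16‖ + ‖u * d ^ 2 * G ^ 3 / 16‖ :=
            (norm_sub_le _ _).trans (by gcongr; exact norm_sub_le _ _)
        _ = ‖u‖ ^ 2 * ‖G‖ ^ 2 + r ^ 2 * ‖G‖ ^ 2 / 16 + ‖u‖ * r ^ 2 * ‖G‖ ^ 3 / 16 := by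
            simp only [norm_mul, norm_div, norm_pow, hqc, Complex.norm_ofNat]
        _ ≤ (2 * r) ^ 2 * ‖G‖ ^ 2 + r ^ 2 * ‖G‖ ^ 2 / 16 + (2 * r) * r ^ 2 * ‖G‖ ^ 3 / 16 := by
            gcongr
        _ = (4 + 1 / 16) * (r ^ 2 * ‖G‖ ^ 2) + (‖G‖ * r) * (r ^ 2 * ‖G‖ ^ 2) / 8 := by ring
        _ ≤ (4 + 1 / 16) * (r ^ 2 * ‖G‖ ^ 2) + 7 / 5 * (r ^ 2 * ‖G‖ ^ 2) / 8 := by gcongr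
        _ ≤ 5 * r ^ 2 * ‖G‖ ^ 2 := by nlinarith [sq_nonneg (r * ‖G‖)]
    rw [le_div_iff₀ (by positivity)]
    calc _ = t * ‖(z - ζ)⁻¹ - (G + u * G ^ 2)‖ * t ^ 2 := by ring
      _ ≤ 5 * r ^ 2 * ‖G‖ ^ 2 * t ^ 2 := by gcongr
      _ ≤ 5 * r ^ 2 * (7 / t) ^ 2 * t ^ 2 := by gcongr
      _ = 245 * r ^ 2 := by field_simp; norm_num

end

section

open Topology Set Filter MeasureTheory Real

theorem integral_polar {f : ℂ → ℂ} (hm : Measurable f) (hf : Integrable f) :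
    ∫ z, f z = ∫ ρ in Ioi (0 : ℝ), (ρ : ℂ) * ∫ θ in (0 : ℝ)..2 * π, f (circleMap 0 ρ θ) := by
  have hsymm : ∀ p : ℝ × ℝ, Complex.polarCoord.symm p = circleMap 0 p.1 p.2 := fun p => by
    rw [Complex.polarCoord_symm_apply, circleMap, zero_add, Complex.exp_mul_I]
    push_cast; rfl
  have hmeas : Measurable fun p : ℝ × ℝ => p.1 • f (Complex.polarCoord.symm p) := by
    simp only [hsymm]
    refine measurable_fst.smul (hm.comp ?_)
    exact Continuous.measurable (by unfold circleMap; fun_prop)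
  have h_int : IntegrableOn (fun p : ℝ × ℝ => p.1 • f (Complex.polarCoord.symm p))
      polarCoord.target := by
    refine ⟨hmeas.aestronglyMeasurable, ?_⟩
    rw [hasFiniteIntegral_iff_enorm]
    have h1 := Complex.lintegral_comp_polarCoord_symm (fun z => ‖f z‖ₑ)
    have h2 := hf.2
    rw [hasFiniteIntegral_iff_enorm, ← h1] at h2
    refine lt_of_le_of_lt (setLIntegral_mono' polarCoord.open_target.measurableSet ?_) h2
    intro p hp
    rw [enorm_smul, smul_eq_mul, Real.enorm_of_nonneg]
    exact (show p.1 ∈ Ioi (0 : ℝ) from hp.1).le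
  rw [← Complex.integral_comp_polarCoord_symm, polarCoord_target]
  rw [polarCoord_target] at h_int
  rw [Measure.volume_eq_prod, setIntegral_prod _ h_int]
  refine setIntegral_congr_fun measurableSet_Ioi fun ρ _ => ?_
  simp only [hsymm, Complex.real_smul]
  rw [← integral_Ioc_eq_integral_Ioo, ← intervalIntegral.integral_of_le (by linarith [pi_pos]),
    intervalIntegral.integral_const_mul]
  congr 1
  have hper : Function.Periodic (fun θ => f (circleMap 0 ρ θ)) (2 * π) := fun θ => by
    simp only [periodic_circleMap 0 ρ θ]
  have := hper.intervalIntegral_add_eq (-π) 0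
  rw [zero_add, show -π + 2 * π = π by ring] at this
  exact this

theorem integral_indicator_ball_mul {δ : ℝ} {h : ℂ → ℂ} (hm : Measurable h)
    (h_int : Integrable fun v => (Metric.ball (0 : ℂ) δ).indicator (fun v => v * h v) v) :
    ∫ v, (Metric.ball (0 : ℂ) δ).indicator (fun v => v * h v) v =
      ∫ ρ in Ioo (0 : ℝ) δ, (ρ : ℂ) * (-Complex.I * ∮ v in C(0, ρ), h v) := by
  have hmeas : Measurable fun v => (Metric.ball (0 : ℂ) δ).indicator (fun v => v * h v) v :=
    (measurable_id.mul hm).indicator Metric.isOpen_ball.measurableSet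
  rw [integral_polar hmeas h_int]
  have : Ioo (0 : ℝ) δ = Ioi 0 ∩ Iio δ := rfl
  rw [this, ← setIntegral_indicator measurableSet_Iio]
  refine setIntegral_congr_fun measurableSet_Ioi fun ρ hρ => ?_
  by_cases hρδ : ρ < δ
  · rw [indicator_of_mem (show ρ ∈ Iio δ from hρδ)]
    congr 1
    rw [circleIntegral, ← intervalIntegral.integral_const_mul]
    refine intervalIntegral.integral_congr fun θ _ => ?_
    have : circleMap 0 ρ θ ∈ Metric.ball (0 : ℂ) δ := by
      simpa [abs_of_pos (show 0 < ρ from hρ)] using hρδ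
    simp only [indicator_of_mem this, deriv_circleMap, smul_eq_mul]
    linear_combination (circleMap 0 ρ θ * h (circleMap 0 ρ θ)) * Complex.I_mul_I
  · rw [indicator_of_notMem (show ρ ∉ Iio δ from hρδ)]
    have : ∀ θ, circleMap 0 ρ θ ∉ Metric.ball (0 : ℂ) δ := fun θ => by
      simpa [abs_of_pos (show 0 < ρ from hρ)] using hρδ
    simp [indicator_of_notMem (this _)]

theorem locallyIntegrable_inv_norm : LocallyIntegrable fun u : ℂ => (‖u‖⁻¹ : ℝ) := by
  refine locallyIntegrable_of_norm_le_rpow (E := ℂ) (μ := volume) (α := 1) (C := 1) ?_ ?_ ?_ ?_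
  · rw [Complex.finrank_real_complex]; norm_num
  · rw [Complex.finrank_real_complex]; norm_num
  · refine ae_of_all _ fun u => ?_
    simp [Real.rpow_neg_one]
  · exact (measurable_norm.inv).aestronglyMeasurable

theorem integrableOn_inv_norm_sub (z : ℂ) (R : ℝ) :
    IntegrableOn (fun ζ : ℂ => ‖z - ζ‖⁻¹) (Metric.ball 0 R) := by
  have h1 : IntegrableOn (fun u : ℂ => (‖u‖⁻¹ : ℝ)) (Metric.closedBall 0 (‖z‖ + R)) :=
    locallyIntegrable_inv_norm.integrableOn_isCompact (isCompact_closedBall _ _)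
  rw [← integrable_indicator_iff Metric.isClosed_closedBall.measurableSet] at h1
  have h2 := (h1.comp_sub_left z).integrableOn (s := Metric.ball 0 R)
  refine h2.congr_fun (fun ζ hζ => ?_) Metric.isOpen_ball.measurableSet
  have : z - ζ ∈ Metric.closedBall (0 : ℂ) (‖z‖ + R) := by
    rw [mem_closedBall_zero_iff]
    rw [mem_ball_zero_iff] at hζ
    linarith [norm_sub_le z ζ]
  simp [indicator_of_mem this]

theorem circleIntegral_inv_sub_of_lt {u : ℂ} {ρ : ℝ} (h : ‖u‖ < ρ) :
    (∮ v in C(0, ρ), (u - v)⁻¹) = -(2 * π * Complex.I) := by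
  have h1 := circleIntegral.integral_sub_inv_of_mem_ball (c := 0) (w := u) (R := ρ) (by simpa using h)
  rw [← h1, ← neg_one_mul, ← circleIntegral.integral_const_mul]
  congr 1; funext v
  rw [neg_one_mul, ← inv_neg, neg_sub]

theorem circleIntegral_inv_sub_of_gt {u : ℂ} {ρ : ℝ} (hρ : 0 ≤ ρ) (h : ρ < ‖u‖) :
    (∮ v in C(0, ρ), (u - v)⁻¹) = 0 := by
  refine Complex.circleIntegral_eq_zero_of_differentiable_on_off_countable hρ countable_empty ?_ ?_
  · refine ContinuousOn.inv₀ (by fun_prop) fun v hv h0 => ?_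
    rw [mem_closedBall_zero_iff] at hv
    rw [sub_eq_zero] at h0
    subst h0; linarith
  · intro v hv
    refine DifferentiableAt.inv (by fun_prop) fun h0 => ?_
    have := mem_ball_zero_iff.1 hv.1
    rw [sub_eq_zero] at h0
    subst h0; linarith

theorem integral_indicator_ball_mul_inv_sub {δ : ℝ} (u : ℂ) :
    ∫ v, (Metric.ball (0 : ℂ) δ).indicator (fun v => v * (u - v)⁻¹) v =
      ((-π * ∫ ρ in Ioo ‖u‖ δ, 2 * ρ : ℝ) : ℂ) := by
  rw [integral_indicator_ball_mul (by fun_prop)]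
  · rw [← integral_indicator measurableSet_Ioo, ← integral_indicator measurableSet_Ioo,
      ← integral_const_mul, ← integral_complex_ofReal]
    have : ∀ᵐ ρ : ℝ, ρ ≠ ‖u‖ := by simp [ae_iff, measure_singleton]
    refine integral_congr_ae ?_
    filter_upwards [this] with ρ hρ
    by_cases h0 : ρ ∈ Ioo 0 δ
    · rw [indicator_of_mem h0]
      rcases lt_or_gt_of_ne hρ with h | h
      · rw [indicator_of_notMem (fun hh => absurd hh.1 (not_lt.2 h.le)),
          circleIntegral_inv_sub_of_gt h0.1.le h]
        simp
      · rw [indicator_of_mem (show ρ ∈ Ioo ‖u‖ δ from ⟨h, h0.2⟩), circleIntegral_inv_sub_of_lt h]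
        push_cast
        linear_combination (2 * ρ * π : ℂ) * Complex.I_mul_I
    · rw [indicator_of_notMem h0, indicator_of_notMem fun hh => h0
        ⟨lt_of_le_of_lt (norm_nonneg u) hh.1, hh.2⟩]
      simp
  · rw [integrable_indicator_iff Metric.isOpen_ball.measurableSet]
    refine ((integrableOn_inv_norm_sub u δ).const_mul δ).mono'
      (by fun_prop) ?_
    refine (ae_restrict_iff' Metric.isOpen_ball.measurableSet).2 (ae_of_all _ fun v hv => ?_)
    rw [norm_mul, norm_inv]
    rw [mem_ball_zero_iff] at hv
    gcongr

theorem setIntegral_Ioo_two_mul {δ : ℝ} (hδ : 0 ≤ δ) (a : ℝ) (ha : 0 ≤ a) :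
    ∫ ρ in Ioo a δ, 2 * ρ = max (δ ^ 2 - a ^ 2) 0 := by
  rcases le_total δ a with h | h
  · rw [Ioo_eq_empty (not_lt.2 h), setIntegral_empty, max_eq_right]
    nlinarith
  · rw [← integral_Ioc_eq_integral_Ioo, ← intervalIntegral.integral_of_le h,
      intervalIntegral.integral_const_mul, integral_id, max_eq_left]
    · ring
    · nlinarith

theorem integrable_paraboloid (δ : ℝ) : Integrable fun u : ℂ => max (δ ^ 2 - ‖u‖ ^ 2) 0 := by
  refine Continuous.integrable_of_hasCompactSupport (by fun_prop) ?_
  refine HasCompactSupport.intro (isCompact_closedBall (0 : ℂ) |δ|) fun u hu => ?_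
  rw [mem_closedBall_zero_iff, not_le] at hu
  rw [max_eq_right]
  have := sq_lt_sq' (by linarith [abs_nonneg δ]) hu
  rw [sq_abs] at this
  linarith

theorem integral_paraboloid {δ : ℝ} (hδ : 0 ≤ δ) :
    ∫ u : ℂ, max (δ ^ 2 - ‖u‖ ^ 2) 0 = π * δ ^ 4 / 2 := by
  have h1 := integral_polar (f := fun u : ℂ => ((max (δ ^ 2 - ‖u‖ ^ 2) 0 : ℝ) : ℂ))
    (by fun_prop) (integrable_paraboloid δ).ofReal
  have h2 : ∫ ρ in Ioi (0 : ℝ), (ρ : ℂ) * ∫ θ in (0 : ℝ)..2 * π,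
      ((max (δ ^ 2 - ‖circleMap 0 ρ θ‖ ^ 2) 0 : ℝ) : ℂ) =
      ∫ ρ in Ioc (0 : ℝ) δ, ((2 * π * (δ ^ 2 * ρ - ρ ^ 3) : ℝ) : ℂ) := by
    rw [← Ioi_inter_Iic, ← setIntegral_indicator measurableSet_Iic]
    refine setIntegral_congr_fun measurableSet_Ioi fun ρ hρ => ?_
    simp only [norm_circleMap_zero, sq_abs, intervalIntegral.integral_const]
    by_cases h : ρ ∈ Iic δ
    · rw [indicator_of_mem h, max_eq_left]
      · simp; ring
      · have := mem_Iic.1 h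
        have := mem_Ioi.1 hρ
        nlinarith
    · rw [indicator_of_notMem h, max_eq_right]
      · simp
      · have : δ < ρ := not_le.1 h
        nlinarith
  rw [h2, integral_complex_ofReal, integral_complex_ofReal, Complex.ofReal_inj] at h1
  rw [h1, ← intervalIntegral.integral_of_le hδ, intervalIntegral.integral_const_mul,
    intervalIntegral.integral_sub (Continuous.intervalIntegrable (by fun_prop) _ _)
      (Continuous.intervalIntegrable (by fun_prop) _ _),
    intervalIntegral.integral_const_mul, integral_id, integral_pow]
  norm_num
  ring

end

section

open Topology Set Filter MeasureTheory Real

theorem integral_indicator_ball_mul_eq_zero {δ : ℝ} {h : ℂ → ℂ} (hc : Continuous h)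
    (hd : DifferentiableOn ℂ h (Metric.ball 0 δ)) :
    ∫ v, (Metric.ball (0 : ℂ) δ).indicator (fun v => v * h v) v = 0 := by
  rw [integral_indicator_ball_mul hc.measurable]
  · refine (setIntegral_congr_fun (g := fun _ => 0) measurableSet_Ioo fun ρ hρ => ?_).trans (by simp)
    simp only
    rw [Complex.circleIntegral_eq_zero_of_differentiable_on_off_countable hρ.1.le countable_empty
      hc.continuousOn fun v hv => hd.differentiableAt
        (Metric.isOpen_ball.mem_nhds (Metric.ball_subset_ball hρ.2.le hv.1))]
    simp
  · rw [integrable_indicator_iff Metric.isOpen_ball.measurableSet]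
    exact ((continuous_id.mul hc).continuousOn.integrableOn_compact
      (isCompact_closedBall (0 : ℂ) δ)).mono_set Metric.ball_subset_closedBall

theorem exists_cauchy_smoothing {F : ℂ → ℂ} (hF : Continuous F) (hFc : HasCompactSupport F)
    {δ η : ℝ} (hδ : 0 < δ) (hη : ∀ x y, ‖x - y‖ < δ → ‖F x - F y‖ ≤ η) :
    ∃ ψ : ℂ → ℂ, Measurable ψ ∧ (∀ ζ, ‖ψ ζ‖ ≤ π * η * δ ^ 3) ∧
      (∃ R, ∀ ζ, R ≤ ‖ζ‖ → ψ ζ = 0) ∧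
      (∀ ζ, DifferentiableOn ℂ F (Metric.ball ζ δ) → ψ ζ = 0) ∧
      ∀ z, ‖F z + (2 / (π ^ 2 * δ ^ 4) : ℝ) * ∫ ζ, ψ ζ * (z - ζ)⁻¹‖ ≤ η := by
  have hη0 : 0 ≤ η := by simpa using hη 0 0 (by simpa using hδ)
  set B : ℂ → ℂ := (Metric.ball 0 δ).indicator id with hB
  have hBm : Measurable B := measurable_id.indicator Metric.isOpen_ball.measurableSet
  have hBmem : ∀ v, ‖v‖ < δ → B v = v := fun v hv => by
    rw [hB, indicator_of_mem (by simpa using hv)]; rfl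
  have hBnot : ∀ v, ¬ ‖v‖ < δ → B v = 0 := fun v hv => by
    rw [hB, indicator_of_notMem (by simpa using hv)]
  have hBle : ∀ v, ‖B v‖ ≤ δ := fun v => by
    by_cases hv : ‖v‖ < δ
    · rw [hBmem v hv]; exact hv.le
    · rw [hBnot v hv]; simpa using hδ.le
  have hBmul : ∀ (h : ℂ → ℂ) (v : ℂ), h v * B v =
      (Metric.ball (0 : ℂ) δ).indicator (fun v => v * h v) v := fun h v => by
    by_cases hv : ‖v‖ < δ
    · rw [hBmem v hv, indicator_of_mem (by simpa using hv), mul_comm]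
    · rw [hBnot v hv, indicator_of_notMem (by simpa using hv), mul_zero]
  obtain ⟨R, hR0, hR⟩ : ∃ R, 0 < R ∧ ∀ x, R ≤ ‖x‖ → F x = 0 := by
    obtain ⟨R, hR0, hR⟩ := hFc.isCompact.isBounded.subset_ball_lt 0 0
    exact ⟨R, hR0, fun x hx => image_eq_zero_of_notMem_tsupport fun hh => by
      have := hR hh
      rw [mem_ball_zero_iff] at this; linarith⟩
  have hFint : Integrable F := hF.integrable_of_hasCompactSupport hFc
  have hsupp : ∀ ζ x, R + δ ≤ ‖ζ‖ → F x * B (ζ - x) = 0 := fun ζ x hζ => by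
    by_cases hx : R ≤ ‖x‖
    · rw [hR x hx, zero_mul]
    · rw [hBnot, mul_zero]
      have := norm_sub_norm_le ζ x
      push Not at hx ⊢
      linarith
  have hψ : ∀ ζ, ∫ x, F x * B (ζ - x) = ∫ v, F (ζ - v) * B v := fun ζ => by
    rw [← integral_sub_left_eq_self (fun v => F (ζ - v) * B v) volume ζ]
    simp
  have hBF : Measurable (Function.uncurry fun ζ x : ℂ => F x * B (ζ - x)) :=
    (hF.measurable.comp measurable_snd).mul (hBm.comp (measurable_fst.sub measurable_snd))
  have h_int : ∀ ζ, Integrable fun v => F (ζ - v) * B v := fun ζ => by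
    refine ((hFint.comp_sub_left ζ).norm.mul_const δ).mono' ?_ (ae_of_all _ fun v => ?_)
    · exact ((hF.comp (by fun_prop)).measurable.mul hBm).aestronglyMeasurable
    · rw [norm_mul]
      exact mul_le_mul_of_nonneg_left (hBle v) (norm_nonneg _)
  refine ⟨fun ζ => ∫ x, F x * B (ζ - x), ?_, fun ζ => ?_, ⟨R + δ, fun ζ hζ => ?_⟩,
    fun ζ hζ => ?_, fun z => ?_⟩
  · exact hBF.stronglyMeasurable.integral_prod_right.measurable
  · have h0 : ∫ v, F ζ * B v = 0 := by
      simp only [hBmul (fun _ => F ζ)]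
      exact integral_indicator_ball_mul_eq_zero continuous_const (by fun_prop)
    have hBint : Integrable fun v => F ζ * B v := by
      refine Integrable.const_mul ?_ _
      rw [hB, integrable_indicator_iff Metric.isOpen_ball.measurableSet]
      exact (continuous_id.continuousOn.integrableOn_compact
        (isCompact_closedBall (0 : ℂ) δ)).mono_set Metric.ball_subset_closedBall
    have h1 : ∫ v, F (ζ - v) * B v = ∫ v in Metric.ball 0 δ, (F (ζ - v) - F ζ) * B v := by
      rw [setIntegral_eq_integral_of_forall_compl_eq_zero, ← sub_zero (∫ v, F (ζ - v) * B v), ← h0,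
        ← integral_sub (h_int ζ) hBint]
      · simp only [sub_mul]
      · intro v hv
        rw [hBnot v (by simpa using hv), mul_zero]
    simp only [hψ]
    rw [h1]
    refine (norm_setIntegral_le_of_norm_le_const (C := η * δ) measure_ball_lt_top fun v hv => ?_).trans_eq ?_
    · rw [norm_mul]
      refine mul_le_mul (hη _ _ ?_) (hBle v) (norm_nonneg _) hη0
      simpa using hv
    · rw [Measure.real, Complex.volume_ball, ENNReal.toReal_mul, ENNReal.toReal_pow,
        ENNReal.toReal_ofReal hδ.le]
      simp
      ring
  · simp [hsupp ζ _ hζ]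
  · simp only [hψ, hBmul (fun v => F (ζ - v))]
    refine integral_indicator_ball_mul_eq_zero (hF.comp (by fun_prop)) ?_
    refine hζ.comp (by fun_prop) fun v hv => ?_
    simpa using hv
  · have hint2 : Integrable (Function.uncurry fun ζ x : ℂ => F x * B (ζ - x) * (z - ζ)⁻¹)
        (volume.prod volume) := by
      have h1 := (integrable_indicator_iff Metric.isOpen_ball.measurableSet).2
        (integrableOn_inv_norm_sub z (R + δ))
      refine ((h1.const_mul δ).mul_prod hFint.norm).mono' ?_ (ae_of_all _ fun p => ?_)
      · exact (hBF.mul ((measurable_const.sub measurable_fst).inv)).aestronglyMeasurable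
      · obtain ⟨ζ, x⟩ := p
        simp only [Function.uncurry]
        by_cases hζ : R + δ ≤ ‖ζ‖
        · rw [hsupp ζ x hζ, zero_mul, norm_zero]
          refine mul_nonneg (mul_nonneg hδ.le (indicator_nonneg (fun _ _ => by positivity) _)) (norm_nonneg _)
        · rw [indicator_of_mem (by simpa using hζ), norm_mul, norm_mul, norm_inv]
          have := hBle (ζ - x)
          calc ‖F x‖ * ‖B (ζ - x)‖ * ‖z - ζ‖⁻¹ ≤ ‖F x‖ * δ * ‖z - ζ‖⁻¹ := by gcongr
            _ = _ := by ring
    have hA : ∀ u, ∫ v, B v * (u - v)⁻¹ = ((-π * max (δ ^ 2 - ‖u‖ ^ 2) 0 : ℝ) : ℂ) := fun u => by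
      rw [← setIntegral_Ioo_two_mul hδ.le _ (norm_nonneg u), ← integral_indicator_ball_mul_inv_sub]
      simp only [mul_comm (B _), hBmul (fun v => (u - v)⁻¹)]
    have h2 : ∫ ζ, (∫ x, F x * B (ζ - x)) * (z - ζ)⁻¹ =
        -π * ∫ u, F (z - u) * ((max (δ ^ 2 - ‖u‖ ^ 2) 0 : ℝ) : ℂ) := by
      simp only [← integral_mul_const]
      rw [integral_integral_swap hint2,
        ← integral_sub_left_eq_self (fun u => F (z - u) * ((max (δ ^ 2 - ‖u‖ ^ 2) 0 : ℝ) : ℂ)) volume z,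
        ← integral_const_mul]
      congr 1; funext x
      simp only [mul_assoc, integral_const_mul]
      have := integral_sub_right_eq_self (μ := volume) (fun v => B v * (z - x - v)⁻¹) x
      simp only [sub_sub_sub_cancel_right] at this
      rw [this, hA, sub_sub_cancel]
      push_cast; ring
    have hAint := integrable_paraboloid δ
    have h3 : F z + (2 / (π ^ 2 * δ ^ 4) : ℝ) * (-π * ∫ u, F (z - u) * ((max (δ ^ 2 - ‖u‖ ^ 2) 0 : ℝ) : ℂ))
        = (2 / (π * δ ^ 4) : ℝ) * ∫ u, (F z - F (z - u)) * ((max (δ ^ 2 - ‖u‖ ^ 2) 0 : ℝ) : ℂ) := by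
      have e1 : ∫ u : ℂ, F z * ((max (δ ^ 2 - ‖u‖ ^ 2) 0 : ℝ) : ℂ) = F z * ((π * δ ^ 4 / 2 : ℝ) : ℂ) := by
        rw [integral_const_mul, integral_complex_ofReal, integral_paraboloid hδ.le]
      simp only [sub_mul]
      rw [integral_sub (hAint.ofReal.const_mul _), e1]
      · have : (δ : ℂ) ≠ 0 := by exact_mod_cast hδ.ne'
        have : (π : ℂ) ≠ 0 := by exact_mod_cast pi_pos.ne'
        push_cast
        field_simp
        ring
      · refine ((hFint.comp_sub_left z).norm.mul_const (δ ^ 2)).mono' ?_ (ae_of_all _ fun v => ?_)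
        · exact ((hF.comp (by fun_prop)).mul (by fun_prop)).aestronglyMeasurable
        · rw [norm_mul, Complex.norm_real, Real.norm_of_nonneg (le_max_right _ _)]
          refine mul_le_mul_of_nonneg_left (max_le ?_ (by positivity)) (norm_nonneg _)
          nlinarith [norm_nonneg v]
    rw [h2, h3, norm_mul, Complex.norm_real, Real.norm_of_nonneg (by positivity)]
    have h4 : ‖∫ u, (F z - F (z - u)) * ((max (δ ^ 2 - ‖u‖ ^ 2) 0 : ℝ) : ℂ)‖ ≤
        ∫ u : ℂ, η * max (δ ^ 2 - ‖u‖ ^ 2) 0 := by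
      refine norm_integral_le_of_norm_le (hAint.const_mul η) (ae_of_all _ fun u => ?_)
      rw [norm_mul, Complex.norm_real, Real.norm_of_nonneg (le_max_right _ _)]
      by_cases hu : ‖u‖ < δ
      · refine mul_le_mul_of_nonneg_right (hη _ _ (by simpa using hu)) (le_max_right _ _)
      · rw [max_eq_right]
        · simp
        · nlinarith
    rw [integral_const_mul, integral_paraboloid hδ.le] at h4
    refine (mul_le_mul_of_nonneg_left h4 (by positivity)).trans_eq ?_
    have := pi_pos.ne'
    field_simp

end

section

open Topology Set Filter MeasureTheory Real

theorem measurable_kernelBound (r : ℝ) : Measurable (kernelBound r) := by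
  unfold kernelBound
  refine Measurable.ite ?_ (by fun_prop) (by fun_prop)
  exact measurableSet_lt measurable_norm measurable_const

theorem kernelBound_nonneg {r : ℝ} (hr : 0 < r) (u : ℂ) : 0 ≤ kernelBound r u := by
  unfold kernelBound
  split_ifs <;> positivity

theorem kernelBound_scale {r : ℝ} (hr : 0 < r) (u : ℂ) :
    kernelBound r u = r⁻¹ * kernelBound 1 (r⁻¹ • u) := by
  have h : ‖r⁻¹ • u‖ = ‖u‖ / r := by
    rw [norm_smul, norm_inv, Real.norm_of_nonneg hr.le]; ring
  unfold kernelBound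
  simp only [h, mul_one, div_lt_iff₀ hr]
  split_ifs
  · field_simp
  · rcases eq_or_ne ‖u‖ 0 with h0 | h0
    · simp [h0]
    · field_simp

theorem integrable_kernelBound_one : Integrable (kernelBound 1) := by
  have h1 : IntegrableOn (fun u : ℂ => (‖u‖⁻¹ : ℝ) + 21736 / 1) (Metric.closedBall 0 5) :=
    (locallyIntegrable_inv_norm.integrableOn_isCompact (isCompact_closedBall _ _)).add
      (continuousOn_const.integrableOn_compact (isCompact_closedBall _ _))
  rw [← integrable_indicator_iff Metric.isClosed_closedBall.measurableSet] at h1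
  have h2 : Integrable (fun u : ℂ => (1 + ‖u‖) ^ (-3 : ℝ)) := by
    refine integrable_one_add_norm ?_
    rw [Complex.finrank_real_complex]; norm_num
  refine (h1.add (h2.const_mul (245 * 8))).mono' (measurable_kernelBound 1).aestronglyMeasurable
    (ae_of_all _ fun u => ?_)
  rw [Real.norm_of_nonneg (kernelBound_nonneg one_pos u)]
  have h3 : 0 ≤ 245 * 8 * (1 + ‖u‖) ^ (-3 : ℝ) := by positivity
  unfold kernelBound
  simp only [Pi.add_apply]
  split_ifs with h
  · rw [indicator_of_mem (by rw [mem_closedBall_zero_iff]; linarith)]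
    linarith
  · have h4 : 245 * 1 ^ 2 / ‖u‖ ^ 3 ≤ 245 * 8 * (1 + ‖u‖) ^ (-3 : ℝ) := by
      rw [Real.rpow_neg (by positivity), show (3 : ℝ) = (3 : ℕ) by norm_num, Real.rpow_natCast,
        ← div_eq_mul_inv, div_le_div_iff₀ (by have : 0 < ‖u‖ := by linarith
                                              positivity) (by positivity)]
      have : (1 + ‖u‖) ^ 3 ≤ (2 * ‖u‖) ^ 3 := by gcongr; linarith
      nlinarith
    have h5 : 0 ≤ (Metric.closedBall (0 : ℂ) 5).indicator (fun u : ℂ => (‖u‖⁻¹ : ℝ) + 21736 / 1) u :=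
      indicator_nonneg (fun _ _ => by positivity) _
    linarith

theorem integrable_kernelBound {r : ℝ} (hr : 0 < r) : Integrable (kernelBound r) := by
  have := ((integrable_comp_smul_iff volume (kernelBound 1) (inv_ne_zero hr.ne')).2
    integrable_kernelBound_one).const_mul r⁻¹
  refine this.congr (ae_of_all _ fun u => (kernelBound_scale hr u).symm)

theorem integral_kernelBound {r : ℝ} (hr : 0 < r) :
    ∫ u, kernelBound r u = r * ∫ u, kernelBound 1 u := by
  simp_rw [kernelBound_scale hr]
  rw [integral_const_mul, Measure.integral_comp_smul, Complex.finrank_real_complex]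
  rw [abs_of_pos (by positivity), smul_eq_mul]
  field_simp

end

section

open Topology Set Filter MeasureTheory Real

theorem exists_polyApprox_integral_inv_sub {K S : Set ℂ} (hK : IsCompact K)
    (hub : ∀ p ∉ K, ¬ Bornology.IsBounded (connectedComponentIn Kᶜ p)) {r M : ℝ} (hr : 0 < r)
    {ψ : ℂ → ℂ} (hψ : Measurable ψ) (hM : ∀ ζ, ‖ψ ζ‖ ≤ M) (hS : IsCompact S)
    (hψS : ∀ ζ ∉ S, ψ ζ = 0) (hc : ∀ ζ ∈ S, ∃ c ∉ K, ζ ∈ Metric.ball c r) :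
    ∃ G, PolyApprox K G ∧
      ∀ z ∈ K, ‖(∫ ζ, ψ ζ * (z - ζ)⁻¹) - G z‖ ≤ M * (r * ∫ u, kernelBound 1 u) := by
  have hM0 : 0 ≤ M := (norm_nonneg _).trans (hM 0)
  have h_int : ∀ z, Integrable fun ζ => ψ ζ * (z - ζ)⁻¹ := fun z => by
    obtain ⟨R, hR⟩ := hS.isBounded.subset_ball 0
    have h1 := (integrable_indicator_iff Metric.isOpen_ball.measurableSet).2
      (integrableOn_inv_norm_sub z R)
    refine (h1.const_mul M).mono' (by fun_prop) (ae_of_all _ fun ζ => ?_)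
    by_cases h : ζ ∈ Metric.ball 0 R
    · rw [indicator_of_mem h, norm_mul, norm_inv]
      exact mul_le_mul_of_nonneg_right (hM ζ) (by positivity)
    · rw [hψS ζ fun hh => h (hR hh), zero_mul, norm_zero]
      exact mul_nonneg hM0 (indicator_nonneg (fun _ _ => by positivity) _)
  have hkint : ∀ z, Integrable fun ζ => M * kernelBound r (z - ζ) := fun z =>
    ((integrable_kernelBound hr).comp_sub_left z).const_mul M
  have key : ∃ t, S ⊆ t ∧ MeasurableSet t ∧ ∀ Y ⊆ t, MeasurableSet Y → ∃ G, PolyApprox K G ∧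
      ∀ z ∈ K, ‖(∫ ζ in Y, ψ ζ * (z - ζ)⁻¹) - G z‖ ≤ ∫ ζ in Y, M * kernelBound r (z - ζ) := by
    refine hS.induction_on (p := fun s => ∃ t, s ⊆ t ∧ MeasurableSet t ∧ ∀ Y ⊆ t, MeasurableSet Y →
      ∃ G, PolyApprox K G ∧ ∀ z ∈ K, ‖(∫ ζ in Y, ψ ζ * (z - ζ)⁻¹) - G z‖ ≤
        ∫ ζ in Y, M * kernelBound r (z - ζ)) ?_ ?_ ?_ ?_
    · refine ⟨∅, subset_rfl, MeasurableSet.empty, fun Y hY _ => ⟨fun _ => 0, PolyApprox.const 0, ?_⟩⟩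
      rw [subset_empty_iff.1 hY]
      simp
    · rintro s t hst ⟨t', ht, h⟩
      exact ⟨t', hst.trans ht, h⟩
    · rintro s t ⟨s', hs, hsm, h1⟩ ⟨t', ht, htm, h2⟩
      refine ⟨s' ∪ t', union_subset_union hs ht, hsm.union htm, fun Y hY hYm => ?_⟩
      obtain ⟨G₁, hG₁, h1⟩ := h1 (Y ∩ s') inter_subset_right (hYm.inter hsm)
      obtain ⟨G₂, hG₂, h2⟩ := h2 (Y \ s') (fun x hx => (hY hx.1).resolve_left hx.2) (hYm.diff hsm)
      refine ⟨fun z => G₁ z + G₂ z, hG₁.add hG₂, fun z hz => ?_⟩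
      rw [← integral_inter_add_sdiff hsm (h_int z).integrableOn,
        ← integral_inter_add_sdiff hsm (hkint z).integrableOn, add_sub_add_comm]
      exact (norm_add_le _ _).trans (add_le_add (h1 z hz) (h2 z hz))
    · intro ζ hζ
      obtain ⟨c, hcK, hζc⟩ := hc ζ hζ
      refine ⟨Metric.ball c r, mem_nhdsWithin_of_mem_nhds (Metric.isOpen_ball.mem_nhds hζc),
        Metric.ball c r, subset_rfl, Metric.isOpen_ball.measurableSet, fun Y hY hYm => ?_⟩
      obtain ⟨g, m, hg, hgm⟩ := exists_kernel hK hub hcK hr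
      have hψY : IntegrableOn ψ Y := by
        refine Measure.integrableOn_of_bounded (M := M) ?_ hψ.aestronglyMeasurable (ae_of_all _ hM)
        exact ((measure_mono hY).trans_lt measure_ball_lt_top).ne
      have hψY2 : IntegrableOn (fun ζ => ψ ζ * (ζ - m)) Y := by
        refine Measure.integrableOn_of_bounded (M := M * (‖c - m‖ + r)) ?_ (by fun_prop) ?_
        · exact ((measure_mono hY).trans_lt measure_ball_lt_top).ne
        · refine (ae_restrict_iff' hYm).2 (ae_of_all _ fun ζ hζ => ?_)
          have h1 := mem_ball_iff_norm.1 (hY hζ)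
          rw [norm_mul]
          refine mul_le_mul (hM ζ) ?_ (norm_nonneg _) hM0
          calc ‖ζ - m‖ = ‖(c - m) + (ζ - c)‖ := by congr 1; ring
            _ ≤ _ := (norm_add_le _ _).trans (by linarith)
      refine ⟨fun z => (∫ ζ in Y, ψ ζ) * g z + (∫ ζ in Y, ψ ζ * (ζ - m)) * g z ^ 2,
        (hg.const_mul hK _).add ((hg.pow hK 2).const_mul hK _), fun z hz => ?_⟩
      have e : (∫ ζ in Y, ψ ζ * (z - ζ)⁻¹) -
          ((∫ ζ in Y, ψ ζ) * g z + (∫ ζ in Y, ψ ζ * (ζ - m)) * g z ^ 2) =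
          ∫ ζ in Y, ψ ζ * ((z - ζ)⁻¹ - (g z + (ζ - m) * g z ^ 2)) := by
        have h3 : IntegrableOn (fun ζ => ψ ζ * g z + ψ ζ * (ζ - m) * g z ^ 2) Y :=
          (hψY.mul_const _).add (hψY2.mul_const _)
        rw [← integral_mul_const, ← integral_mul_const, ← integral_add (hψY.mul_const _)
          (hψY2.mul_const _), ← integral_sub (h_int z).integrableOn h3]
        congr 1; funext ζ; ring
      rw [e]
      refine norm_integral_le_of_norm_le (hkint z).integrableOn
        ((ae_restrict_iff' hYm).2 (ae_of_all _ fun ζ hζ => ?_))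
      rw [norm_mul]
      exact mul_le_mul (hM ζ) (hgm z hz ζ (Metric.ball_subset_closedBall (hY hζ))) (norm_nonneg _) hM0
  obtain ⟨t, hSt, htm, h⟩ := key
  obtain ⟨G, hG, h⟩ := h t subset_rfl htm
  refine ⟨G, hG, fun z hz => ?_⟩
  rw [← setIntegral_eq_integral_of_forall_compl_eq_zero (s := t)
    fun ζ hζ => by rw [hψS ζ fun hh => hζ (hSt hh), zero_mul]]
  refine (h z hz).trans ?_
  rw [← integral_kernelBound hr, ← integral_const_mul,
    ← integral_sub_left_eq_self (fun u => M * kernelBound r u) volume z]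
  exact setIntegral_le_integral (hkint z)
    (ae_of_all _ fun ζ => mul_nonneg hM0 (kernelBound_nonneg hr _))

theorem exists_continuous_hasCompactSupport_eqOn {K : Set ℂ} (hK : IsCompact K) {g : ℂ → ℂ}
    (hg : ContinuousOn g K) : ∃ F : ℂ → ℂ, Continuous F ∧ HasCompactSupport F ∧ EqOn F g K := by
  obtain ⟨G, hG⟩ := ContinuousMap.exists_restrict_eq hK.isClosed ⟨K.domRestrict g, hg.domRestrict⟩
  obtain ⟨b, hb1, -, hb2, -⟩ := exists_continuous_one_zero_of_isCompact hK isClosed_empty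
    (disjoint_empty K)
  refine ⟨fun z => (b z : ℂ) * G z, by fun_prop, ?_, fun z hz => ?_⟩
  · exact HasCompactSupport.mul_right (hb2.comp_left (g := ((↑) : ℝ → ℂ)) (by simp))
  · have h1 : G z = g z := DFunLike.congr_fun hG ⟨z, hz⟩
    simp [h1, hb1 hz]

theorem polyApprox_of_jordan {γ : Circle → ℂ} (hγ : Continuous γ) (hinj : Function.Injective γ)
    {Ω : Set ℂ} (hΩ : IsOpen Ω) (hΩb : Bornology.IsBounded Ω) (hΩne : Ω.Nonempty)
    (hΩf : frontier Ω = range γ) {g : ℂ → ℂ} (hgc : ContinuousOn g (closure Ω))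
    (hgd : DifferentiableOn ℂ g Ω) : PolyApprox (closure Ω) g := by
  have hK : IsCompact (closure Ω) := hΩb.isCompact_closure
  have hub : ∀ p ∉ closure Ω, ¬ Bornology.IsBounded (connectedComponentIn (closure Ω)ᶜ p) :=
    fun p hp => not_isBounded_component_of_jordan hγ hinj hΩ hΩb hΩne hΩf hp
  have hfr := frontier_subset_closure_compl_of_jordan hγ hinj hΩ hΩb hΩne hΩf
  obtain ⟨F, hF, hFc, hFg⟩ := exists_continuous_hasCompactSupport_eqOn hK hgc
  have hMk : 0 ≤ ∫ u, kernelBound 1 u := integral_nonneg fun u => kernelBound_nonneg one_pos u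
  refine PolyApprox.of_uniform fun ε hε => ?_
  set C : ℝ := 1 + 4 * (∫ u, kernelBound 1 u) / π with hC
  have hC0 : 0 < C := by positivity
  obtain ⟨δ, hδ, hFδ⟩ := Metric.uniformContinuous_iff.1 (hFc.uniformContinuous_of_continuous hF)
    (ε / C) (by positivity)
  obtain ⟨ψ, hψm, hψM, ⟨R, hR⟩, hψ0, hψF⟩ := exists_cauchy_smoothing hF hFc hδ (η := ε / C)
    fun x y h => by
      rw [← dist_eq_norm] at h ⊢
      exact (hFδ h).le
  have hSc : IsCompact (closure (Function.support ψ)) := by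
    refine (Metric.isBounded_ball (x := (0 : ℂ)) (r := R)).subset (fun ζ hζ => ?_) |>.isCompact_closure
    rw [mem_ball_zero_iff]
    by_contra h
    exact hζ (hR ζ (not_lt.1 h))
  obtain ⟨G, hG, hGz⟩ := exists_polyApprox_integral_inv_sub hK hub (r := 2 * δ) (by positivity) hψm hψM
    hSc (fun ζ hζ => by
      by_contra h
      exact hζ (subset_closure h)) (fun ζ hζ => by
      obtain ⟨ζ', hζ', h1⟩ := Metric.mem_closure_iff.1 hζ (δ / 2) (by positivity)
      obtain ⟨y, hy, hyΩ⟩ : ∃ y ∈ Metric.ball ζ' δ, y ∉ Ω := by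
        by_contra! h
        refine hζ' (hψ0 ζ' ?_)
        exact (hgd.mono h).congr fun x hx => hFg (subset_closure (h x hx))
      have hy2 : y ∈ closure (closure Ω)ᶜ := by
        by_cases h : y ∈ closure Ω
        · exact hfr ⟨h, by rwa [hΩ.interior_eq]⟩
        · exact subset_closure h
      obtain ⟨c, hc, h2⟩ := Metric.mem_closure_iff.1 hy2 (δ / 2) (by positivity)
      refine ⟨c, hc, ?_⟩
      rw [Metric.mem_ball]
      rw [Metric.mem_ball, dist_comm] at hy
      linarith [dist_triangle4 ζ ζ' y c])
  refine ⟨fun z => (-(2 / (π ^ 2 * δ ^ 4) : ℝ) : ℂ) * G z, hG.const_mul hK _, fun z hz => ?_⟩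
  have e : g z - (-(2 / (π ^ 2 * δ ^ 4) : ℝ) : ℂ) * G z =
      (F z + (2 / (π ^ 2 * δ ^ 4) : ℝ) * ∫ ζ, ψ ζ * (z - ζ)⁻¹) -
        (2 / (π ^ 2 * δ ^ 4) : ℝ) * ((∫ ζ, ψ ζ * (z - ζ)⁻¹) - G z) := by
    rw [hFg hz]; ring
  rw [e]
  refine (norm_sub_le _ _).trans ?_
  rw [norm_mul, Complex.norm_real, Real.norm_of_nonneg (by positivity)]
  refine (add_le_add (hψF z) (mul_le_mul_of_nonneg_left (hGz z hz) (by positivity))).trans_eq ?_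
  have h1 : ε = ε / C * C := by field_simp
  have h2 := pi_pos.ne'
  conv_rhs => rw [h1]
  generalize ε / C = η
  rw [hC]
  field_simp
  ring

end

section

open Topology Set Filter

/-- The coordinate `z` in the decomposition `q = z + w j` with `z`, `w` complex. -/
def coordOne : Quaternion ℝ →ₗ[ℝ] ℂ where
  toFun q := ⟨q.re, q.imI⟩
  map_add' _ _ := rfl
  map_smul' r q := by apply Complex.ext <;> simp

/-- The coordinate `w` in the decomposition `q = z + w j` with `z`, `w` complex. -/
def coordTwo : Quaternion ℝ →ₗ[ℝ] ℂ where
  toFun q := ⟨q.imJ, q.imK⟩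
  map_add' _ _ := rfl
  map_smul' r q := by apply Complex.ext <;> simp

/-- The imaginary unit `j`. -/
def unitJ : Quaternion ℝ := ⟨0, 0, 1, 0⟩

@[simp] theorem re_coordOne (q : Quaternion ℝ) : (coordOne q).re = q.re := rfl
@[simp] theorem im_coordOne (q : Quaternion ℝ) : (coordOne q).im = q.imI := rfl
@[simp] theorem re_coordTwo (q : Quaternion ℝ) : (coordTwo q).re = q.imJ := rfl
@[simp] theorem im_coordTwo (q : Quaternion ℝ) : (coordTwo q).im = q.imK := rfl
@[simp] theorem re_unitJ : unitJ.re = 0 := rfl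
@[simp] theorem imI_unitJ : unitJ.imI = 0 := rfl
@[simp] theorem imJ_unitJ : unitJ.imJ = 1 := rfl
@[simp] theorem imK_unitJ : unitJ.imK = 0 := rfl

theorem coordOne_add_coordTwo (q : Quaternion ℝ) :
    Quaternion.ofComplex (coordOne q) + Quaternion.ofComplex (coordTwo q) * unitJ = q := by
  ext <;> simp

theorem coordOne_ofComplex_I_mul (q : Quaternion ℝ) :
    coordOne (Quaternion.ofComplex Complex.I * q) = Complex.I * coordOne q := by
  apply Complex.ext <;> simp

theorem coordTwo_ofComplex_I_mul (q : Quaternion ℝ) :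
    coordTwo (Quaternion.ofComplex Complex.I * q) = Complex.I * coordTwo q := by
  apply Complex.ext <;> simp

theorem ofComplex_eq (z : ℂ) :
    Quaternion.ofComplex z = (z.re : Quaternion ℝ) + z.im • Quaternion.ofComplex Complex.I := by
  ext <;> simp

theorem ofComplex_I_sq : (Quaternion.ofComplex Complex.I) ^ 2 = -1 := by
  rw [← map_pow, Complex.I_sq, map_neg, map_one]

theorem continuous_ofComplex : Continuous Quaternion.ofComplex :=
  Quaternion.ofComplex.toLinearMap.continuous_of_finiteDimensional

theorem norm_ofComplex (z : ℂ) : ‖Quaternion.ofComplex z‖ = ‖z‖ := by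
  rw [← sq_eq_sq₀ (norm_nonneg _) (norm_nonneg _), sq, ← Quaternion.normSq_eq_norm_mul_self,
    Quaternion.normSq_def', Complex.sq_norm, Complex.normSq_apply]
  simp; ring

theorem norm_unitJ : ‖unitJ‖ = 1 := by
  rw [← sq_eq_sq₀ (norm_nonneg _) zero_le_one, sq, ← Quaternion.normSq_eq_norm_mul_self,
    Quaternion.normSq_def']
  simp

theorem exists_eq_add_smul_of_sq (q : Quaternion ℝ) :
    ∃ (x y : ℝ) (I : Quaternion ℝ), I ^ 2 = -1 ∧ q = (x : Quaternion ℝ) + y • I := by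
  by_cases h : q.im = 0
  · refine ⟨q.re, 0, Quaternion.ofComplex Complex.I, ofComplex_I_sq, ?_⟩
    rw [zero_smul, add_zero]
    conv_lhs => rw [← Quaternion.re_add_im q, h, add_zero]
  · have h1 : ‖q.im‖ ≠ 0 := norm_ne_zero_iff.2 h
    refine ⟨q.re, ‖q.im‖, ‖q.im‖⁻¹ • q.im, ?_, ?_⟩
    · rw [smul_pow, Quaternion.im_sq, Quaternion.normSq_eq_norm_mul_self, smul_neg]
      rw [← Quaternion.coe_smul, smul_eq_mul]
      rw [show ‖q.im‖⁻¹ ^ 2 * (‖q.im‖ * ‖q.im‖) = 1 by field_simp, Quaternion.coe_one]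
    · rw [smul_inv_smul₀ h1, Quaternion.re_add_im]

/-- Any imaginary unit is conjugate to `i`. -/
theorem exists_ne_zero_mul_eq_mul {I : Quaternion ℝ} (hI : I ^ 2 = -1) :
    ∃ u ≠ 0, u * I = Quaternion.ofComplex Complex.I * u := by
  set i := Quaternion.ofComplex Complex.I with hi
  have hi2 : i * i = -1 := by rw [← sq]; exact ofComplex_I_sq
  rw [sq] at hI
  by_cases h : I = -i
  · refine ⟨unitJ, fun h0 => by simpa [h0] using norm_unitJ, ?_⟩
    rw [h, hi]
    ext <;> simp
  · refine ⟨1 - i * I, fun h0 => h ?_, ?_⟩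
    · rw [sub_eq_zero] at h0
      calc I = -(i * i) * I := by rw [hi2]; simp
        _ = -(i * (i * I)) := by noncomm_ring
        _ = -i := by rw [← h0, mul_one]
    · calc (1 - i * I) * I = I - i * (I * I) := by noncomm_ring
        _ = i - (i * i) * I := by rw [hI, hi2]; noncomm_ring
        _ = _ := by noncomm_ring

theorem differentiableOn_coord_slice {T : Set (Quaternion ℝ)} (hTo : IsOpen T)
    (hTs : AxiallySymmetric T) {f : Quaternion ℝ → Quaternion ℝ} (hf : SliceRegularOn f T)
    {φ : Quaternion ℝ →ₗ[ℝ] ℂ}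
    (hφ : ∀ q, φ (Quaternion.ofComplex Complex.I * q) = Complex.I * φ q)
    {I u : Quaternion ℝ} (hI : I ^ 2 = -1) (hu : u * I = Quaternion.ofComplex Complex.I * u) :
    DifferentiableOn ℂ (fun z : ℂ => φ (u * f ((z.re : Quaternion ℝ) + z.im • I)))
      (Quaternion.ofComplex ⁻¹' T) := by
  intro z hz
  refine DifferentiableAt.differentiableWithinAt ?_
  have hzT : (z.re : Quaternion ℝ) + z.im • I ∈ T := by
    refine hTs _ _ _ _ ofComplex_I_sq hI ?_
    rw [← ofComplex_eq]; exact hz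
  have hcr := hf.2 I hI z.re z.im hzT
  set G : ℝ × ℝ → Quaternion ℝ := fun p => f ((p.1 : Quaternion ℝ) + p.2 • I) with hG
  have hGd : DifferentiableAt ℝ G (z.re, z.im) := by
    have h1 : DifferentiableAt ℝ f ((z.re : Quaternion ℝ) + z.im • I) :=
      (hf.1 _ hzT).differentiableAt (hTo.mem_nhds hzT)
    refine DifferentiableAt.comp (𝕜 := ℝ) (g := f)
      (f := fun p : ℝ × ℝ => (p.1 : Quaternion ℝ) + p.2 • I) (z.re, z.im) h1 ?_
    have : (fun p : ℝ × ℝ => (p.1 : Quaternion ℝ) + p.2 • I) =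
        fun p : ℝ × ℝ => p.1 • (1 : Quaternion ℝ) + p.2 • I := by
      funext p; rw [← Algebra.algebraMap_eq_smul_one]; rfl
    rw [this]
    fun_prop
  let L : ℂ →L[ℝ] ℝ × ℝ := Complex.reCLM.prod Complex.imCLM
  let Φ : Quaternion ℝ →L[ℝ] ℂ :=
    LinearMap.toContinuousLinearMap (φ ∘ₗ LinearMap.mulLeft ℝ u)
  have hH : HasFDerivAt (𝕜 := ℝ) (fun z : ℂ => φ (u * f ((z.re : Quaternion ℝ) + z.im • I)))
      (Φ.comp ((fderiv ℝ G (z.re, z.im)).comp L)) z :=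
    Φ.hasFDerivAt.comp z (hGd.hasFDerivAt.comp (f := L) z L.hasFDerivAt)
  rw [differentiableAt_complex_iff_differentiableAt_real]
  refine ⟨hH.differentiableAt, ?_⟩
  rw [hH.fderiv]
  have e1 : L Complex.I = (0, 1) := by simp [L]
  have e2 : L 1 = (1, 0) := by simp [L]
  have e3 : ∀ q, Φ q = φ (u * q) := fun q => rfl
  simp only [ContinuousLinearMap.comp_apply, e1, e2, e3]
  set a := fderiv ℝ G (z.re, z.im) (1, 0)
  set b := fderiv ℝ G (z.re, z.im) (0, 1)
  have hb : b = I * a := by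
    rw [sq] at hI
    calc b = -(I * I) * b := by rw [hI]; simp
      _ = I * a - I * (a + I * b) := by noncomm_ring
      _ = I * a := by rw [hcr]; simp
  rw [hb, ← mul_assoc, hu, mul_assoc, hφ, smul_eq_mul]

end

section

open Topology Set Filter

theorem isPreconnected_slice {T : Set (Quaternion ℝ)}
    (hT : SimplyConnectedSpace ↥(T ∩ slicePlane (Quaternion.ofComplex Complex.I))) :
    IsPreconnected (Quaternion.ofComplex ⁻¹' T) ∧ (Quaternion.ofComplex ⁻¹' T).Nonempty := by
  have h1 : Quaternion.ofComplex ⁻¹' T =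
      coordOne '' (T ∩ slicePlane (Quaternion.ofComplex Complex.I)) := by
    ext z
    constructor
    · intro hz
      refine ⟨Quaternion.ofComplex z, ⟨hz, z.re, z.im, ofComplex_eq z⟩, ?_⟩
      apply Complex.ext <;> simp
    · rintro ⟨q, ⟨hq, x, y, hxy⟩, rfl⟩
      have : Quaternion.ofComplex (coordOne q) = q := by
        rw [hxy]; ext <;> simp
      rw [mem_preimage, this]; exact hq
  have h2 : IsPreconnected (T ∩ slicePlane (Quaternion.ofComplex Complex.I)) :=
    isPreconnected_iff_preconnectedSpace.2 inferInstance
  have h3 : (T ∩ slicePlane (Quaternion.ofComplex Complex.I)).Nonempty :=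
    nonempty_coe_sort.1 (inferInstance : Nonempty _)
  rw [h1]
  exact ⟨h2.image _ (coordOne.continuous_of_finiteDimensional).continuousOn, h3.image _⟩

theorem exists_real_mem_slice {T : Set (Quaternion ℝ)} (hTs : AxiallySymmetric T)
    (hp : IsPreconnected (Quaternion.ofComplex ⁻¹' T)) (hne : (Quaternion.ofComplex ⁻¹' T).Nonempty) :
    ∃ x : ℝ, (x : ℂ) ∈ Quaternion.ofComplex ⁻¹' T := by
  obtain ⟨z, hz⟩ := hne
  have hz' : (starRingEnd ℂ) z ∈ Quaternion.ofComplex ⁻¹' T := by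
    rw [mem_preimage, ofComplex_eq] at hz ⊢
    have := hTs _ _ _ (-Quaternion.ofComplex Complex.I) ofComplex_I_sq
      (by rw [neg_sq, ofComplex_I_sq]) hz
    rwa [smul_neg, ← neg_smul] at this
  have h0 : ∃ w ∈ Quaternion.ofComplex ⁻¹' T, w.im = 0 := by
    rcases le_total z.im 0 with h | h
    · exact hp.intermediate_value hz hz' Complex.continuous_im.continuousOn
        ⟨h, by simpa using h⟩
    · exact hp.intermediate_value hz' hz Complex.continuous_im.continuousOn
        ⟨by simpa using h, h⟩
  obtain ⟨w, hw, hw0⟩ := h0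
  exact ⟨w.re, by rwa [show (w.re : ℂ) = w from Complex.ext rfl hw0.symm]⟩

theorem eqOn_zero_of_forall_real {Ω : Set ℂ} (hΩ : IsOpen Ω) (hp : IsPreconnected Ω) {x : ℝ}
    (hx : (x : ℂ) ∈ Ω) {D : ℂ → ℂ} (hD : DifferentiableOn ℂ D Ω) (h0 : ∀ t : ℝ, D t = 0) :
    EqOn D 0 Ω := by
  refine (hD.analyticOnNhd hΩ).eqOn_of_preconnected_of_frequently_eq
    (fun _ _ => analyticAt_const) hp hx ?_
  have h1 : Tendsto (fun t : ℝ => (t : ℂ)) (𝓝[≠] x) (𝓝[≠] (x : ℂ)) := by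
    refine Complex.continuous_ofReal.continuousWithinAt.tendsto_nhdsWithin fun t ht => ?_
    simpa using ht
  exact h1.frequently (Eventually.of_forall fun t => by simp [h0]).frequently

theorem norm_half_conj_le {u i : Quaternion ℝ} (hi : ‖i‖ = 1) (s : Quaternion ℝ)
    (hs : s = i * u * i ∨ s = -(i * u * i)) : ‖(2⁻¹ : ℝ) • (u + s)‖ ≤ ‖u‖ := by
  have h1 : ‖s‖ = ‖u‖ := by
    rcases hs with rfl | rfl <;> simp [hi]
  rw [norm_smul]
  have := norm_add_le u s
  rw [Real.norm_of_nonneg (by norm_num)]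
  linarith

theorem norm_slice_sub_sum_le {T : Set (Quaternion ℝ)} (hT : MemFrakR T)
    {f : Quaternion ℝ → Quaternion ℝ} (hf : SliceRegularOn f T) {n : ℕ} {a : ℕ → Quaternion ℝ}
    {C : ℝ} (hC : ∀ z : ℂ, Quaternion.ofComplex z ∈ T → ‖f (Quaternion.ofComplex z) -
      ∑ k ∈ Finset.range n, Quaternion.ofComplex z ^ k * a k‖ ≤ C) {q : Quaternion ℝ} (hq : q ∈ T) :
    ‖f q - ∑ k ∈ Finset.range n, q ^ k * a k‖ ≤ 2 * C := by
  obtain ⟨hTo, hTs, hTc⟩ := hT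
  obtain ⟨x, y, I, hI, rfl⟩ := exists_eq_add_smul_of_sq q
  obtain ⟨u, hu0, hu⟩ := exists_ne_zero_mul_eq_mul hI
  obtain ⟨hp, hne⟩ := isPreconnected_slice (hTc _ ofComplex_I_sq)
  obtain ⟨x₀, hx₀⟩ := exists_real_mem_slice hTs hp hne
  set i := Quaternion.ofComplex Complex.I with hi
  have hi2 : i * i = -1 := by rw [← sq]; exact ofComplex_I_sq
  have hi1 : ‖i‖ = 1 := by rw [hi, norm_ofComplex, Complex.norm_I]
  set u₁ := (2⁻¹ : ℝ) • (u + -(i * u * i)) with hu₁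
  set u₂ := (2⁻¹ : ℝ) • (u + i * u * i) with hu₂
  have hc₁ : u₁ * i = i * u₁ := by
    rw [hu₁, smul_mul_assoc, mul_smul_comm]
    congr 1
    calc (u + -(i * u * i)) * i = u * i - i * u * (i * i) := by noncomm_ring
      _ = i * u - (i * i) * u * i := by rw [hi2]; noncomm_ring
      _ = _ := by noncomm_ring
  have hc₂ : u₂ * -i = i * u₂ := by
    rw [hu₂, smul_mul_assoc, mul_smul_comm]
    congr 1
    calc (u + i * u * i) * -i = -(u * i) - i * u * (i * i) := by noncomm_ring
      _ = i * u + (i * i) * u * i := by rw [hi2]; noncomm_ring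
      _ = _ := by noncomm_ring
  have hadd : u = u₁ + u₂ := by
    rw [hu₁, hu₂, ← smul_add, show u + -(i * u * i) + (u + i * u * i) = (2 : ℝ) • u by
      rw [two_smul]; abel, inv_smul_smul₀ two_ne_zero]
  have hrep : ∀ φ : Quaternion ℝ →ₗ[ℝ] ℂ, (∀ q, φ (i * q) = Complex.I * φ q) →
      ∀ z ∈ Quaternion.ofComplex ⁻¹' T, φ (u * f ((z.re : Quaternion ℝ) + z.im • I)) =
        φ (u₁ * f ((z.re : Quaternion ℝ) + z.im • i) +
          u₂ * f ((z.re : Quaternion ℝ) + z.im • -i)) := by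
    intro φ hφ z hz
    have h1 := differentiableOn_coord_slice hTo hTs hf hφ hI hu
    have h2 := differentiableOn_coord_slice hTo hTs hf hφ ofComplex_I_sq hc₁
    have h3 := differentiableOn_coord_slice hTo hTs hf hφ
      (show (-i) ^ 2 = -1 by rw [neg_sq, hi, ofComplex_I_sq]) hc₂
    have h4 := eqOn_zero_of_forall_real (hTo.preimage continuous_ofComplex) hp hx₀
      (h1.sub (h2.add h3)) (fun t => by simp [← map_add, ← add_mul, ← hadd]) hz
    rw [map_add]
    exact sub_eq_zero.1 h4
  have hz : Quaternion.ofComplex ⟨x, y⟩ ∈ T := by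
    rw [ofComplex_eq]; exact hTs _ _ _ _ hI ofComplex_I_sq hq
  have hz' : Quaternion.ofComplex ⟨x, -y⟩ ∈ T := by
    rw [ofComplex_eq, neg_smul, ← smul_neg]
    exact hTs _ _ _ _ hI (by rw [neg_sq, ofComplex_I_sq]) hq
  have e₁ : Quaternion.ofComplex ⟨x, y⟩ = (x : Quaternion ℝ) + y • i := ofComplex_eq _
  have e₂ : Quaternion.ofComplex ⟨x, -y⟩ = (x : Quaternion ℝ) + y • -i := by
    rw [ofComplex_eq, neg_smul, ← smul_neg]
  have hfrep : u * f ((x : Quaternion ℝ) + y • I) = u₁ * f (Quaternion.ofComplex ⟨x, y⟩) +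
      u₂ * f (Quaternion.ofComplex ⟨x, -y⟩) := by
    rw [e₁, e₂, ← coordOne_add_coordTwo (u * _), hrep coordOne coordOne_ofComplex_I_mul _ hz,
      hrep coordTwo coordTwo_ofComplex_I_mul _ hz, coordOne_add_coordTwo]
  have hcomm : ∀ (v J : Quaternion ℝ), v * J = i * v → ∀ k,
      v * ((x : Quaternion ℝ) + y • J) ^ k = ((x : Quaternion ℝ) + y • i) ^ k * v := by
    intro v J hv k
    refine (show SemiconjBy v ((x : Quaternion ℝ) + y • J) ((x : Quaternion ℝ) + y • i) from ?_).pow_right k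
    rw [SemiconjBy, mul_add, add_mul, mul_smul_comm, smul_mul_assoc, hv, Quaternion.coe_commutes]
  have hprep : u * ∑ k ∈ Finset.range n, ((x : Quaternion ℝ) + y • I) ^ k * a k =
      u₁ * (∑ k ∈ Finset.range n, Quaternion.ofComplex ⟨x, y⟩ ^ k * a k) +
      u₂ * ∑ k ∈ Finset.range n, Quaternion.ofComplex ⟨x, -y⟩ ^ k * a k := by
    rw [e₁, e₂, Finset.mul_sum, Finset.mul_sum, Finset.mul_sum, ← Finset.sum_add_distrib]
    refine Finset.sum_congr rfl fun k _ => ?_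
    rw [← mul_assoc, ← mul_assoc, ← mul_assoc, hcomm u I hu, hcomm u₁ i hc₁, hcomm u₂ (-i) hc₂,
      ← add_mul, ← mul_add, ← hadd]
  have key : u * (f ((x : Quaternion ℝ) + y • I) -
      ∑ k ∈ Finset.range n, ((x : Quaternion ℝ) + y • I) ^ k * a k) =
      u₁ * (f (Quaternion.ofComplex ⟨x, y⟩) -
        ∑ k ∈ Finset.range n, Quaternion.ofComplex ⟨x, y⟩ ^ k * a k) +
      u₂ * (f (Quaternion.ofComplex ⟨x, -y⟩) -
        ∑ k ∈ Finset.range n, Quaternion.ofComplex ⟨x, -y⟩ ^ k * a k) := by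
    rw [mul_sub, hfrep, hprep]; noncomm_ring
  have hu_pos : 0 < ‖u‖ := norm_pos_iff.2 hu0
  refine le_of_mul_le_mul_left ?_ hu_pos
  rw [← norm_mul, key]
  refine (norm_add_le _ _).trans ?_
  rw [norm_mul, norm_mul]
  have b₁ : ‖u₁‖ ≤ ‖u‖ := norm_half_conj_le hi1 _ (Or.inr rfl)
  have b₂ : ‖u₂‖ ≤ ‖u‖ := norm_half_conj_le hi1 _ (Or.inl rfl)
  have := mul_le_mul b₁ (hC _ hz) (norm_nonneg _) hu_pos.le
  have := mul_le_mul b₂ (hC _ hz') (norm_nonneg _) hu_pos.le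
  linarith

theorem polyApprox_coord {T : Set (Quaternion ℝ)} (hT : MemFrakR T)
    (hTbdd : Bornology.IsBounded T)
    (hJ : IsJordanRegionIn (Quaternion.ofComplex Complex.I)
      (T ∩ slicePlane (Quaternion.ofComplex Complex.I)))
    {f : Quaternion ℝ → Quaternion ℝ} (hf : SliceRegularOn f T) (hfc : ContinuousOn f (closure T))
    {φ : Quaternion ℝ →ₗ[ℝ] ℂ}
    (hφ : ∀ q, φ (Quaternion.ofComplex Complex.I * q) = Complex.I * φ q) :
    PolyApprox (closure (Quaternion.ofComplex ⁻¹' T)) (fun z => φ (f (Quaternion.ofComplex z))) := by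
  obtain ⟨-, -, -, γ, hγ, hinj, hγr⟩ := hJ
  have hφc : Continuous coordOne := coordOne.continuous_of_finiteDimensional
  let e : ℂ ≃ₜ ↥(slicePlane (Quaternion.ofComplex Complex.I)) :=
    { toFun := fun z => ⟨Quaternion.ofComplex z, z.re, z.im, ofComplex_eq z⟩
      invFun := fun q => coordOne q.1
      left_inv := fun z => by apply Complex.ext <;> simp
      right_inv := fun q => by
        obtain ⟨q, x, y, rfl⟩ := q
        apply Subtype.ext
        ext <;> simp
      continuous_toFun := continuous_ofComplex.subtype_mk _
      continuous_invFun := hφc.comp continuous_subtype_val }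
  have hpre : e ⁻¹' (Subtype.val ⁻¹' (T ∩ slicePlane (Quaternion.ofComplex Complex.I))) =
      Quaternion.ofComplex ⁻¹' T := by
    ext z
    exact ⟨fun h => h.1, fun h => ⟨h, z.re, z.im, ofComplex_eq z⟩⟩
  refine polyApprox_of_jordan (γ := e.symm ∘ γ) (e.symm.continuous.comp hγ)
    (e.symm.injective.comp hinj) (hT.1.preimage continuous_ofComplex) ?_
    (isPreconnected_slice (hT.2.2 _ ofComplex_I_sq)).2 ?_ ?_ ?_
  · obtain ⟨R, hR⟩ := hTbdd.subset_ball 0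
    refine (Metric.isBounded_ball (x := (0 : ℂ)) (r := R)).subset fun z hz => ?_
    have := hR hz
    rwa [mem_ball_zero_iff, norm_ofComplex, ← mem_ball_zero_iff] at this
  · rw [← hpre, ← e.preimage_frontier, ← hγr, range_comp, e.image_symm]
  · refine (φ.continuous_of_finiteDimensional.comp_continuousOn hfc).comp
      continuous_ofComplex.continuousOn fun z hz => ?_
    exact map_mem_closure continuous_ofComplex hz fun w hw => hw
  · have := differentiableOn_coord_slice hT.1 hT.2.1 hf hφ ofComplex_I_sq (u := 1) (by simp)
    simpa only [one_mul, ← ofComplex_eq] using this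

end

/-- Let `T ∈ 𝔯(ℍ)` be bounded with every slice `T ∩ ℂ_I` a Jordan region in `ℂ_I`, and
let `α ∈ closure T`. If `f` is slice regular on `T` and continuous on `closure T`, then
for every `ε > 0` there is a polynomial `P(q) = ∑_{k=0}^n q^k a_k` with `P(α) = f(α)`
and `sup_{q ∈ closure T} ‖f q − P q‖ < ε`. -/
theorem mergelyan_type_frakR_with_interpolation
    (T : Set (Quaternion ℝ)) (hT : MemFrakR T) (hTbdd : Bornology.IsBounded T)
    (hTslice : ∀ I : Quaternion ℝ, I ^ 2 = -1 → IsJordanRegionIn I (T ∩ slicePlane I))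
    (α : Quaternion ℝ) (hα : α ∈ closure T)
    (f : Quaternion ℝ → Quaternion ℝ)
    (hfreg : SliceRegularOn f T) (hfcont : ContinuousOn f (closure T))
    (ε : ℝ) (hε : 0 < ε) :
    ∃ (n : ℕ) (a : ℕ → Quaternion ℝ),
      (∑ k ∈ Finset.range (n + 1), α ^ k * a k) = f α ∧
      ∀ q ∈ closure T, ‖f q - ∑ k ∈ Finset.range (n + 1), q ^ k * a k‖ < ε := by
  have hJ := hTslice _ ofComplex_I_sq
  obtain ⟨p₁, hp₁⟩ := polyApprox_coord hT hTbdd hJ hfreg hfcont coordOne_ofComplex_I_mul (ε / 9)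
    (by positivity)
  obtain ⟨p₂, hp₂⟩ := polyApprox_coord hT hTbdd hJ hfreg hfcont coordTwo_ofComplex_I_mul (ε / 9)
    (by positivity)
  set n := max p₁.natDegree p₂.natDegree with hn
  set a : ℕ → Quaternion ℝ := fun k =>
    Quaternion.ofComplex (p₁.coeff k) + Quaternion.ofComplex (p₂.coeff k) * unitJ with ha
  have hsum : ∀ z : ℂ, ∑ k ∈ Finset.range (n + 1), Quaternion.ofComplex z ^ k * a k =
      Quaternion.ofComplex (p₁.eval z) + Quaternion.ofComplex (p₂.eval z) * unitJ := by
    intro z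
    rw [Polynomial.eval_eq_sum_range' (n := n + 1) (by omega) z,
      Polynomial.eval_eq_sum_range' (n := n + 1) (by omega) z, map_sum, map_sum, Finset.sum_mul,
      ← Finset.sum_add_distrib]
    refine Finset.sum_congr rfl fun k _ => ?_
    rw [ha, mul_comm (p₁.coeff k), mul_comm (p₂.coeff k)]
    simp only [map_mul, map_pow]
    noncomm_ring
  have hslice : ∀ z : ℂ, Quaternion.ofComplex z ∈ T → ‖f (Quaternion.ofComplex z) -
      ∑ k ∈ Finset.range (n + 1), Quaternion.ofComplex z ^ k * a k‖ ≤ 2 * (ε / 9) := by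
    intro z hz
    have hzc : z ∈ closure (Quaternion.ofComplex ⁻¹' T) := subset_closure hz
    rw [hsum, ← coordOne_add_coordTwo (f (Quaternion.ofComplex z)), add_sub_add_comm, ← sub_mul,
      ← map_sub, ← map_sub]
    refine (norm_add_le _ _).trans ?_
    rw [norm_mul, norm_unitJ, norm_ofComplex, norm_ofComplex, mul_one, two_mul]
    exact add_le_add (hp₁ z hzc) (hp₂ z hzc)
  have hclosure : ∀ q ∈ closure T,
      ‖f q - ∑ k ∈ Finset.range (n + 1), q ^ k * a k‖ ≤ 2 * (2 * (ε / 9)) := by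
    intro q hq
    have hc : ContinuousOn (fun q => ‖f q - ∑ k ∈ Finset.range (n + 1), q ^ k * a k‖) (closure T) :=
      (hfcont.sub (by fun_prop)).norm
    have h1 : Set.MapsTo (fun q => ‖f q - ∑ k ∈ Finset.range (n + 1), q ^ k * a k‖) T
        (Set.Iic (2 * (2 * (ε / 9)))) := fun q hq => norm_slice_sub_sum_le hT hfreg hslice hq
    exact isClosed_Iic.closure_subset ((h1.closure_of_continuousOn hc) hq)
  set c := f α - ∑ k ∈ Finset.range (n + 1), α ^ k * a k with hc
  have hshift : ∀ q : Quaternion ℝ, ∑ k ∈ Finset.range (n + 1), q ^ k * (a k + if k = 0 then c else 0) =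
      (∑ k ∈ Finset.range (n + 1), q ^ k * a k) + c := by
    intro q
    simp only [mul_add, Finset.sum_add_distrib, mul_ite, mul_zero]
    simp
  refine ⟨n, fun k => a k + if k = 0 then c else 0, ?_, fun q hq => ?_⟩
  · rw [hshift, hc]; abel
  · rw [hshift, ← sub_sub]
    refine (norm_sub_le _ _).trans_lt ?_
    linarith [hclosure q hq, hclosure α hα]
end
end

section
/- Approximation on boundaries by polynomials in q and q⁻¹: let Σ be the boundary of an open set Ω ∈ 𝔯(ℍ) containing the origin, and assume Σ ∩ ℂ_I is a Jordan curve for every unit imaginary quaternion I. Then every continuous slice function f on Σ can be uniformly approximated on Σ by polynomials in q and q⁻¹: for every ε > 0 there exist m, n ∈ ℕ and coefficients a_k ∈ ℍ such that sup_{q ∈ Σ} ‖f(q) − ∑_{k=−m}^{n} q^k a_k‖ < ε. -/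
noncomputable section

section ClosedSubalgebra

open Set Metric

variable {X : Type*} [TopologicalSpace X] [CompactSpace X]

theorem exists_mem_closedSubalgebra_hasSum {A : Subalgebra ℂ C(X, ℂ)}
    (hA : IsClosed (A : Set C(X, ℂ))) {f : C(X, ℂ)} (hf : f ∈ A) (c : ℕ → ℂ)
    (hc : Summable fun n => ‖c n‖ * ‖f‖ ^ n) :
    ∃ g ∈ A, ∀ x, HasSum (fun n => c n * f x ^ n) (g x) := by
  have hs : Summable fun n => c n • f ^ n := by
    refine Summable.of_norm_bounded hc fun n => ?_
    rw [norm_smul]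
    refine mul_le_mul_of_nonneg_left ?_ (norm_nonneg _)
    refine (ContinuousMap.norm_le _ (by positivity)).2 fun x => ?_
    simpa using pow_le_pow_left₀ (norm_nonneg _) (f.norm_coe_le_norm x) n
  refine ⟨∑' n, c n • f ^ n, ?_, fun x => ?_⟩
  · exact hA.mem_of_tendsto hs.hasSum (Filter.Eventually.of_forall fun s =>
      sum_mem fun n _ => A.smul_mem (pow_mem hf n) _)
  · simpa using ContinuousMap.hasSum_apply hs.hasSum x

theorem exists_mem_closedSubalgebra_exp {A : Subalgebra ℂ C(X, ℂ)}
    (hA : IsClosed (A : Set C(X, ℂ))) {f : C(X, ℂ)} (hf : f ∈ A) :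
    ∃ g ∈ A, ∀ x, g x = Complex.exp (f x) := by
  obtain ⟨g, hg, h⟩ := exists_mem_closedSubalgebra_hasSum hA hf (fun n => ((n.factorial : ℂ))⁻¹) (by
    simpa [div_eq_inv_mul] using Real.summable_pow_div_factorial ‖f‖)
  refine ⟨g, hg, fun x => (h x).unique ?_⟩
  rw [Complex.exp_eq_exp_ℂ]
  simpa [div_eq_inv_mul] using NormedSpace.expSeries_div_hasSum_exp (𝔸 := ℂ) (f x)

theorem exists_mem_closedSubalgebra_log {A : Subalgebra ℂ C(X, ℂ)}
    (hA : IsClosed (A : Set C(X, ℂ))) {f : C(X, ℂ)} (hf : f ∈ A) (hf1 : ‖f‖ < 1) :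
    ∃ g ∈ A, ∀ x, g x = Complex.log (1 + f x) := by
  obtain ⟨g, hg, h⟩ := exists_mem_closedSubalgebra_hasSum hA hf
    (fun n => (-1 : ℂ) ^ (n + 1) / n) (by
      refine Summable.of_nonneg_of_le (fun n => by positivity) (fun n => ?_)
        (summable_geometric_of_lt_one (norm_nonneg f) hf1)
      refine mul_le_of_le_one_left (by positivity) ?_
      rcases Nat.eq_zero_or_pos n with rfl | hn
      · simp
      · simpa using inv_le_one_of_one_le₀ (by exact_mod_cast hn : (1 : ℝ) ≤ n))
  refine ⟨g, hg, fun x => (h x).unique ?_⟩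
  simpa only [div_mul_eq_mul_div] using
    Complex.hasSum_taylorSeries_log ((f.norm_coe_le_norm x).trans_lt hf1)

end ClosedSubalgebra

section Resolvent

open Set Metric

variable {Γ : Set ℂ}

/-- The point `p` lies off `Γ` and `z ↦ (z - p)⁻¹` belongs to `A`. -/
def HasResolventIn (A : Subalgebra ℂ C(Γ, ℂ)) (p : ℂ) : Prop :=
  ∃ g ∈ A, ∀ z : Γ, g z * (z - p) = 1

theorem HasResolventIn.notMem {A : Subalgebra ℂ C(Γ, ℂ)} {p : ℂ} (h : HasResolventIn A p) :
    p ∉ Γ := by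
  rintro hp
  obtain ⟨g, -, hg⟩ := h
  simpa using hg ⟨p, hp⟩

theorem sub_ne_zero_of_notMem {p : ℂ} (h : p ∉ Γ) (z : Γ) : (z : ℂ) - p ≠ 0 :=
  sub_ne_zero.2 fun e => h (e ▸ z.2)

variable [CompactSpace Γ]

/-- Moving a pole by less than its distance to `Γ` costs the logarithm of a factor close to `1`. -/
theorem HasResolventIn.exists_log {A : Subalgebra ℂ C(Γ, ℂ)}
    (hA : IsClosed (A : Set C(Γ, ℂ))) {p q : ℂ} (hp : HasResolventIn A p)
    (hpq : ‖q - p‖ < infDist p Γ) :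
    ∃ L ∈ A, ∀ z : Γ, 0 < (((z : ℂ) - q) / (z - p)).re ∧
      L z = Complex.log ((z - q) / (z - p)) := by
  obtain ⟨g, hgA, hg⟩ := id hp
  have hg' : ∀ z : Γ, g z = ((z : ℂ) - p)⁻¹ := fun z => eq_inv_of_mul_eq_one_left (hg z)
  have hw : ‖(p - q) • g‖ < 1 := by
    have hd : 0 < infDist p Γ := (norm_nonneg _).trans_lt hpq
    refine lt_of_le_of_lt ((ContinuousMap.norm_le _ (by positivity : 0 ≤ ‖q - p‖ / infDist p Γ)).2
      fun z => ?_) ((div_lt_one hd).2 hpq)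
    have : infDist p Γ ≤ ‖(z : ℂ) - p‖ := by
      simpa [dist_eq_norm, norm_sub_rev] using infDist_le_dist_of_mem (x := p) z.2
    rw [ContinuousMap.smul_apply, norm_smul, hg', norm_inv, norm_sub_rev p q, ← div_eq_mul_inv]
    gcongr
  have e : ∀ z : Γ, 1 + ((p - q) • g) z = (z - q) / (z - p) := fun z => by
    have := sub_ne_zero_of_notMem hp.notMem z
    simp only [ContinuousMap.coe_smul, Pi.smul_apply, smul_eq_mul, hg']
    field_simp
    ring
  obtain ⟨L, hL, h⟩ := exists_mem_closedSubalgebra_log hA (A.smul_mem hgA (p - q)) hw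
  refine ⟨L, hL, fun z => ⟨?_, by rw [h, e]⟩⟩
  rw [← e z, Complex.add_re, Complex.one_re]
  have h1 := (((p - q) • g).norm_coe_le_norm z).trans_lt hw
  have h2 := (abs_le.1 (Complex.abs_re_le_norm (((p - q) • g) z))).1
  linarith

theorem HasResolventIn.of_near {A : Subalgebra ℂ C(Γ, ℂ)}
    (hA : IsClosed (A : Set C(Γ, ℂ))) {p q : ℂ} (hp : HasResolventIn A p)
    (hpq : ‖q - p‖ < infDist p Γ) : HasResolventIn A q := by
  obtain ⟨L, hL, h⟩ := hp.exists_log hA hpq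
  obtain ⟨E, hE, h'⟩ := exists_mem_closedSubalgebra_exp hA (neg_mem hL)
  obtain ⟨g, hgA, hg⟩ := id hp
  refine ⟨g * E, mul_mem hgA hE, fun z => ?_⟩
  have h1 : ((z : ℂ) - q) / (z - p) ≠ 0 := fun h0 => by simpa [h0] using (h z).1
  have h2 := sub_ne_zero_of_notMem hp.notMem z
  have h3 : (z : ℂ) - q ≠ 0 := fun h0 => by simp [h0] at h1
  simp only [ContinuousMap.mul_apply, h', ContinuousMap.neg_apply, (h z).2, Complex.exp_neg,
    Complex.exp_log h1, eq_inv_of_mul_eq_one_left (hg z)]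
  field_simp

theorem hasResolventIn_of_norm_gt {A : Subalgebra ℂ C(Γ, ℂ)}
    (hA : IsClosed (A : Set C(Γ, ℂ))) (hid : ContinuousMap.restrict Γ (.id ℂ) ∈ A) {p : ℂ}
    (hp : ‖ContinuousMap.restrict Γ (.id ℂ)‖ < ‖p‖) : HasResolventIn A p := by
  have hp0 : p ≠ 0 := norm_pos_iff.1 ((norm_nonneg _).trans_lt hp)
  obtain ⟨L, hL, h⟩ := exists_mem_closedSubalgebra_log hA (A.smul_mem hid (-p⁻¹)) (by
    rw [norm_smul, norm_neg, norm_inv, ← div_eq_inv_mul]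
    exact (div_lt_one (norm_pos_iff.2 hp0)).2 hp)
  obtain ⟨E, hE, h'⟩ := exists_mem_closedSubalgebra_exp hA (neg_mem hL)
  refine ⟨(-p⁻¹) • E, A.smul_mem hE _, fun z => ?_⟩
  have hz : ‖(z : ℂ)‖ < ‖p‖ :=
    ((ContinuousMap.restrict Γ (.id ℂ)).norm_coe_le_norm z).trans_lt hp
  have hzp : (z : ℂ) - p ≠ 0 := sub_ne_zero.2 fun e => by simp [e] at hz
  have e : 1 + -p⁻¹ * (z : ℂ) = -((z - p) / p) := by field_simp; ring
  have e0 : -(((z : ℂ) - p) / p) ≠ 0 := neg_ne_zero.2 (div_ne_zero hzp hp0)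
  simp only [ContinuousMap.coe_smul, Pi.smul_apply, smul_eq_mul, h', ContinuousMap.neg_apply, h,
    ContinuousMap.restrict_apply, ContinuousMap.id_apply, e, Complex.exp_neg, Complex.exp_log e0]
  field_simp

/-- If `T` absorbs every point of `O` that is closer to a point of `T` than `Γ` is,
then `T` is relatively clopen in `O`. -/
theorem relatively_clopen_of_near {Γ O T : Set ℂ} (hΓ : IsClosed Γ) (hΓ0 : Γ.Nonempty)
    (hO : IsOpen O) (hOΓ : Disjoint O Γ) (hTO : T ⊆ O)
    (h : ∀ b ∈ T, ∀ b' ∈ O, ‖b' - b‖ < infDist b Γ → b' ∈ T) :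
    IsOpen T ∧ closure T ∩ O ⊆ T := by
  have hpos : ∀ x ∈ O, 0 < infDist x Γ := fun x hx =>
    (hΓ.notMem_iff_infDist_pos hΓ0).1 (disjoint_left.1 hOΓ hx)
  constructor
  · rw [Metric.isOpen_iff]
    intro b hb
    obtain ⟨ε, hε, hε'⟩ := Metric.isOpen_iff.1 hO b (hTO hb)
    refine ⟨min ε (infDist b Γ), lt_min hε (hpos b (hTO hb)), fun x hx => ?_⟩
    rw [mem_ball, lt_min_iff] at hx
    exact h b hb x (hε' hx.1) (by simpa [dist_eq_norm] using hx.2)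
  · rintro q ⟨hq, hqO⟩
    have hd := hpos q hqO
    obtain ⟨b, hb, hqb⟩ := Metric.mem_closure_iff.1 hq (infDist q Γ / 2) (by linarith)
    refine h b hb q hqO ?_
    have := infDist_le_infDist_add_dist (s := Γ) (x := q) (y := b)
    rw [← dist_eq_norm]
    linarith

theorem isOpen_hasResolventIn_and_closure {A : Subalgebra ℂ C(Γ, ℂ)}
    (hA : IsClosed (A : Set C(Γ, ℂ))) (hΓ0 : Γ.Nonempty) :
    IsOpen {p | HasResolventIn A p} ∧
      closure {p | HasResolventIn A p} ∩ Γᶜ ⊆ {p | HasResolventIn A p} := by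
  have hΓ : IsClosed Γ := (isCompact_iff_compactSpace.2 inferInstance).isClosed
  exact relatively_clopen_of_near hΓ hΓ0 hΓ.isOpen_compl disjoint_compl_left
    (fun p hp => hp.notMem) fun b hb b' _ hbb' => HasResolventIn.of_near hA hb hbb'

end Resolvent

section JordanTopology

open Set Metric Complex

theorem exists_continuous_exp_eq {X : Type*} [TopologicalSpace X] [SimplyConnectedSpace X]
    [LocallyPathConnectedSpace X] {g : X → ℂ} (hg : Continuous g) (hg0 : ∀ x, g x ≠ 0) :
    ∃ h : X → ℂ, Continuous h ∧ ∀ x, exp (h x) = g x := by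
  obtain ⟨x₀⟩ : Nonempty X := inferInstance
  obtain ⟨h, ⟨-, hh⟩, -⟩ := isCoveringMapOn_exp.existsUnique_continuousMap_lifts
    ⟨g, hg⟩ (exp_log (hg0 x₀)) fun x => hg0 x
  exact ⟨h, h.continuous, fun x => congrFun hh x⟩

theorem eq_of_continuous_of_exp_eq {X : Type*} [TopologicalSpace X] [PreconnectedSpace X]
    {h₁ h₂ : X → ℂ} (h₁c : Continuous h₁) (h₂c : Continuous h₂)
    (h : ∀ x, exp (h₁ x) = exp (h₂ x)) {x₀ : X} (h0 : h₁ x₀ = h₂ x₀) : h₁ = h₂ :=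
  isCoveringMap_exp.eq_of_comp_eq h₁c h₂c (funext fun x => Subtype.ext (h x)) x₀ h0

theorem exponent_eq_zero_of_periodic_log {k : ℝ → ℂ} (hk : Continuous k)
    (hper : k (2 * Real.pi) = k 0) {R : ℝ} (hR : 0 < R) {N : ℤ}
    (h : ∀ θ : ℝ, exp (k θ) = (R * exp (θ * I)) ^ N) : N = 0 := by
  have key := eq_of_continuous_of_exp_eq (h₁ := fun θ : ℝ => k θ - N * (θ * I))
    (h₂ := fun _ => k 0) (by fun_prop) continuous_const (fun θ => by
      have hR' : (R : ℂ) ≠ 0 := by exact_mod_cast hR.ne'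
      have h0 := h 0
      rw [h0, exp_sub, h, exp_int_mul, mul_zpow, ofReal_zero, zero_mul, exp_zero, mul_one]
      have := zpow_ne_zero N (exp_ne_zero (θ * I))
      field_simp) (x₀ := 0) (by simp)
  have := congrFun key (2 * Real.pi)
  simp only [hper, sub_eq_self, mul_eq_zero, ofReal_eq_zero, I_ne_zero, or_false,
    Int.cast_eq_zero] at this
  exact this.resolve_right (by simp [Real.pi_ne_zero])

theorem exponent_eq_zero_of_eqOn_frontier {V : Set ℂ} (hV : IsOpen V)
    (hVb : Bornology.IsBounded V) {p : ℂ} (hp : p ∈ V) {N : ℤ} {w : ℂ → ℂ}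
    (hw : ContinuousOn w (closure V)) (hw0 : ∀ z ∈ closure V, w z ≠ 0)
    (h : ∀ z ∈ frontier V, (z - p) ^ N = w z) : N = 0 := by
  classical
  have hne : ∀ z ∈ Vᶜ, z - p ≠ 0 := fun z hz => sub_ne_zero.2 fun e => hz (e ▸ hp)
  have hG : Continuous (V.piecewise w fun z => (z - p) ^ N) := by
    refine continuous_piecewise (fun z hz => (h z hz).symm) hw ?_
    rw [hV.isClosed_compl.closure_eq]
    exact (continuousOn_id.sub continuousOn_const).zpow₀ N fun z hz => Or.inl (hne z hz)
  obtain ⟨H, hH, hHe⟩ := exists_continuous_exp_eq hG fun z => by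
    by_cases hz : z ∈ V
    · simpa [hz] using hw0 z (subset_closure hz)
    · simpa [hz] using zpow_ne_zero N (hne z hz)
  obtain ⟨R, hR, hRV⟩ := hVb.subset_ball_lt 0 p
  refine exponent_eq_zero_of_periodic_log (k := fun θ : ℝ => H (p + R * exp (θ * I)))
    (by fun_prop) ?_ hR fun θ => ?_
  · simp [exp_two_pi_mul_I]
  · rw [hHe, piecewise_eq_of_notMem]
    · simp
    · intro hmem
      simpa [norm_exp_ofReal_mul_I, abs_of_pos hR] using hRV hmem

theorem isBounded_of_isSimplyConnected {D : Set ℂ} (hD : IsOpen D) (hDs : IsSimplyConnected D)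
    (hF : Bornology.IsBounded (frontier D)) {p : ℂ} (hp : p ∉ D) : Bornology.IsBounded D := by
  obtain ⟨R, hR, hFR⟩ := hF.subset_closedBall_lt 0 p
  by_contra hDb
  have hne : (D ∩ (closedBall p R)ᶜ).Nonempty := by
    by_contra he
    exact hDb (isBounded_closedBall.subset (by
      simpa [not_nonempty_iff_eq_empty, ← disjoint_iff_inter_eq_empty, disjoint_compl_right_iff]
        using he))
  have hconn : IsPreconnected (closedBall p R)ᶜ := by
    have : (closedBall p R)ᶜ = (fun x : ℝ × ℝ => p + x.1 * exp (x.2 * I)) '' (Ioi R ×ˢ univ) := by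
      ext z
      simp only [mem_compl_iff, mem_closedBall, dist_eq_norm, not_le, mem_image, mem_prod, mem_Ioi,
        mem_univ, and_true, Prod.exists]
      constructor
      · exact fun h => ⟨‖z - p‖, arg (z - p), h, by rw [norm_mul_exp_arg_mul_I]; ring⟩
      · rintro ⟨r, θ, hr, rfl⟩
        rwa [add_sub_cancel_left, norm_mul, norm_exp_ofReal_mul_I, norm_real, mul_one,
          Real.norm_of_nonneg (hR.trans hr).le]
    rw [this]
    exact (isPreconnected_Ioi.prod isPreconnected_univ).image _ (by fun_prop)
  have hsub : (closedBall p R)ᶜ ⊆ D := by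
    refine hconn.subset_of_closure_inter_subset hD (by rwa [inter_comm]) ?_
    rintro z ⟨hz, hzR⟩
    by_contra hzD
    exact hzR (hFR (by rw [hD.frontier_eq]; exact ⟨hz, hzD⟩))
  obtain ⟨f, hf, hfe⟩ := exists_continuousOn_eqOn_exp_comp hDs hD (g := fun z => z - p)
    (by fun_prop) (by rintro ⟨z, hz, e⟩; exact hp (sub_eq_zero.1 e ▸ hz))
  have hmem : ∀ θ : ℝ, p + (R + 1 : ℝ) * exp (θ * I) ∈ D := fun θ => hsub (by
    rw [mem_compl_iff, mem_closedBall, dist_eq_norm, add_sub_cancel_left, norm_mul,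
      norm_exp_ofReal_mul_I, norm_real, Real.norm_of_nonneg (by positivity)]
    linarith)
  refine one_ne_zero (exponent_eq_zero_of_periodic_log (N := 1) (R := R + 1)
    (k := fun θ : ℝ => f (p + (R + 1 : ℝ) * exp (θ * I)))
    (hf.comp_continuous (by fun_prop) hmem) ?_ (by positivity) fun θ => ?_)
  · simp [exp_two_pi_mul_I]
  · have := hfe (hmem θ)
    simpa using this

theorem exists_periodic_log {u : Circle → ℂ} (hu : Continuous u) (hu0 : ∀ t, u t ≠ 0) :
    ∃ (H : ℝ → ℂ) (n : ℤ), Continuous H ∧ (∀ θ, exp (H θ) = u (Circle.exp θ)) ∧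
      ∀ θ, H (θ + 2 * Real.pi) = H θ + n * (2 * Real.pi * I) := by
  obtain ⟨H, hH, hHe⟩ := exists_continuous_exp_eq (g := fun θ : ℝ => u (Circle.exp θ))
    (by fun_prop) fun _ => hu0 _
  obtain ⟨n, hn⟩ := exp_eq_exp_iff_exists_int.1
    (show exp (H (0 + 2 * Real.pi)) = exp (H 0) by simp [hHe])
  refine ⟨H, n, hH, hHe, fun θ => ?_⟩
  refine congrFun (eq_of_continuous_of_exp_eq (h₁ := fun θ => H (θ + 2 * Real.pi))
    (h₂ := fun θ => H θ + n * (2 * Real.pi * I)) (by fun_prop) (by fun_prop) (fun θ => ?_) hn) θ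
  simp [hHe, exp_add, exp_int_mul]

/-- A Jordan curve cannot contain the boundaries of two disjoint bounded open sets. -/
theorem false_of_disjoint_isBounded_of_frontier_subset {c : Circle → ℂ} (hc : Continuous c)
    (hci : Function.Injective c) {U V : Set ℂ} (hU : IsOpen U) (hV : IsOpen V)
    (hUb : Bornology.IsBounded U) (hVb : Bornology.IsBounded V) (hUV : Disjoint U V)
    (hUf : frontier U ⊆ range c) (hVf : frontier V ⊆ range c)
    (hUc : Disjoint U (range c)) (hVc : Disjoint V (range c))
    {a b : ℂ} (ha : a ∈ U) (hb : b ∈ V) : False := by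
  have hac : ∀ t, c t - a ≠ 0 := fun t => sub_ne_zero.2 fun e =>
    disjoint_left.1 hUc ha ⟨t, e⟩
  have hbc : ∀ t, c t - b ≠ 0 := fun t => sub_ne_zero.2 fun e =>
    disjoint_left.1 hVc hb ⟨t, e⟩
  obtain ⟨Ha, n, hHa, hHae, hHan⟩ := exists_periodic_log (u := fun t => c t - a) (by fun_prop) hac
  obtain ⟨Hb, m, hHb, hHbe, hHbm⟩ := exists_periodic_log (u := fun t => c t - b) (by fun_prop) hbc
  obtain ⟨N, M, hNM, hne⟩ : ∃ N M : ℤ, N * n = M * m ∧ ¬ (N = 0 ∧ M = 0) := by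
    by_cases h : m = 0 ∧ n = 0
    · exact ⟨1, 0, by simp [h.2], by simp⟩
    · exact ⟨m, n, mul_comm _ _, h⟩
  let k : C(ℝ, ℂ) := ⟨fun θ => N * Ha θ - M * Hb θ, by fun_prop⟩
  have hk : Function.Periodic k (2 * Real.pi) := fun θ => by
    have : (N * n : ℂ) = M * m := by exact_mod_cast hNM
    simp only [k, ContinuousMap.coe_mk, hHan, hHbm]
    linear_combination (2 * Real.pi * I) * this
  have hq : Topology.IsQuotientMap Circle.exp :=
    Circle.isCoveringMap_exp.isQuotientMap Circle.exp_surjective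
  have hkf : ∀ x y, Circle.exp x = Circle.exp y → k x = k y := by
    intro x y hxy
    obtain ⟨j, rfl⟩ := Circle.exp_eq_exp.1 hxy
    exact hk.int_mul j y
  obtain ⟨g, hg⟩ := ContinuousMap.exists_extension' (hc.isClosedEmbedding hci)
    (hq.lift (f := ⟨Circle.exp, by fun_prop⟩) k hkf)
  have hgk : ∀ θ, g (c (Circle.exp θ)) = k θ := fun θ =>
    (congrFun hg (Circle.exp θ)).trans
      (DFunLike.congr_fun (hq.lift_comp (f := ⟨Circle.exp, by fun_prop⟩) k hkf) θ)
  have hrel : ∀ z ∈ range c, (z - a) ^ N = (z - b) ^ M * exp (g z) := by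
    rintro _ ⟨t, rfl⟩
    obtain ⟨θ, rfl⟩ := Circle.exp_surjective t
    rw [hgk, ← hHae, ← hHbe, ← exp_int_mul, ← exp_int_mul, ← exp_add]
    simp [k]
  have hbU : ∀ z ∈ closure U, z - b ≠ 0 := fun z hz => sub_ne_zero.2 fun e =>
    disjoint_left.1 (hUV.closure_left hV) hz (e ▸ hb)
  have haV : ∀ z ∈ closure V, z - a ≠ 0 := fun z hz => sub_ne_zero.2 fun e =>
    disjoint_left.1 (hUV.symm.closure_left hU) hz (e ▸ ha)
  refine hne ⟨?_, ?_⟩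
  · refine exponent_eq_zero_of_eqOn_frontier hU hUb ha (w := fun z => (z - b) ^ M * exp (g z))
      (((continuousOn_id.sub continuousOn_const).zpow₀ M fun z hz => Or.inl (hbU z hz)).mul
        (by fun_prop)) (fun z hz => mul_ne_zero (zpow_ne_zero _ (hbU z hz)) (exp_ne_zero _))
      fun z hz => hrel z (hUf hz)
  · refine exponent_eq_zero_of_eqOn_frontier hV hVb hb (w := fun z => (z - a) ^ N * exp (-g z))
      (((continuousOn_id.sub continuousOn_const).zpow₀ N fun z hz => Or.inl (haV z hz)).mul
        (by fun_prop)) (fun z hz => mul_ne_zero (zpow_ne_zero _ (haV z hz)) (exp_ne_zero _))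
      fun z hz => ?_
    rw [hrel z (hVf hz), mul_assoc, ← exp_add]
    simp

end JordanTopology

section Kernel

open Set Metric

theorem Complex.log_div_of_re_pos {u v : ℂ} (hu : 0 < u.re) (hv : 0 < v.re) :
    Complex.log (v / u) = Complex.log v - Complex.log u := by
  have hu0 : u ≠ 0 := fun h => by simp [h] at hu
  have hv0 : v ≠ 0 := fun h => by simp [h] at hv
  have h1 := abs_lt.1 (Complex.abs_arg_lt_pi_div_two_iff.2 (Or.inl hu))
  have h2 := abs_lt.1 (Complex.abs_arg_lt_pi_div_two_iff.2 (Or.inl hv))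
  rw [← Complex.log_exp (x := Complex.log v - Complex.log u), Complex.exp_sub,
    Complex.exp_log hu0, Complex.exp_log hv0]
  · simp only [Complex.sub_im, Complex.log_im]; linarith
  · simp only [Complex.sub_im, Complex.log_im]; linarith

theorem algebraMap_continuousMap_apply {X : Type*} [TopologicalSpace X] (a : ℂ) (x : X) :
    algebraMap ℂ C(X, ℂ) a x = a := rfl

theorem one_sub_lt_re_div_of_mem_ball {p a z : ℂ} {R : ℝ} (ha : a ∈ ball p R) {t : ℝ}
    (ht : 0 < t) (hz : t * R < ‖z - p‖) : 1 - 1 / t < ((z - a) / (z - p)).re := by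
  have haR : ‖a - p‖ < R := by simpa [dist_eq_norm] using ha
  have hR : 0 < R := (norm_nonneg _).trans_lt haR
  have hzp : 0 < ‖z - p‖ := (by positivity : 0 < t * R).trans hz
  have e : (z - a) / (z - p) = 1 - (a - p) / (z - p) := by
    have := norm_pos_iff.1 hzp
    field_simp
    ring
  have h1 : ‖(a - p) / (z - p)‖ < 1 / t := by
    rw [norm_div, div_lt_div_iff₀ hzp ht]
    nlinarith
  have h2 := (abs_le.1 (Complex.abs_re_le_norm ((a - p) / (z - p)))).2
  rw [e, Complex.sub_re, Complex.one_re]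
  linarith

variable {Γ : Set ℂ} [CompactSpace Γ]

/-- Near a boundary point `p` of `D` there is a branch of `√((z - a)(z - b))` in `A`, with
`a`, `b` close to `p` but well separated. -/
theorem exists_sqrt_branch {A : Subalgebra ℂ C(Γ, ℂ)} (hA : IsClosed (A : Set C(Γ, ℂ)))
    (hid : ContinuousMap.restrict Γ (.id ℂ) ∈ A) {D : Set ℂ} (hD : IsOpen D)
    (hDc : IsPreconnected D) (hDΓ : Disjoint D Γ) (hres : ∀ a ∈ D, HasResolventIn A a)
    {p : ℂ} (hpΓ : p ∈ Γ) (hp : p ∈ closure D) {R : ℝ} (hR : 0 < R) {d : ℂ} (hd : d ∈ D)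
    (hdp : R ≤ ‖d - p‖) :
    ∃ a ∈ ball p R, ∃ b ∈ ball p R, R / 2 ≤ ‖b - a‖ ∧ ∃ s ∈ A, ∀ z : Γ,
      s z ^ 2 = (z - a) * (z - b) ∧ (R < ‖(z : ℂ) - p‖ → 0 < (s z / (z - p)).re) := by
  have hΓ : IsClosed Γ := (isCompact_iff_compactSpace.2 inferInstance).isClosed
  obtain ⟨a, haD, hpa⟩ := Metric.mem_closure_iff.1 hp (R / 4) (by positivity)
  rw [dist_comm] at hpa
  let O : Set ℂ := D ∩ ball p R
  have haO : a ∈ O := ⟨haD, by rw [mem_ball]; linarith⟩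
  let T : Set ℂ := {b | b ∈ O ∧ ∃ L ∈ A, ∀ z : Γ, Complex.exp (L z) = (z - b) / (z - a) ∧
    (R < ‖(z : ℂ) - p‖ → L z = Complex.log ((z - b) / (z - p)) - Complex.log ((z - a) / (z - p)))}
  have hza : ∀ b ∈ O, ∀ z : Γ, (z : ℂ) - b ≠ 0 := fun b hb =>
    sub_ne_zero_of_notMem (disjoint_left.1 hDΓ hb.1)
  have hzp : ∀ {z : ℂ}, R < ‖z - p‖ → z - p ≠ 0 := fun h =>
    norm_pos_iff.1 (hR.trans h)
  have hre : ∀ b ∈ O, ∀ z : Γ, R < ‖(z : ℂ) - p‖ → 0 < (((z : ℂ) - b) / (z - p)).re :=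
    fun b hb z hz => by
      have := one_sub_lt_re_div_of_mem_ball hb.2 one_pos (z := z) (by simpa using hz)
      simpa using this
  have haT : a ∈ T := by
    refine ⟨haO, 0, zero_mem _, fun z => ⟨?_, fun _ => by simp⟩⟩
    simp [div_self (hza a haO z)]
  obtain ⟨hTo, hTc⟩ := relatively_clopen_of_near (T := T) hΓ ⟨p, hpΓ⟩ (hD.inter isOpen_ball)
    (hDΓ.mono_left inter_subset_left) (fun b hb => hb.1) (by
      rintro b ⟨hbO, L, hL, hLz⟩ b' hb' hbb'
      obtain ⟨L', hL', hLz'⟩ := (hres b hbO.1).exists_log hA hbb'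
      refine ⟨hb', L + L', add_mem hL hL', fun z => ⟨?_, fun hz => ?_⟩⟩
      · have h1 := hza b hbO z
        have h2 := hza a haO z
        rw [ContinuousMap.add_apply, Complex.exp_add, (hLz z).1, (hLz' z).2,
          Complex.exp_log (div_ne_zero (hza b' hb' z) h1)]
        field_simp
      · rw [ContinuousMap.add_apply, (hLz z).2 hz, (hLz' z).2,
          ← div_div_div_cancel_right₀ (hzp hz) ((z : ℂ) - b') (z - b),
          Complex.log_div_of_re_pos (hre b hbO z hz) (hre b' hb' z hz)]
        ring)
  obtain ⟨b, hbT, hab⟩ : ∃ b ∈ T, R / 2 ≤ ‖b - a‖ := by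
    by_contra! hfar
    have hsub : closure T ⊆ ball p R := fun x hx => by
      have : closure T ⊆ closedBall a (R / 2) := closure_minimal
        (fun y hy => by simpa [dist_eq_norm] using (hfar y hy).le) isClosed_closedBall
      have h1 := mem_closedBall.1 (this hx)
      have := dist_triangle x a p
      rw [mem_ball]
      linarith
    have hDT : D ⊆ T := hDc.subset_of_closure_inter_subset hTo ⟨a, haD, haT⟩
      fun x hx => hTc ⟨hx.1, hx.2, hsub hx.1⟩
    have := (hDT hd).1.2
    rw [mem_ball, dist_eq_norm] at this
    linarith
  obtain ⟨hbO, L, hL, hLz⟩ := hbT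
  obtain ⟨E, hE, hEz⟩ := exists_mem_closedSubalgebra_exp hA (A.smul_mem hL (1 / 2))
  refine ⟨a, haO.2, b, hbO.2, hab,
    (ContinuousMap.restrict Γ (.id ℂ) - algebraMap ℂ _ a) * E,
    mul_mem (sub_mem hid (A.algebraMap_mem a)) hE, fun z => ⟨?_, fun hz => ?_⟩⟩
  · have h2 := hza a haO z
    have h3 : E z ^ 2 = (z - b) / (z - a) := by
      rw [hEz, ← (hLz z).1, ← Complex.exp_nat_mul]
      congr 1
      simp
    simp only [ContinuousMap.mul_apply, ContinuousMap.sub_apply, ContinuousMap.restrict_apply,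
      ContinuousMap.id_apply, algebraMap_continuousMap_apply, mul_pow, h3]
    field_simp
  · have h1 := hre a haO z hz
    have h2 := hre b hbO z hz
    have h10 : ((z : ℂ) - a) / (z - p) ≠ 0 := fun h => by simp [h] at h1
    have e : ((ContinuousMap.restrict Γ (.id ℂ) - algebraMap ℂ _ a) * E) z / (z - p) =
        Complex.exp (1 / 2 * (Complex.log ((z - a) / (z - p)) +
          Complex.log ((z - b) / (z - p)))) := by
      have : (1 / 2 * (Complex.log ((z - a) / (z - p)) + Complex.log ((z - b) / (z - p))) : ℂ) =
        Complex.log ((z - a) / (z - p)) + 1 / 2 * L z := by rw [(hLz z).2 hz]; ring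
      rw [this, Complex.exp_add, Complex.exp_log h10]
      simp only [ContinuousMap.mul_apply, ContinuousMap.sub_apply, ContinuousMap.restrict_apply,
        ContinuousMap.id_apply, algebraMap_continuousMap_apply, hEz,
        ContinuousMap.smul_apply, smul_eq_mul]
      ring
    have h1' := abs_lt.1 (Complex.abs_arg_lt_pi_div_two_iff.2 (Or.inl h1))
    have h2' := abs_lt.1 (Complex.abs_arg_lt_pi_div_two_iff.2 (Or.inl h2))
    rw [e, Complex.exp_re]
    refine mul_pos (Real.exp_pos _) (Real.cos_pos_of_mem_Ioo ?_)
    have : (1 / 2 * (Complex.log ((z - a) / (z - p)) + Complex.log ((z - b) / (z - p))) : ℂ).im =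
        1 / 2 * (Complex.arg ((z - a) / (z - p)) + Complex.arg ((z - b) / (z - p))) := by
      simp [Complex.log_im]
    rw [this]
    constructor <;> linarith

end Kernel

section KernelEstimate

open Set Metric

theorem le_sqrt_mul_rpow_of_near_far {X R t : ℝ} (hR : 0 < R) (ht : 0 < t)
    (hnear : t < 10 * R → X ≤ 1664 / R + 1 / t) (hfar : 10 * R ≤ t → X ≤ 26 * R / t ^ 2) :
    X ≤ 200000 * √R * t ^ (-(3 / 2) : ℝ) := by
  obtain ⟨a, ha, rfl⟩ : ∃ a, 0 < a ∧ R = a ^ 2 :=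
    ⟨√R, Real.sqrt_pos.2 hR, (Real.sq_sqrt hR.le).symm⟩
  obtain ⟨b, hb, rfl⟩ : ∃ b, 0 < b ∧ t = b ^ 2 :=
    ⟨√t, Real.sqrt_pos.2 ht, (Real.sq_sqrt ht.le).symm⟩
  have e : (b ^ 2) ^ (-(3 / 2) : ℝ) = 1 / b ^ 3 := by
    rw [← Real.rpow_natCast, ← Real.rpow_mul hb.le, one_div, ← Real.rpow_natCast,
      ← Real.rpow_neg hb.le]
    norm_num
  rw [e, Real.sqrt_sq ha.le]
  rcases lt_or_ge (b ^ 2) (10 * a ^ 2) with h | h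
  · refine (hnear h).trans ?_
    have hba : b < 4 * a := by nlinarith
    have : 1664 / a ^ 2 + 1 / b ^ 2 = (1664 * b ^ 3 + a ^ 2 * b) / a ^ 2 * (1 / b ^ 3) := by
      field_simp
    rw [this]
    refine mul_le_mul_of_nonneg_right ?_ (by positivity)
    rw [div_le_iff₀ (by positivity)]
    have h3 : b ^ 3 ≤ (4 * a) ^ 3 := by gcongr
    nlinarith [mul_pos (pow_pos ha 2) ha, mul_lt_mul_of_pos_left hba (pow_pos ha 2)]
  · refine (hfar h).trans ?_
    have hba : a ≤ b := by nlinarith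
    have : 26 * a ^ 2 / (b ^ 2) ^ 2 = 26 * a ^ 2 / b * (1 / b ^ 3) := by field_simp
    rw [this]
    refine mul_le_mul_of_nonneg_right ?_ (by positivity)
    rw [div_le_iff₀ hb]
    nlinarith [mul_le_mul_of_nonneg_left hba ha.le]

/-- Pointwise estimates for the kernel `8 (a - b)⁻² (z - (a + b) / 2 - s)` where `s` is a value of
`√((z - a)(z - b))`, in terms of `d = z - (a + b) / 2`. -/
theorem norm_kernel_sub_inv_le {d s z ζ p δ : ℂ} {R : ℝ} (hR : 0 < R)
    (hs : s ^ 2 = d ^ 2 - δ ^ 2 / 4)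
    (hδ : δ ≠ 0) (hδR : ‖δ‖ ≤ 2 * R) (hdp : ‖d - (z - p)‖ ≤ R) (hζ : ‖ζ - p‖ ≤ 3 * R)
    (hsum : ‖z - p‖ / 2 ≤ ‖d + s‖) (hfar : 10 * R ≤ ‖z - ζ‖) :
    ‖8 / δ ^ 2 * (d - s) - (z - ζ)⁻¹‖ ≤ 26 * R / ‖z - ζ‖ ^ 2 := by
  have hzp : 7 / 10 * ‖z - ζ‖ ≤ ‖z - p‖ := by
    have := norm_sub_le (z - p) (ζ - p)
    rw [sub_sub_sub_cancel_right] at this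
    linarith
  have ht : 0 < ‖z - ζ‖ := by linarith
  have hds : 35 / 100 * ‖z - ζ‖ ≤ ‖d + s‖ := by linarith
  have hds0 : d + s ≠ 0 := norm_pos_iff.1 (by linarith)
  have hzζ : z - ζ ≠ 0 := norm_pos_iff.1 ht
  have hprod : (d - s) * (d + s) = δ ^ 2 / 4 := by linear_combination -hs
  have hdms : ‖d - s‖ ≤ R := by
    have h1 : ‖d - s‖ * ‖d + s‖ ≤ R ^ 2 := by
      rw [← norm_mul, hprod, norm_div, norm_pow]
      norm_num
      nlinarith [norm_nonneg δ]
    by_contra! h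
    nlinarith
  have e : 8 / δ ^ 2 * (d - s) - (z - ζ)⁻¹ =
      ((d - s) - 2 * (d - (z - p)) + 2 * (p - ζ)) / ((z - ζ) * (d + s)) := by
    have : d - s = δ ^ 2 / 4 / (d + s) := eq_div_of_mul_eq hds0 hprod
    have h8 : 8 / δ ^ 2 * (d - s) = 2 / (d + s) := by
      rw [this]; field_simp; norm_num
    rw [h8]
    field_simp
    ring
  rw [e, norm_div, norm_mul, div_le_div_iff₀ (by positivity) (by positivity)]
  have hnum : ‖(d - s) - 2 * (d - (z - p)) + 2 * (p - ζ)‖ ≤ 9 * R := by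
    have h1 := norm_add_le ((d - s) - 2 * (d - (z - p))) (2 * (p - ζ))
    have h2 := norm_sub_le (d - s) (2 * (d - (z - p)))
    rw [norm_mul, Complex.norm_ofNat] at h1 h2
    rw [norm_sub_rev p ζ] at h1
    linarith
  calc _ ≤ 9 * R * ‖z - ζ‖ ^ 2 := by gcongr
    _ ≤ 26 * R * (‖z - ζ‖ * (35 / 100 * ‖z - ζ‖)) := by nlinarith [mul_pos hR (pow_pos ht 2)]
    _ ≤ _ := by gcongr

theorem norm_kernel_le {d s z p δ u v : ℂ} {R M : ℝ} (hR : 0 < R) (hM : ‖z - p‖ ≤ M)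
    (hRM : R ≤ M) (hu : ‖u - p‖ ≤ R) (hv : ‖v - p‖ ≤ R)
    (hs : s ^ 2 = (z - u) * (z - v)) (hdp : ‖d - (z - p)‖ ≤ R) (hδR : R / 2 ≤ ‖δ‖) :
    ‖8 / δ ^ 2 * (d - s)‖ ≤ 128 * M / R ^ 2 := by
  have h1 : ‖z - u‖ ≤ 2 * M := by
    have := norm_sub_le (z - p) (u - p)
    rw [sub_sub_sub_cancel_right] at this
    linarith
  have h2 : ‖z - v‖ ≤ 2 * M := by
    have := norm_sub_le (z - p) (v - p)
    rw [sub_sub_sub_cancel_right] at this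
    linarith
  have h3 : ‖s‖ ≤ 2 * M := by
    refine abs_le_of_sq_le_sq' ?_ (by linarith) |>.2
    have hM0 : 0 ≤ 2 * M := by linarith
    rw [← norm_pow, hs, norm_mul, sq]
    gcongr
  have h4 : ‖d‖ ≤ 2 * M := by
    have := norm_add_le (d - (z - p)) (z - p)
    rw [sub_add_cancel] at this
    linarith
  have h5 : ‖d - s‖ ≤ 4 * M := by linarith [norm_sub_le d s]
  rw [norm_mul, norm_div, norm_pow, Complex.norm_ofNat]
  calc 8 / ‖δ‖ ^ 2 * ‖d - s‖ ≤ 8 / (R / 2) ^ 2 * (4 * M) := by gcongr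
    _ = _ := by field_simp; ring

variable {Γ : Set ℂ} [CompactSpace Γ]

theorem exists_kernel_near {A : Subalgebra ℂ C(Γ, ℂ)} (hA : IsClosed (A : Set C(Γ, ℂ)))
    (hid : ContinuousMap.restrict Γ (.id ℂ) ∈ A) {D : Set ℂ} (hD : IsOpen D)
    (hDc : IsPreconnected D) (hDΓ : Disjoint D Γ) (hres : ∀ a ∈ D, HasResolventIn A a)
    {p : ℂ} (hpΓ : p ∈ Γ) (hp : p ∈ closure D) {R : ℝ} (hR : 0 < R) {d : ℂ} (hd : d ∈ D)
    (hdp : R ≤ ‖d - p‖) :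
    ∃ g ∈ A, ∀ (z : Γ) (ζ : ℂ), ‖ζ - p‖ ≤ 3 * R → (z : ℂ) ≠ ζ →
      ‖g z - (z - ζ)⁻¹‖ ≤ 200000 * √R * ‖z - ζ‖ ^ (-(3 / 2) : ℝ) := by
  obtain ⟨a, ha, b, hb, hab, s, hsA, hs⟩ :=
    exists_sqrt_branch hA hid hD hDc hDΓ hres hpΓ hp hR hd hdp
  have ha' : ‖a - p‖ < R := by simpa [dist_eq_norm] using ha
  have hb' : ‖b - p‖ < R := by simpa [dist_eq_norm] using hb
  have hδ : b - a ≠ 0 := norm_pos_iff.1 (by linarith)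
  refine ⟨(8 / (b - a) ^ 2) • (ContinuousMap.restrict Γ (.id ℂ) -
    algebraMap ℂ _ ((a + b) / 2) - s),
    A.smul_mem (sub_mem (sub_mem hid (A.algebraMap_mem _)) hsA) _,
    fun z ζ hζ hzζ => ?_⟩
  have hdp' : ‖((z : ℂ) - (a + b) / 2) - (z - p)‖ ≤ R := by
    have : ((z : ℂ) - (a + b) / 2) - (z - p) = -((a - p) + (b - p)) / 2 := by ring
    rw [this, norm_div, norm_neg, Complex.norm_ofNat]
    linarith [norm_add_le (a - p) (b - p)]
  have ht : 0 < ‖(z : ℂ) - ζ‖ := norm_pos_iff.2 (sub_ne_zero.2 hzζ)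
  simp only [ContinuousMap.smul_apply, ContinuousMap.sub_apply, ContinuousMap.restrict_apply,
    ContinuousMap.id_apply, algebraMap_continuousMap_apply, smul_eq_mul]
  refine le_sqrt_mul_rpow_of_near_far hR ht (fun hnear => ?_) fun hfar => ?_
  · have hM : ‖(z : ℂ) - p‖ ≤ 13 * R := by
      have := norm_add_le ((z : ℂ) - ζ) (ζ - p)
      rw [sub_add_sub_cancel] at this
      linarith
    have hk := norm_kernel_le hR hM (by linarith) ha'.le hb'.le (hs z).1 hdp' (δ := b - a) ?_
    · refine (norm_sub_le _ _).trans (add_le_add (hk.trans_eq ?_) ?_)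
      · field_simp; norm_num
      · rw [norm_inv, one_div]
    · exact hab
  · refine norm_kernel_sub_inv_le hR ?_ hδ ?_ hdp' hζ ?_ hfar
    · rw [(hs z).1]; ring
    · have := norm_sub_le (b - p) (a - p)
      rw [sub_sub_sub_cancel_right] at this
      linarith
    · have h7 : 7 * R ≤ ‖(z : ℂ) - p‖ := by
        have := norm_sub_le ((z : ℂ) - p) (ζ - p)
        rw [sub_sub_sub_cancel_right] at this
        linarith
      have hc : (a + b) / 2 ∈ ball p R := by
        rw [mem_ball, dist_eq_norm]
        have : (a + b) / 2 - p = ((a - p) + (b - p)) / 2 := by ring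
        rw [this, norm_div, Complex.norm_ofNat]
        linarith [norm_add_le (a - p) (b - p)]
      have hzp : 0 < ‖(z : ℂ) - p‖ := by linarith
      have h1 := one_sub_lt_re_div_of_mem_ball hc (t := 2) (z := z) (by norm_num) (by linarith)
      have h2 := (hs z).2 (by linarith)
      have h3 := Complex.re_le_norm (((z : ℂ) - (a + b) / 2 + s z) / (z - p))
      rw [add_div, Complex.add_re, ← add_div, norm_div, le_div_iff₀ hzp] at h3
      nlinarith

end KernelEstimate

section CauchyTransform

open Set Metric MeasureTheory Real

theorem Complex.integral_eq_integral_circleAverage {f : ℂ → ℂ} (hf : Integrable f)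
    (hfm : Measurable f) :
    ∫ ζ, f ζ = ∫ ρ in Ioi (0 : ℝ), (2 * π * ρ) • circleAverage f 0 ρ := by
  have hint : IntegrableOn (fun p : ℝ × ℝ => p.1 • f (Complex.polarCoord.symm p))
      polarCoord.target := by
    refine ⟨Measurable.aestronglyMeasurable ?_, ?_⟩
    · simp only [Complex.polarCoord_symm_apply]
      fun_prop
    · refine lt_of_eq_of_lt ?_ hf.2
      rw [← Complex.lintegral_comp_polarCoord_symm]
      refine setLIntegral_congr_fun polarCoord.open_target.measurableSet fun p hp => ?_
      have hp0 : 0 < p.1 := hp.1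
      simp only [enorm_smul, smul_eq_mul, Real.enorm_of_nonneg hp0.le]
  rw [← Complex.integral_comp_polarCoord_symm, polarCoord_target]
  rw [polarCoord_target] at hint
  rw [Measure.volume_eq_prod, setIntegral_prod _ hint]
  refine setIntegral_congr_fun measurableSet_Ioi fun ρ hρ => ?_
  have hper : Function.Periodic (fun θ => f (circleMap 0 ρ θ)) (2 * π) := fun θ => by
    simp only [periodic_circleMap 0 ρ θ]
  have h := hper.intervalIntegral_add_eq (-π) 0
  rw [show -π + 2 * π = π by ring, zero_add] at h
  simp only [circleAverage_def, ← h, integral_smul]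
  rw [intervalIntegral.integral_of_le (by linarith [pi_pos]), integral_Ioc_eq_integral_Ioo,
    smul_smul]
  have e : 2 * π * ρ * (2 * π)⁻¹ = ρ := by field_simp
  rw [e]
  congr 2
  ext θ
  simp [circleMap, Complex.exp_mul_I]

theorem circleAverage_inv_sub_of_lt {z : ℂ} {ρ : ℝ} (hρ : 0 ≤ ρ) (h : ρ < ‖z‖) :
    circleAverage (fun ζ => (z - ζ)⁻¹) 0 ρ = z⁻¹ := by
  rw [circleAverage_of_differentiable_on_off_countable countable_empty, sub_zero]
  · refine ContinuousOn.inv₀ (by fun_prop) fun ζ hζ => sub_ne_zero.2 ?_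
    rintro rfl
    rw [mem_closedBall_zero_iff, abs_of_nonneg hρ] at hζ
    linarith
  · intro ζ hζ
    refine DifferentiableAt.inv (by fun_prop) (sub_ne_zero.2 ?_)
    rintro rfl
    have := hζ.1
    rw [mem_ball_zero_iff, abs_of_nonneg hρ] at this
    linarith

theorem circleAverage_inv_sub_of_gt {z : ℂ} (hz : z ≠ 0) {ρ : ℝ} (h : ‖z‖ < ρ) :
    circleAverage (fun ζ => (z - ζ)⁻¹) 0 ρ = 0 := by
  have hρ : 0 < ρ := (norm_nonneg z).trans_lt h
  have hne : ∀ ζ ∈ sphere (0 : ℂ) |ρ|, ζ - z ≠ 0 := fun ζ hζ => sub_ne_zero.2 fun e => by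
    rw [e, mem_sphere_zero_iff_norm, abs_of_pos hρ] at hζ
    linarith
  have h1 : circleAverage (fun ζ => ((ζ - 0) / (ζ - z)) • (1 : ℂ)) 0 ρ = 1 :=
    DiffContOnCl.circleAverage_smul_div (f := fun _ => (1 : ℂ)) diffContOnCl_const
      (by simpa [abs_of_pos hρ] using h)
  have hc : CircleIntegrable (fun ζ => ((ζ - 0) / (ζ - z)) • (1 : ℂ)) 0 ρ := by
    refine ContinuousOn.circleIntegrable' ?_
    exact ContinuousOn.smul (ContinuousOn.div (by fun_prop) (by fun_prop) hne) (by fun_prop)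
  have e : circleAverage (fun ζ => (z - ζ)⁻¹) 0 ρ =
      circleAverage (z⁻¹ • ((fun _ => (1 : ℂ)) - fun ζ => ((ζ - 0) / (ζ - z)) • (1 : ℂ))) 0 ρ := by
    refine circleAverage_congr_sphere fun ζ hζ => ?_
    have h1 := hne ζ hζ
    have h2 : z - ζ ≠ 0 := by rw [← neg_sub]; exact neg_ne_zero.2 h1
    simp only [Pi.smul_apply, Pi.sub_apply, smul_eq_mul]
    field_simp
    ring
  rw [e, circleAverage_smul, circleAverage_sub (circleIntegrable_const _ _ _) hc, h1,
    circleAverage_const, sub_self, smul_zero]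

theorem integrableOn_ball_norm_rpow (R : ℝ) :
    IntegrableOn (fun u : ℂ => ‖u‖ ^ (-(3 / 2) : ℝ)) (ball 0 R) := by
  refine integrableOn_ball_of_norm_le_rpow (C := 1) (α := 3 / 2) (by simp) (by simp; norm_num)
    (Filter.Eventually.of_forall fun u => ?_) (measurable_norm.pow_const _).aestronglyMeasurable
  rw [one_mul, Real.norm_of_nonneg (by positivity)]

theorem integrableOn_ball_norm_sub_rpow {z : ℂ} {M : ℝ} (hz : ‖z‖ < M) :
    IntegrableOn (fun ζ : ℂ => ‖z - ζ‖ ^ (-(3 / 2) : ℝ)) (ball 0 M) ∧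
      ∫ ζ in ball (0 : ℂ) M, ‖z - ζ‖ ^ (-(3 / 2) : ℝ) ≤
        ∫ u in ball (0 : ℂ) (2 * M), ‖u‖ ^ (-(3 / 2) : ℝ) := by
  have hsub : ball (0 : ℂ) M ⊆ (fun ζ => z - ζ) ⁻¹' ball 0 (2 * M) := fun ζ hζ => by
    rw [mem_preimage, mem_ball_zero_iff]
    rw [mem_ball_zero_iff] at hζ
    linarith [norm_sub_le z ζ]
  have hmp := Measure.measurePreserving_sub_left (volume : Measure ℂ) z
  have hemb : MeasurableEmbedding fun ζ : ℂ => z - ζ :=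
    (MeasurableEquiv.subLeft z).measurableEmbedding
  have hint := (hmp.integrableOn_comp_preimage hemb).2 (integrableOn_ball_norm_rpow (2 * M))
  refine ⟨hint.mono_set hsub, ?_⟩
  rw [← hmp.setIntegral_preimage_emb hemb (fun u => ‖u‖ ^ (-(3 / 2) : ℝ))]
  exact setIntegral_mono_set hint
    (Filter.Eventually.of_forall fun ζ => Real.rpow_nonneg (norm_nonneg _) _)
    hsub.eventuallyLE

theorem integrableOn_ball_inv_sub (z : ℂ) (M : ℝ) :
    IntegrableOn (fun ζ : ℂ => (z - ζ)⁻¹) (ball 0 M) := by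
  have hsub : ball (0 : ℂ) M ⊆ (fun ζ => z - ζ) ⁻¹' ball 0 (‖z‖ + M) := fun ζ hζ => by
    rw [mem_preimage, mem_ball_zero_iff]
    rw [mem_ball_zero_iff] at hζ
    linarith [norm_sub_le z ζ]
  have hmp := Measure.measurePreserving_sub_left (volume : Measure ℂ) z
  have hemb : MeasurableEmbedding fun ζ : ℂ => z - ζ :=
    (MeasurableEquiv.subLeft z).measurableEmbedding
  refine IntegrableOn.mono_set ((hmp.integrableOn_comp_preimage hemb (f := fun u => u⁻¹)).2 ?_) hsub
  refine integrableOn_ball_of_norm_le_rpow (C := 1) (α := 1) (by simp) (by simp)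
    (Filter.Eventually.of_forall fun u => ?_) (by fun_prop)
  rw [one_mul, norm_inv, Real.rpow_neg_one]

/-- The Cauchy transform of a disk centred at the origin. -/
theorem setIntegral_ball_inv_sub {z : ℂ} (hz : z ≠ 0) {M : ℝ} (hM : ‖z‖ < M) :
    ∫ ζ in ball (0 : ℂ) M, (z - ζ)⁻¹ = π * (starRingEnd ℂ) z := by
  have hz0 : 0 < ‖z‖ := norm_pos_iff.2 hz
  rw [← integral_indicator measurableSet_ball,
    Complex.integral_eq_integral_circleAverage
      ((integrable_indicator_iff measurableSet_ball).2 (integrableOn_ball_inv_sub z M))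
      (Measurable.indicator (by fun_prop) measurableSet_ball)]
  have hsplit : ∀ᵐ ρ : ℝ, ρ ∈ Ioi (0 : ℝ) → (2 * π * ρ) •
      circleAverage ((ball (0 : ℂ) M).indicator fun ζ => (z - ζ)⁻¹) 0 ρ =
      (Ioc 0 ‖z‖).indicator (fun ρ : ℝ => ((ρ : ℝ) : ℂ) * (2 * π * z⁻¹)) ρ := by
    filter_upwards [Measure.ae_ne volume ‖z‖, Measure.ae_ne volume M] with ρ hρz hρM hρ
    have hρ0 : 0 < ρ := hρ
    rcases lt_or_gt_of_ne hρM with h | h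
    · have : circleAverage ((ball (0 : ℂ) M).indicator fun ζ => (z - ζ)⁻¹) 0 ρ =
          circleAverage (fun ζ => (z - ζ)⁻¹) 0 ρ := by
        refine circleAverage_congr_sphere fun ζ hζ => indicator_of_mem ?_ _
        rw [mem_sphere_zero_iff_norm, abs_of_pos hρ0] at hζ
        rwa [mem_ball_zero_iff, hζ]
      rw [this]
      rcases lt_or_gt_of_ne hρz with h' | h'
      · rw [circleAverage_inv_sub_of_lt hρ0.le h',
          indicator_of_mem (show ρ ∈ Ioc 0 ‖z‖ from ⟨hρ0, h'.le⟩),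
          Complex.real_smul]
        push_cast
        ring
      · rw [circleAverage_inv_sub_of_gt hz h', indicator_of_notMem (fun h => h'.not_ge h.2),
          smul_zero]
    · have : circleAverage ((ball (0 : ℂ) M).indicator fun ζ => (z - ζ)⁻¹) 0 ρ =
          circleAverage (fun _ => (0 : ℂ)) 0 ρ := by
        refine circleAverage_congr_sphere fun ζ hζ => indicator_of_notMem ?_ _
        rw [mem_sphere_zero_iff_norm, abs_of_pos hρ0] at hζ
        rw [mem_ball_zero_iff, hζ]
        exact h.not_gt
      rw [this, circleAverage_const, smul_zero,
        indicator_of_notMem fun h' => (hM.trans h).not_ge h'.2]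
  rw [setIntegral_congr_ae measurableSet_Ioi hsplit, setIntegral_indicator measurableSet_Ioc,
    inter_eq_self_of_subset_right fun _ h => h.1, ← intervalIntegral.integral_of_le hz0.le,
    intervalIntegral.integral_mul_const, intervalIntegral.integral_ofReal, integral_id]
  have h := Complex.mul_conj' z
  push_cast
  field_simp
  rw [h]
  ring

end CauchyTransform

section ConjApproximation

open Set Metric MeasureTheory Real

theorem exists_simpleFunc_norm_sub_le (M : ℝ) {r : ℝ} (hr : 0 < r) :
    ∃ φ : SimpleFunc ℂ ℂ, ∀ ζ ∈ ball (0 : ℂ) M, ‖ζ - φ ζ‖ ≤ r := by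
  obtain ⟨t, ht⟩ := (isCompact_closedBall (0 : ℂ) M).elim_finite_subcover
    (fun k : ℕ => ball (TopologicalSpace.denseSeq ℂ k) r) (fun _ => isOpen_ball) fun ζ _ => by
      obtain ⟨k, hk⟩ := (TopologicalSpace.denseRange_denseSeq ℂ).exists_dist_lt ζ hr
      exact mem_iUnion.2 ⟨k, hk⟩
  refine ⟨SimpleFunc.nearestPt (TopologicalSpace.denseSeq ℂ) (t.sup id), fun ζ hζ => ?_⟩
  obtain ⟨k, hkt, hk⟩ := mem_iUnion₂.1 (ht (ball_subset_closedBall hζ))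
  have h := SimpleFunc.edist_nearestPt_le (TopologicalSpace.denseSeq ℂ) ζ
    (Finset.le_sup (f := id) hkt)
  rw [edist_dist, edist_dist, ENNReal.ofReal_le_ofReal_iff dist_nonneg] at h
  rw [mem_ball, dist_comm] at hk
  rw [← dist_eq_norm, dist_comm]
  exact h.trans hk.le

variable {Γ : Set ℂ} [CompactSpace Γ]

theorem exists_mem_apply_eq_setIntegral (A : Subalgebra ℂ C(Γ, ℂ)) {G : ℂ → C(Γ, ℂ)}
    (hG : ∀ c, G c ∈ A) (φ : SimpleFunc ℂ ℂ) {U : Set ℂ} (hU : volume U ≠ ⊤) :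
    ∃ F ∈ A, ∀ z, IntegrableOn (fun ζ => G (φ ζ) z) U ∧ F z = ∫ ζ in U, G (φ ζ) z := by
  have : IsFiniteMeasure (volume.restrict U) := ⟨by simpa using hU.lt_top⟩
  refine ⟨∑ c ∈ φ.range, ((volume.restrict U).real (φ ⁻¹' {c}) : ℂ) • G c,
    sum_mem fun c _ => A.smul_mem (hG c) _, fun z => ?_⟩
  have e : (fun ζ => G (φ ζ) z) =
      fun ζ => ∑ c ∈ φ.range, (φ ⁻¹' {c}).indicator (fun _ => G c z) ζ := by
    ext ζ
    rw [Finset.sum_eq_single (φ ζ)]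
    · simp
    · intro c _ hc
      have : ζ ∉ φ ⁻¹' {c} := fun h => hc (Eq.symm h)
      simp [this]
    · exact fun h => (h (φ.mem_range_self ζ)).elim
  have hint : ∀ c ∈ φ.range, Integrable ((φ ⁻¹' {c}).indicator fun _ => G c z)
      (volume.restrict U) := fun c _ => (integrable_const _).indicator (φ.measurableSet_fiber c)
  rw [e]
  refine ⟨integrable_finsetSum _ hint, ?_⟩
  rw [integral_finsetSum _ hint]
  simp [ContinuousMap.sum_apply, integral_indicator_const, φ.measurableSet_fiber]

theorem exists_kernel_s19 {A : Subalgebra ℂ C(Γ, ℂ)} (hA : IsClosed (A : Set C(Γ, ℂ)))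
    (hid : ContinuousMap.restrict Γ (.id ℂ) ∈ A) {D : Set ℂ} (hD : IsOpen D)
    (hDc : IsPreconnected D) (hDΓ : Disjoint D Γ) (hΓD : Γ ⊆ closure D)
    (hres : ∀ p ∉ Γ, HasResolventIn A p) {r : ℝ} (hr : 0 < r) (hrD : ball 0 r ⊆ D) (c : ℂ) :
    ∃ g ∈ A, ∀ (z : Γ) (ζ : ℂ), ‖ζ - c‖ ≤ r → (z : ℂ) ≠ ζ →
      ‖g z - (z - ζ)⁻¹‖ ≤ 200000 * √r * ‖z - ζ‖ ^ (-(3 / 2) : ℝ) := by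
  by_cases hc : ∃ p ∈ Γ, ‖p - c‖ < 2 * r
  · obtain ⟨p, hp, hpc⟩ := hc
    obtain ⟨g, hg, h⟩ := exists_kernel_near hA hid hD hDc hDΓ
      (fun a ha => hres a (disjoint_left.1 hDΓ ha)) hp (hΓD hp) hr (d := 0)
      (hrD (mem_ball_self hr)) (by
        by_contra! h
        exact disjoint_left.1 hDΓ (hrD (by simpa using h)) hp)
    refine ⟨g, hg, fun z ζ hζ => h z ζ ?_⟩
    have := norm_sub_le (ζ - c) (p - c)
    rw [sub_sub_sub_cancel_right] at this
    linarith
  · push Not at hc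
    have hcΓ : c ∉ Γ := fun h => by
      have := hc c h
      rw [sub_self, norm_zero] at this
      linarith
    obtain ⟨g, hg, h⟩ := hres c hcΓ
    refine ⟨g, hg, fun z ζ hζ hzζ => ?_⟩
    have hzc := sub_ne_zero_of_notMem hcΓ z
    have h2 := hc z z.2
    have h3 := norm_sub_le ((z : ℂ) - ζ) (c - ζ)
    have h4 := norm_sub_le ((z : ℂ) - c) (ζ - c)
    rw [sub_sub_sub_cancel_right] at h3 h4
    rw [norm_sub_rev c ζ] at h3
    have hzζ' : (z : ℂ) - ζ ≠ 0 := sub_ne_zero.2 hzζ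
    have ht : r ≤ ‖(z : ℂ) - ζ‖ := by linarith
    have ht0 : 0 < ‖(z : ℂ) - ζ‖ := by linarith
    have htc : ‖(z : ℂ) - ζ‖ ≤ 2 * ‖(z : ℂ) - c‖ := by linarith
    have key : ‖g z - (z - ζ)⁻¹‖ ≤ 2 * r / ‖(z : ℂ) - ζ‖ ^ 2 := by
      rw [eq_inv_of_mul_eq_one_left (h z)]
      have : ((z : ℂ) - c)⁻¹ - (z - ζ)⁻¹ = -(ζ - c) / ((z - c) * (z - ζ)) := by
        field_simp
        ring
      rw [this, norm_div, norm_neg, norm_mul, div_le_div_iff₀ (by positivity) (by positivity)]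
      nlinarith [mul_le_mul hζ (mul_le_mul_of_nonneg_right htc ht0.le) (by positivity) hr.le]
    refine le_sqrt_mul_rpow_of_near_far hr ht0 (fun _ => key.trans ?_) fun _ => key.trans ?_
    · have : 2 * r / ‖(z : ℂ) - ζ‖ ^ 2 ≤ 1664 / r := by
        rw [div_le_div_iff₀ (by positivity) hr]
        nlinarith
      have : 0 < 1 / ‖(z : ℂ) - ζ‖ := by positivity
      linarith
    · gcongr
      norm_num

theorem conj_mem_of_hasResolventIn {A : Subalgebra ℂ C(Γ, ℂ)} (hA : IsClosed (A : Set C(Γ, ℂ)))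
    (hid : ContinuousMap.restrict Γ (.id ℂ) ∈ A) {D : Set ℂ} (hD : IsOpen D)
    (hDc : IsPreconnected D) (hDΓ : Disjoint D Γ) (hΓD : Γ ⊆ closure D) (h0 : 0 ∈ D)
    (hres : ∀ p ∉ Γ, HasResolventIn A p) : star (ContinuousMap.restrict Γ (.id ℂ)) ∈ A := by
  obtain ⟨ρ, hρ, hρD⟩ := Metric.isOpen_iff.1 hD 0 h0
  set M : ℝ := ‖ContinuousMap.restrict Γ (.id ℂ)‖ + 1 with hM
  set J : ℝ := ∫ u in ball (0 : ℂ) (2 * M), ‖u‖ ^ (-(3 / 2) : ℝ) with hJ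
  have hJ0 : 0 ≤ J := integral_nonneg fun u => Real.rpow_nonneg (norm_nonneg _) _
  have hzM : ∀ z : Γ, ‖(z : ℂ)‖ < M := fun z =>
    ((ContinuousMap.restrict Γ (.id ℂ)).norm_coe_le_norm z).trans_lt (lt_add_one _)
  have hπ : (π : ℂ) ≠ 0 := by exact_mod_cast pi_ne_zero
  refine hA.closure_subset (Metric.mem_closure_iff.2 fun ε hε => ?_)
  obtain ⟨s, hs0, hsρ, hsε⟩ : ∃ s : ℝ, 0 < s ∧ s ^ 2 ≤ ρ ∧ 200000 * s * J < ε * π := by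
    refine ⟨min √ρ (ε * π / (200000 * (J + 1))),
      lt_min (Real.sqrt_pos.2 hρ) (by positivity), ?_, ?_⟩
    · exact (Real.le_sqrt' (lt_min (Real.sqrt_pos.2 hρ) (by positivity))).1 (min_le_left _ _)
    · calc 200000 * min √ρ (ε * π / (200000 * (J + 1))) * J
          ≤ 200000 * (ε * π / (200000 * (J + 1))) * J := by gcongr; exact min_le_right _ _
        _ = ε * π * (J / (J + 1)) := by field_simp
        _ < ε * π * 1 := by
          gcongr
          rw [div_lt_one (by positivity)]
          exact lt_add_one J
        _ = _ := mul_one _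
  choose G hGA hG using exists_kernel_s19 hA hid hD hDc hDΓ hΓD hres (pow_pos hs0 2)
    ((ball_subset_ball hsρ).trans hρD)
  rw [Real.sqrt_sq hs0.le] at hG
  obtain ⟨φ, hφ⟩ := exists_simpleFunc_norm_sub_le M (pow_pos hs0 2)
  obtain ⟨F, hFA, hF⟩ := exists_mem_apply_eq_setIntegral A hGA φ
    (U := ball 0 M) measure_ball_lt_top.ne
  refine ⟨(π : ℂ)⁻¹ • F, A.smul_mem hFA _, ?_⟩
  rw [dist_comm, ContinuousMap.dist_lt_iff hε]
  intro z
  have hz0 : (z : ℂ) ≠ 0 := fun h => disjoint_left.1 hDΓ h0 (h ▸ z.2)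
  have hP := setIntegral_ball_inv_sub hz0 (hzM z)
  obtain ⟨hint, hle⟩ := integrableOn_ball_norm_sub_rpow (hzM z)
  have key : ‖F z - π * (starRingEnd ℂ) z‖ ≤ 200000 * s * J := by
    rw [(hF z).2, ← hP, ← integral_sub (hF z).1 (integrableOn_ball_inv_sub _ _)]
    refine (norm_integral_le_of_norm_le (hint.const_mul (200000 * s)) ?_).trans ?_
    · filter_upwards [ae_restrict_mem measurableSet_ball,
        ae_restrict_of_ae (Measure.ae_ne volume (z : ℂ))] with ζ hζ hζz
      exact hG _ z ζ (hφ ζ hζ) hζz.symm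
    · rw [integral_const_mul]
      gcongr
  have e : ((π : ℂ)⁻¹ • F) z - star (ContinuousMap.restrict Γ (.id ℂ)) z =
      (π : ℂ)⁻¹ * (F z - π * (starRingEnd ℂ) z) := by
    simp only [ContinuousMap.smul_apply, ContinuousMap.star_apply, ContinuousMap.restrict_apply,
      ContinuousMap.id_apply, smul_eq_mul]
    field_simp
    rfl
  rw [dist_eq_norm, e, norm_mul, norm_inv, Complex.norm_real, Real.norm_of_nonneg pi_pos.le,
    inv_mul_lt_iff₀ pi_pos]
  linarith

end ConjApproximation

section LaurentApproximation

open Set Metric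

theorem hasResolventIn_of_notMem_frontier {c : Circle → ℂ} (hc : Continuous c)
    (hci : Function.Injective c) {D : Set ℂ} (hD : IsOpen D) (hDs : IsSimplyConnected D)
    (h0 : 0 ∈ D) {Γ : Set ℂ} (hΓ : frontier D = Γ) (hΓr : Γ = range c) [CompactSpace Γ]
    {A : Subalgebra ℂ C(Γ, ℂ)} (hA : IsClosed (A : Set C(Γ, ℂ)))
    (hid : ContinuousMap.restrict Γ (.id ℂ) ∈ A) (hres0 : HasResolventIn A 0)
    {p : ℂ} (hp : p ∉ Γ) : HasResolventIn A p := by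
  set P : Set ℂ := {p | HasResolventIn A p} with hPdef
  have hΓc : IsClosed Γ := hΓ ▸ isClosed_frontier
  have hΓne : Γ.Nonempty := hΓr ▸ range_nonempty c
  have hDΓ : Disjoint D Γ := by
    rw [← hΓ, hD.frontier_eq]
    exact disjoint_sdiff_right
  obtain ⟨hPo, hPc⟩ := isOpen_hasResolventIn_and_closure hA hΓne
  have hDP : D ⊆ P := hDs.isPathConnected.isConnected.isPreconnected.subset_of_closure_inter_subset
    hPo ⟨0, h0, hres0⟩ fun x hx => hPc ⟨hx.1, disjoint_left.1 hDΓ hx.2⟩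
  obtain ⟨q, hq⟩ := hΓne
  have hDb : Bornology.IsBounded D := isBounded_of_isSimplyConnected hD hDs
    (hΓ ▸ (isCompact_iff_compactSpace.2 inferInstance : IsCompact Γ).isBounded)
    (disjoint_right.1 hDΓ hq)
  by_contra hpP
  have hVeq : Γᶜ \ P = (Γ ∪ closure P)ᶜ := by
    ext x
    simp only [mem_sdiff, mem_compl_iff, mem_union, not_or]
    exact and_congr_right fun hx => not_congr ⟨fun h => subset_closure h, fun h => hPc ⟨h, hx⟩⟩
  have hVo : IsOpen (Γᶜ \ P) := by
    rw [hVeq]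
    exact (hΓc.union isClosed_closure).isOpen_compl
  refine false_of_disjoint_isBounded_of_frontier_subset hc hci hD hVo hDb ?_ ?_
    (hΓ.trans hΓr).subset ?_ ?_ ?_
    h0 (b := p) ⟨hp, hpP⟩
  · refine (isBounded_closedBall (x := (0 : ℂ))
      (r := ‖ContinuousMap.restrict Γ (.id ℂ)‖)).subset fun x hx => ?_
    rw [mem_closedBall_zero_iff]
    by_contra! h
    exact hx.2 (hasResolventIn_of_norm_gt hA hid h)
  · exact disjoint_left.2 fun x hx hx' => hx'.2 (hDP hx)
  · rw [← hΓr]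
    intro x hx
    rw [hVo.frontier_eq] at hx
    by_contra hxΓ
    have hxP : x ∈ P := by
      by_contra h
      exact hx.2 ⟨hxΓ, h⟩
    obtain ⟨y, hy, hyV⟩ := mem_closure_iff.1 hx.1 P hPo hxP
    exact hyV.2 hy
  · rwa [← hΓr]
  · rw [← hΓr]
    exact disjoint_left.2 fun x hx hx' => hx.1 hx'

/-- Uniform approximation by Laurent polynomials on a Jordan curve around the origin. -/
theorem exists_laurent_approx {c : Circle → ℂ} (hc : Continuous c)
    (hci : Function.Injective c) {D : Set ℂ} (hD : IsOpen D) (hDs : IsSimplyConnected D)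
    (h0 : 0 ∈ D) (hDc : frontier D = range c) {h : ℂ → ℂ} (hh : ContinuousOn h (frontier D))
    {ε : ℝ} (hε : 0 < ε) :
    ∃ a : ℤ →₀ ℂ, ∀ z ∈ frontier D, ‖h z - a.sum fun n w => w * z ^ n‖ < ε := by
  have hcpt : CompactSpace (frontier D) :=
    isCompact_iff_compactSpace.1 (hDc ▸ isCompact_range hc)
  have hne : ∀ z : frontier D, (z : ℂ) ≠ 0 := fun z hz => by
    have := z.2
    rw [hz] at this
    exact (hD.frontier_eq ▸ this).2 h0
  let F : Multiplicative ℤ →* C(frontier D, ℂ) :=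
    { toFun := fun n => ⟨fun z => (z : ℂ) ^ n.toAdd,
        continuous_subtype_val.zpow₀ _ fun z => Or.inl (hne z)⟩
      map_one' := by ext z; simp
      map_mul' := fun m n => by ext z; simp [zpow_add₀ (hne z)] }
  let B : Subalgebra ℂ C(frontier D, ℂ) := (AddMonoidAlgebra.lift ℂ C(frontier D, ℂ) ℤ F).range
  have hB : ∀ n, F n ∈ B := fun n => ⟨AddMonoidAlgebra.single n.toAdd 1,
    (AddMonoidAlgebra.lift_single F n.toAdd 1).trans (one_smul _ _)⟩
  have hA : IsClosed (B.topologicalClosure : Set C(frontier D, ℂ)) := B.isClosed_topologicalClosure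
  have hid : ContinuousMap.restrict (frontier D) (.id ℂ) ∈ B.topologicalClosure := by
    refine B.le_topologicalClosure ?_
    convert hB (Multiplicative.ofAdd 1)
    ext z
    simp [F]
  have hres0 : HasResolventIn B.topologicalClosure 0 :=
    ⟨F (Multiplicative.ofAdd (-1)), B.le_topologicalClosure (hB _), fun z => by simp [F, hne z]⟩
  have hconj := conj_mem_of_hasResolventIn hA hid hD hDs.isPathConnected.isConnected.isPreconnected
    (by rw [hD.frontier_eq]; exact disjoint_sdiff_right) frontier_subset_closure h0
    fun p hp => hasResolventIn_of_notMem_frontier hc hci hD hDs h0 rfl hDc hA hid hres0 hp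
  have htop : B.topologicalClosure = ⊤ := by
    have h1 := ContinuousMap.elemental_id_eq_top (frontier D)
    have h2 : (StarAlgebra.adjoin ℂ {ContinuousMap.restrict (frontier D) (.id ℂ)}).toSubalgebra ≤
        B.topologicalClosure := by
      rw [StarAlgebra.adjoin_toSubalgebra, Algebra.adjoin_le_iff, star_singleton]
      rintro _ (rfl | rfl)
      exacts [hid, hconj]
    rw [eq_top_iff]
    intro g _
    have hg : g ∈ StarAlgebra.elemental ℂ (ContinuousMap.restrict (frontier D) (.id ℂ)) := by
      rw [h1]; trivial
    exact closure_minimal h2 hA hg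
  let H : C(frontier D, ℂ) := ⟨fun z => h z, continuousOn_iff_continuous_domRestrict.1 hh⟩
  have hH : H ∈ closure (B : Set C(frontier D, ℂ)) := by
    have : H ∈ B.topologicalClosure := htop ▸ Algebra.mem_top
    exact this
  obtain ⟨g, ⟨a, rfl⟩, hg⟩ := Metric.mem_closure_iff.1 hH ε hε
  refine ⟨a.coeff, fun z hz => ?_⟩
  have hLz : AddMonoidAlgebra.lift ℂ C(frontier D, ℂ) ℤ F a ⟨z, hz⟩ =
      a.coeff.sum fun n w => w * z ^ n := by
    simp [AddMonoidAlgebra.lift_apply, Finsupp.sum, ContinuousMap.sum_apply, F]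
  have := (ContinuousMap.dist_lt_iff hε).1 hg ⟨z, hz⟩
  rw [dist_eq_norm] at this
  rwa [← hLz]

end LaurentApproximation

section RealLaurent

theorem exists_real_laurent_approx {c : Circle → ℂ} (hc : Continuous c)
    (hci : Function.Injective c) {D : Set ℂ} (hD : IsOpen D) (hDs : IsSimplyConnected D)
    (h0 : 0 ∈ D) (hDc : frontier D = Set.range c) {h : ℂ → ℂ} (hh : ContinuousOn h (frontier D))
    (hconj : ∀ z ∈ frontier D, (starRingEnd ℂ) z ∈ frontier D ∧
      h ((starRingEnd ℂ) z) = (starRingEnd ℂ) (h z)) {ε : ℝ} (hε : 0 < ε) :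
    ∃ (a : ℤ → ℝ) (N : ℕ), ∀ n : ℕ, N ≤ n → ∀ z ∈ frontier D,
      ‖h z - ∑ k ∈ Finset.Icc (-(n : ℤ)) n, (a k : ℂ) * z ^ k‖ < ε := by
  obtain ⟨a, ha⟩ := exists_laurent_approx hc hci hD hDs h0 hDc hh hε
  refine ⟨fun k => (a k).re, a.support.sup Int.natAbs, fun n hn z hz => ?_⟩
  have hsum : ∀ w : ℂ, (a.sum fun k v => v * w ^ k) =
      ∑ k ∈ Finset.Icc (-(n : ℤ)) n, a k * w ^ k := fun w => by
    refine Finsupp.sum_of_support_subset _ (fun k hk => ?_) _ (by simp)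
    have : k.natAbs ≤ n := (Finset.le_sup hk).trans hn
    rw [Finset.mem_Icc]
    lia
  have h1 := ha z hz
  have h2 := ha _ (hconj z hz).1
  rw [hsum] at h1 h2
  rw [(hconj z hz).2, ← Complex.norm_conj] at h2
  simp only [map_sub, Complex.conj_conj, map_sum, map_mul, map_zpow₀] at h2
  have e : h z - ∑ k ∈ Finset.Icc (-(n : ℤ)) n, (((a k).re : ℝ) : ℂ) * z ^ k =
      ((h z - ∑ k ∈ Finset.Icc (-(n : ℤ)) n, a k * z ^ k) +
        (h z - ∑ k ∈ Finset.Icc (-(n : ℤ)) n, (starRingEnd ℂ) (a k) * z ^ k)) / 2 := by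
    have : ∀ k, (((a k).re : ℝ) : ℂ) * z ^ k =
        (a k * z ^ k + (starRingEnd ℂ) (a k) * z ^ k) / 2 := fun k => by
      rw [Complex.re_eq_add_conj]; ring
    simp only [this, ← Finset.sum_div, Finset.sum_add_distrib]
    ring
  rw [e, norm_div, Complex.norm_ofNat]
  linarith [norm_add_le (h z - ∑ k ∈ Finset.Icc (-(n : ℤ)) n, a k * z ^ k)
    (h z - ∑ k ∈ Finset.Icc (-(n : ℤ)) n, (starRingEnd ℂ) (a k) * z ^ k)]

end RealLaurent

section Slices

/-- The isometric embedding `x + i y ↦ x + y I` of the complex plane as the slice `ℂ_I`. -/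
def sliceEmbedding (I : Quaternion ℝ) (hI : I ^ 2 = -1) : ℂ →ₐ[ℝ] Quaternion ℝ :=
  Complex.liftAux I (by rw [← sq, hI])

variable {I : Quaternion ℝ}

theorem sliceEmbedding_apply (hI : I ^ 2 = -1) (z : ℂ) :
    sliceEmbedding I hI z = (z.re : Quaternion ℝ) + z.im • I :=
  Complex.liftAux_apply I _ z

theorem re_eq_zero_and_normSq_eq_one_of_sq_eq_neg_one (hI : I ^ 2 = -1) :
    I.re = 0 ∧ Quaternion.normSq I = 1 := by
  have h1 : Quaternion.normSq I = 1 := by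
    have h := congrArg Quaternion.normSq hI
    rw [map_pow, Quaternion.normSq_neg, map_one] at h
    exact (pow_eq_one_iff_of_nonneg Quaternion.normSq_nonneg two_ne_zero).1 h
  exact ⟨Quaternion.sq_eq_neg_normSq.1 (by rw [hI, h1, Quaternion.coe_one]), h1⟩

variable (hI : I ^ 2 = -1)

theorem norm_sliceEmbedding (z : ℂ) : ‖sliceEmbedding I hI z‖ = ‖z‖ := by
  obtain ⟨hre, hn⟩ := re_eq_zero_and_normSq_eq_one_of_sq_eq_neg_one hI
  rw [← sq_eq_sq₀ (norm_nonneg _) (norm_nonneg _), Complex.sq_norm, Complex.normSq_apply, sq,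
    ← Quaternion.normSq_eq_norm_mul_self, sliceEmbedding_apply, Quaternion.normSq_def']
  rw [Quaternion.normSq_def'] at hn
  simp [hre] at hn ⊢
  linear_combination z.im ^ 2 * hn

theorem isometry_sliceEmbedding : Isometry (sliceEmbedding I hI) :=
  AddMonoidHomClass.isometry_of_norm _ (norm_sliceEmbedding hI)

theorem range_sliceEmbedding : Set.range (sliceEmbedding I hI) = slicePlane I := by
  ext q
  simp only [Set.mem_range, slicePlane, sliceEmbedding_apply]
  exact ⟨fun ⟨z, hz⟩ => ⟨z.re, z.im, hz.symm⟩, fun ⟨x, y, h⟩ => ⟨⟨x, y⟩, h.symm⟩⟩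

theorem exists_quaternion_sq_eq_neg_one : ∃ I : Quaternion ℝ, I ^ 2 = -1 := by
  obtain ⟨I, h0, h1, h2, h3⟩ :
      ∃ I : Quaternion ℝ, I.re = 0 ∧ I.imI = 1 ∧ I.imJ = 0 ∧ I.imK = 0 :=
    ⟨⟨0, 1, 0, 0⟩, rfl, rfl, rfl, rfl⟩
  refine ⟨I, ?_⟩
  rw [Quaternion.sq_eq_neg_normSq.2 h0, Quaternion.normSq_def', h0, h1, h2, h3]
  simp

/-- The point `x + i |y|` for `q = x + y I`. -/
def sliceProj (q : Quaternion ℝ) : ℂ := ⟨q.re, ‖q.im‖⟩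

theorem continuous_sliceProj : Continuous sliceProj :=
  Complex.equivRealProdCLM.symm.continuous.comp
    (Quaternion.continuous_re.prodMk Quaternion.continuous_im.norm)

theorem exists_eq_sliceEmbedding_sliceProj (q : Quaternion ℝ) :
    ∃ (I : Quaternion ℝ) (hI : I ^ 2 = -1), q = sliceEmbedding I hI (sliceProj q) := by
  by_cases h : q.im = 0
  · obtain ⟨I, hI⟩ := exists_quaternion_sq_eq_neg_one
    refine ⟨I, hI, ?_⟩
    rw [sliceEmbedding_apply, sliceProj, h, norm_zero, zero_smul, add_zero]
    simpa [h] using (Quaternion.re_add_im q).symm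
  · have hn : ‖q.im‖ ≠ 0 := norm_ne_zero_iff.2 h
    refine ⟨‖q.im‖⁻¹ • q.im, ?_, ?_⟩
    · rw [smul_pow, Quaternion.im_sq, Quaternion.normSq_eq_norm_mul_self, ← Quaternion.coe_neg,
        ← Quaternion.coe_smul, smul_eq_mul]
      have : ‖q.im‖⁻¹ ^ 2 * -(‖q.im‖ * ‖q.im‖) = -1 := by field_simp
      rw [this, Quaternion.coe_neg, Quaternion.coe_one]
    · rw [sliceEmbedding_apply, sliceProj, smul_inv_smul₀ hn, Quaternion.re_add_im]

theorem sliceProj_sliceEmbedding (z : ℂ) :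
    sliceProj (sliceEmbedding I hI z) = z ∨
      sliceProj (sliceEmbedding I hI z) = (starRingEnd ℂ) z := by
  obtain ⟨hre, hn⟩ := re_eq_zero_and_normSq_eq_one_of_sq_eq_neg_one hI
  have h1 : ‖I‖ = 1 := by
    rw [Quaternion.normSq_eq_norm_mul_self, ← sq] at hn
    exact (pow_eq_one_iff_of_nonneg (norm_nonneg I) two_ne_zero).1 hn
  have h2 : (sliceEmbedding I hI z).re = z.re := by simp [sliceEmbedding_apply, hre]
  have h3 : (sliceEmbedding I hI z).im = z.im • I := by
    rw [sliceEmbedding_apply]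
    ext <;> simp [hre]
  rw [sliceProj, h2, h3, norm_smul, h1, mul_one, Real.norm_eq_abs]
  rcases abs_choice z.im with h | h
  · exact Or.inl (Complex.ext rfl h)
  · exact Or.inr (Complex.ext rfl h)

/-- An axially symmetric set is determined by its intersection with one slice. -/
theorem sliceEmbedding_mem_iff {Ω : Set (Quaternion ℝ)} (hΩ : AxiallySymmetric Ω)
    {J : Quaternion ℝ} (hJ : J ^ 2 = -1) (z : ℂ) :
    sliceEmbedding I hI z ∈ Ω ↔ sliceEmbedding J hJ z ∈ Ω := by
  rw [sliceEmbedding_apply, sliceEmbedding_apply]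
  exact ⟨hΩ _ _ I J hI hJ, hΩ _ _ J I hJ hI⟩

theorem sliceEmbedding_conj_mem_iff {Ω : Set (Quaternion ℝ)} (hΩ : AxiallySymmetric Ω) (z : ℂ) :
    sliceEmbedding I hI ((starRingEnd ℂ) z) ∈ Ω ↔ sliceEmbedding I hI z ∈ Ω := by
  have h : (-I) ^ 2 = -1 := by rw [neg_sq, hI]
  have : sliceEmbedding I hI ((starRingEnd ℂ) z) = sliceEmbedding (-I) h z := by
    simp [sliceEmbedding_apply]
  rw [this, sliceEmbedding_mem_iff h hΩ hI]

theorem conj_mem_closure_preimage {Ω : Set (Quaternion ℝ)} (hΩ : AxiallySymmetric Ω) {z : ℂ}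
    (hz : z ∈ closure (sliceEmbedding I hI ⁻¹' Ω)) :
    (starRingEnd ℂ) z ∈ closure (sliceEmbedding I hI ⁻¹' Ω) :=
  map_mem_closure Complex.continuous_conj hz fun w hw =>
    (sliceEmbedding_conj_mem_iff hI hΩ w).2 hw

theorem sliceEmbedding_mem_closure_iff {Ω : Set (Quaternion ℝ)} (hΩ : AxiallySymmetric Ω)
    {J : Quaternion ℝ} (hJ : J ^ 2 = -1) (z : ℂ) :
    sliceEmbedding I hI z ∈ closure Ω ↔ z ∈ closure (sliceEmbedding J hJ ⁻¹' Ω) := by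
  refine ⟨fun h => ?_, fun h => map_mem_closure (isometry_sliceEmbedding hI).continuous h
    fun w hw => (sliceEmbedding_mem_iff hI hΩ hJ w).2 hw⟩
  have h' : sliceProj (sliceEmbedding I hI z) ∈ closure (sliceEmbedding J hJ ⁻¹' Ω) := by
    refine map_mem_closure continuous_sliceProj h fun q hq => ?_
    obtain ⟨K, hK, hqK⟩ := exists_eq_sliceEmbedding_sliceProj q
    exact (sliceEmbedding_mem_iff hK hΩ hJ _).1 (hqK ▸ hq)
  rcases sliceProj_sliceEmbedding hI z with e | e
  · rwa [e] at h'
  · rw [e] at h'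
    simpa using conj_mem_closure_preimage hJ hΩ h'

theorem sliceEmbedding_mem_frontier_iff {Ω : Set (Quaternion ℝ)} (hΩo : IsOpen Ω)
    (hΩ : AxiallySymmetric Ω) {J : Quaternion ℝ} (hJ : J ^ 2 = -1) (z : ℂ) :
    sliceEmbedding I hI z ∈ frontier Ω ↔ z ∈ frontier (sliceEmbedding J hJ ⁻¹' Ω) := by
  rw [hΩo.frontier_eq, (hΩo.preimage (isometry_sliceEmbedding hJ).continuous).frontier_eq]
  exact and_congr (sliceEmbedding_mem_closure_iff hI hΩ hJ z)
    (not_congr (sliceEmbedding_mem_iff hI hΩ hJ z))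

theorem isSimplyConnected_preimage_sliceEmbedding {Ω : Set (Quaternion ℝ)}
    (h : SimplyConnectedSpace ↥(Ω ∩ slicePlane I)) :
    IsSimplyConnected (sliceEmbedding I hI ⁻¹' Ω) := by
  rw [← (isometry_sliceEmbedding hI).isEmbedding.isSimplyConnected_image,
    Set.image_preimage_eq_inter_range, range_sliceEmbedding]
  exact h

theorem conj_mem_frontier_preimage {Ω : Set (Quaternion ℝ)} (hΩo : IsOpen Ω)
    (hΩ : AxiallySymmetric Ω) {z : ℂ} (hz : z ∈ frontier (sliceEmbedding I hI ⁻¹' Ω)) :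
    (starRingEnd ℂ) z ∈ frontier (sliceEmbedding I hI ⁻¹' Ω) := by
  rw [(hΩo.preimage (isometry_sliceEmbedding hI).continuous).frontier_eq] at hz ⊢
  exact ⟨conj_mem_closure_preimage hI hΩ hz.1, fun h =>
    hz.2 ((sliceEmbedding_conj_mem_iff hI hΩ z).1 h)⟩

theorem exists_jordan_parametrization_preimage {Γ : Set ℂ} {S : Set (Quaternion ℝ)}
    (hΓ : ∀ z, sliceEmbedding I hI z ∈ S ↔ z ∈ Γ) {γ : Circle → Quaternion ℝ}
    (hγ : Continuous γ) (hγi : Function.Injective γ) (hγr : Set.range γ = S ∩ slicePlane I) :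
    ∃ c : Circle → ℂ, Continuous c ∧ Function.Injective c ∧ Γ = Set.range c := by
  have h : ∀ t, ∃ z, sliceEmbedding I hI z = γ t := fun t => by
    have : γ t ∈ S ∩ slicePlane I := hγr ▸ Set.mem_range_self t
    rw [← range_sliceEmbedding hI] at this
    exact this.2
  choose c hc using h
  have hcγ : sliceEmbedding I hI ∘ c = γ := funext hc
  refine ⟨c, ?_, ?_, ?_⟩
  · rwa [(isometry_sliceEmbedding hI).isEmbedding.continuous_iff, hcγ]
  · exact Function.Injective.of_comp (hcγ ▸ hγi)
  · ext z
    rw [← hΓ]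
    constructor
    · intro hz
      have : sliceEmbedding I hI z ∈ Set.range γ := by
        rw [hγr, ← range_sliceEmbedding hI]
        exact ⟨hz, z, rfl⟩
      obtain ⟨t, ht⟩ := this
      exact ⟨t, (isometry_sliceEmbedding hI).injective ((hc t).trans ht)⟩
    · rintro ⟨t, rfl⟩
      rw [hc]
      exact (hγr.subset (Set.mem_range_self t)).1

theorem add_mul_eq_sum_sliceEmbedding_mul {κ : Type*} [Fintype κ]
    (b : Module.Basis κ ℝ (Quaternion ℝ)) (u v : Quaternion ℝ) :
    u + I * v = ∑ k, sliceEmbedding I hI ⟨b.repr u k, b.repr v k⟩ * b k := by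
  simp only [sliceEmbedding_apply, add_mul, Finset.sum_add_distrib, Quaternion.coe_mul_eq_smul,
    b.sum_repr, smul_mul_assoc, ← mul_smul_comm, ← Finset.mul_sum]

theorem sum_zpow_mul_eq_sum_sliceEmbedding_mul {κ : Type*} [Fintype κ] (b : κ → Quaternion ℝ)
    (a : κ → ℤ → ℝ) (s : Finset ℤ) (z : ℂ) :
    ∑ j ∈ s, sliceEmbedding I hI z ^ j * ∑ k, a k j • b k =
      ∑ k, sliceEmbedding I hI (∑ j ∈ s, (a k j : ℂ) * z ^ j) * b k := by
  simp only [Finset.mul_sum, map_sum, Finset.sum_mul]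
  rw [Finset.sum_comm]
  refine Finset.sum_congr rfl fun k _ => Finset.sum_congr rfl fun j _ => ?_
  rw [← Complex.real_smul, map_smul, map_zpow₀, smul_mul_assoc, mul_smul_comm]

end Slices

/-- **Approximation on boundaries by polynomials in `q` and `q⁻¹`.** Let `Σ` be the
boundary of an open set `Ω ∈ 𝔯(ℍ)` containing the origin, with `Σ ∩ ℂ_I` a Jordan curve
for every unit imaginary quaternion `I`. Then every continuous slice function
`f(x + Iy) = α(x,y) + I β(x,y)` on `Σ` can be uniformly approximated on `Σ` by
polynomials in `q` and `q⁻¹`: for every `ε > 0` there are `m, n ∈ ℕ` and coefficients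
`a_k ∈ ℍ` with `sup_{q ∈ Σ} ‖f q − ∑_{k=−m}^{n} q^k a_k‖ < ε`. -/
theorem boundary_approximation_by_laurent_polynomials
    (Ω : Set (Quaternion ℝ)) (hΩ : MemFrakR Ω) (h0 : (0 : Quaternion ℝ) ∈ Ω)
    (hJordan : ∀ I : Quaternion ℝ, I ^ 2 = -1 →
      ∃ γ : Circle → Quaternion ℝ, Continuous γ ∧ Function.Injective γ ∧
        Set.range γ = frontier Ω ∩ slicePlane I)
    (f : Quaternion ℝ → Quaternion ℝ)
    (α β : ℝ → ℝ → Quaternion ℝ)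
    (hαcont : ContinuousOn (fun p : ℝ × ℝ => α p.1 p.2)
      {p : ℝ × ℝ | ∃ I : Quaternion ℝ, I ^ 2 = -1 ∧
        ((p.1 : Quaternion ℝ) + p.2 • I) ∈ frontier Ω})
    (hβcont : ContinuousOn (fun p : ℝ × ℝ => β p.1 p.2)
      {p : ℝ × ℝ | ∃ I : Quaternion ℝ, I ^ 2 = -1 ∧
        ((p.1 : Quaternion ℝ) + p.2 • I) ∈ frontier Ω})
    (hαeven : ∀ x y : ℝ,
      (∃ I : Quaternion ℝ, I ^ 2 = -1 ∧ ((x : Quaternion ℝ) + y • I) ∈ frontier Ω) →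
      α x (-y) = α x y)
    (hβodd : ∀ x y : ℝ,
      (∃ I : Quaternion ℝ, I ^ 2 = -1 ∧ ((x : Quaternion ℝ) + y • I) ∈ frontier Ω) →
      β x (-y) = -β x y)
    (hf : ∀ (I : Quaternion ℝ), I ^ 2 = -1 → ∀ x y : ℝ,
      ((x : Quaternion ℝ) + y • I) ∈ frontier Ω →
      f ((x : Quaternion ℝ) + y • I) = α x y + I * β x y)
    (ε : ℝ) (hε : 0 < ε) :
    ∃ (m n : ℕ) (a : ℤ → Quaternion ℝ), ∀ q ∈ frontier Ω,
      ‖f q - ∑ k ∈ Finset.Icc (-(m : ℤ)) (n : ℤ), q ^ k * a k‖ < ε := by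
  obtain ⟨hΩo, hΩs, hΩc⟩ := hΩ
  obtain ⟨J, hJ⟩ := exists_quaternion_sq_eq_neg_one
  set D : Set ℂ := sliceEmbedding J hJ ⁻¹' Ω with hD_def
  have hfr : ∀ (I : Quaternion ℝ) (hI : I ^ 2 = -1) (z : ℂ),
      sliceEmbedding I hI z ∈ frontier Ω ↔ z ∈ frontier D := fun I hI z =>
    sliceEmbedding_mem_frontier_iff hI hΩo hΩs hJ z
  have hDo : IsOpen D := hΩo.preimage (isometry_sliceEmbedding hJ).continuous
  have hDs : IsSimplyConnected D := isSimplyConnected_preimage_sliceEmbedding hJ (hΩc J hJ)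
  have hD0 : (0 : ℂ) ∈ D := by
    rw [hD_def, Set.mem_preimage, map_zero]
    exact h0
  obtain ⟨γ, hγ, hγi, hγr⟩ := hJordan J hJ
  obtain ⟨c, hc, hci, hcr⟩ := exists_jordan_parametrization_preimage hJ (hfr J hJ) hγ hγi hγr
  have hmem : ∀ z ∈ frontier D, ∃ I : Quaternion ℝ, I ^ 2 = -1 ∧
      ((z.re : Quaternion ℝ) + z.im • I) ∈ frontier Ω := fun z hz =>
    ⟨J, hJ, by rw [← sliceEmbedding_apply hJ]; exact (hfr J hJ z).2 hz⟩
  set b := Module.finBasis ℝ (Quaternion ℝ)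
  set h : Fin (Module.finrank ℝ (Quaternion ℝ)) → ℂ → ℂ := fun k z =>
    ⟨b.repr (α z.re z.im) k, b.repr (β z.re z.im) k⟩ with hh_def
  have hcoord : ∀ k, Continuous fun q => b.repr q k := fun k =>
    (b.coord k).continuous_of_finiteDimensional
  have hreim : Continuous fun z : ℂ => (z.re, z.im) :=
    Complex.continuous_re.prodMk Complex.continuous_im
  have hcont : ∀ k, ContinuousOn (h k) (frontier D) := fun k =>
    Complex.equivRealProdCLM.symm.continuous.comp_continuousOn
      (((hcoord k).comp_continuousOn (hαcont.comp hreim.continuousOn hmem)).prodMk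
        ((hcoord k).comp_continuousOn (hβcont.comp hreim.continuousOn hmem)))
  have hconj : ∀ k, ∀ z ∈ frontier D, (starRingEnd ℂ) z ∈ frontier D ∧
      h k ((starRingEnd ℂ) z) = (starRingEnd ℂ) (h k z) := fun k z hz => by
    refine ⟨conj_mem_frontier_preimage hJ hΩo hΩs hz, ?_⟩
    apply Complex.ext <;>
      simp [hh_def, hαeven _ _ (hmem z hz), hβodd _ _ (hmem z hz)]
  have hS : 0 ≤ ∑ k, ‖b k‖ := Finset.sum_nonneg fun k _ => norm_nonneg _
  set δ : ℝ := ε / (∑ k, ‖b k‖ + 1) with hδ_def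
  have hδ : 0 < δ := by positivity
  choose a N haN using fun k =>
    exists_real_laurent_approx hc hci hDo hDs hD0 hcr (hcont k) (hconj k) hδ
  set n := Finset.univ.sup N
  refine ⟨n, n, fun j => ∑ k, a k j • b k, fun q hq => ?_⟩
  obtain ⟨I, hI, hqI⟩ := exists_eq_sliceEmbedding_sliceProj q
  set z := sliceProj q
  have hz : z ∈ frontier D := (hfr I hI z).1 (hqI ▸ hq)
  have hfq : f q = ∑ k, sliceEmbedding I hI (h k z) * b k := by
    rw [hqI, sliceEmbedding_apply, hf I hI, add_mul_eq_sum_sliceEmbedding_mul hI b]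
    rwa [← sliceEmbedding_apply hI, ← hqI]
  rw [hfq, hqI, sum_zpow_mul_eq_sum_sliceEmbedding_mul hI, ← Finset.sum_sub_distrib]
  calc _ ≤ ∑ k, δ * ‖b k‖ := by
        refine norm_sum_le_of_le _ fun k _ => ?_
        rw [← sub_mul, ← map_sub, norm_mul, norm_sliceEmbedding]
        exact mul_le_mul_of_nonneg_right
          (haN k n (Finset.le_sup (Finset.mem_univ k)) z hz).le (norm_nonneg _)
    _ = δ * ∑ k, ‖b k‖ := by rw [Finset.mul_sum]
    _ < δ * (∑ k, ‖b k‖ + 1) := by gcongr; linarith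
    _ = ε := by rw [hδ_def]; field_simp
end
end
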